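/- Let D₁, D₂ be semilocal Prüfer domains, and suppose there is an order isomorphism ν : hiSpec(D₁) → hiSpec(D₂) such that: (1) for every P ∈ hiSpec(D₁), there is an order isomorphism ν_P : FStar(Z(P)) → FStar(Z(ν(P))); and (2) for every M ∈ Max(D₁), the maximal ideal M(D₁)_M of (D₁)_M is principal if and only if the maximal ideal ν(M)(D₂)_{ν(M)} of (D₂)_{ν(M)} is principal. Then the order isomorphisms 𝛎 : SStar(D₁) → SStar(D₂) and 𝛎_F : FStar(D₁) → FStar(D₂) obtained from hypothesis (1) restrict to order isomorphisms between the sets of (semi)star operations on D₁ and on D₂ and between Star(D₁) and Star(D₂). -/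

import Mathlib

/- Common background: Prüfer domains, semistar and (fractional) star operations,
standard decomposition, skeleton, supports, `hiSpec`, the rings `Z(P)`,
and the invariants `ω` and `ε`, following Spirito,
"Semistar operations on semilocal Prüfer domains". -/

set_option linter.unusedSectionVars false
set_option maxHeartbeats 1000000

open Pointwise

noncomputable section

namespace Paper

variable (D : Type*) [CommRing D] [IsDomain D]
variable (K : Type*) [Field K] [Algebra D K] [IsFractionRing D K]

/-- The localization of `D` at a prime ideal `P`, viewed as an overring of `D`
inside its quotient field `K`. -/
def locAt (P : Ideal D) (hP : P.IsPrime) : Subalgebra D K :=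
  Localization.subalgebra K (@Ideal.primeCompl D _ P hP)
    (fun _ hx => mem_nonZeroDivisors_of_ne_zero fun h => hx (h ▸ P.zero_mem))

/-- A Prüfer domain: every localization at a prime ideal is a valuation domain
(any two elements are comparable w.r.t. divisibility). -/
def IsPrufer : Prop :=
  ∀ (P : Ideal D) (hP : P.IsPrime), ∀ x y : locAt D K P hP, ∃ z, x * z = y ∨ y * z = x

/-- A semilocal ring: finitely many maximal ideals. -/
def IsSemilocal : Prop := {I : Ideal D | I.IsMaximal}.Finite

/-- Two ideals are dependent if some nonzero prime ideal is contained in both. -/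
def Dependent (M N : Ideal D) : Prop :=
  ∃ P : Ideal D, P.IsPrime ∧ P ≠ ⊥ ∧ P ≤ M ∧ P ≤ N

/-- The member of the standard decomposition corresponding to the dependence class
of the maximal ideal `M`: the intersection of the localizations of `D` at the
maximal ideals dependent on `M`. -/
def TOf (M : Ideal D) : Subalgebra D K :=
  sInf {A | ∃ (N : Ideal D) (hN : N.IsMaximal), Dependent D M N ∧ A = locAt D K N hN.isPrime}

/-- The standard decomposition of `D`. -/
def stdDecomp : Set (Subalgebra D K) :=
  {T | ∃ M : Ideal D, M.IsMaximal ∧ T = TOf D K M}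

/-- The skeleton of `Over(D)`: all intersections of subsets of the standard
decomposition (including the empty intersection `K` and the total one `D`). -/
def SkOver : Set (Subalgebra D K) :=
  {A | ∃ S ⊆ stdDecomp D K, A = sInf S}

/-- `I` is a fractional ideal of the overring `A` of `D`: it is an `A`-submodule
of `K` and `dI ⊆ A` for some nonzero `d ∈ K`. -/
def IsFracOf (A : Subalgebra D K) (I : Submodule D K) : Prop :=
  (∀ a ∈ A, ∀ x ∈ I, a * x ∈ I) ∧ ∃ d : K, d ≠ 0 ∧ ∀ x ∈ I, d * x ∈ A

end Paper

namespace Paper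

/-- A semistar operation on a domain `R` with quotient field `K`: an extensive,
order-preserving, idempotent self-map of the set of `R`-submodules of `K` such
that `(xI)^⋆ = x·I^⋆` for every nonzero `x ∈ K`. -/
structure Semistar (R : Type*) [CommRing R] (K : Type*) [Field K] [Algebra R K] where
  toFun : Submodule R K → Submodule R K
  le_star' : ∀ I, I ≤ toFun I
  mono' : ∀ ⦃I J⦄, I ≤ J → toFun I ≤ toFun J
  idem' : ∀ I, toFun (toFun I) = toFun I
  smul' : ∀ (x : K), x ≠ 0 → ∀ I,
    toFun (Submodule.span R {x} * I) = Submodule.span R {x} * toFun I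

namespace Semistar

variable {R : Type*} [CommRing R] {K : Type*} [Field K] [Algebra R K]

theorem ext' {s t : Semistar R K} (h : s.toFun = t.toFun) : s = t := by
  cases s; cases t; cases h; rfl

instance : PartialOrder (Semistar R K) where
  le s t := ∀ I, s.toFun I ≤ t.toFun I
  le_refl _ _ := le_rfl
  le_trans _ _ _ hab hbc I := (hab I).trans (hbc I)
  le_antisymm _ _ h h' := ext' (funext fun I => le_antisymm (h I) (h' I))

end Semistar

/-- The identity semistar operation `d`. -/
def dOp (R : Type*) [CommRing R] (K : Type*) [Field K] [Algebra R K] : Semistar R K where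
  toFun I := I
  le_star' _ := le_rfl
  mono' _ _ h := h
  idem' _ := rfl
  smul' _ _ _ := rfl

end Paper

namespace Paper

variable (D : Type*) [CommRing D] [IsDomain D]
variable (K : Type*) [Field K] [Algebra D K] [IsFractionRing D K]

/-- A fractional star operation on an overring `A` of `D` (inside `K`): a
semistar-like closure operation defined on the fractional ideals of `A`.
In particular `FracStar D K ⊥` is the set of fractional star operations on `D`. -/
structure FracStar (A : Subalgebra D K) where
  toFun : {I : Submodule D K // IsFracOf D K A I} → {I : Submodule D K // IsFracOf D K A I}
  le_star' : ∀ I, I.1 ≤ (toFun I).1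
  mono' : ∀ I J, I.1 ≤ J.1 → (toFun I).1 ≤ (toFun J).1
  idem' : ∀ I, toFun (toFun I) = toFun I
  smul' : ∀ (x : K), x ≠ 0 → ∀ I J, J.1 = Submodule.span D {x} * I.1 →
    (toFun J).1 = Submodule.span D {x} * (toFun I).1

namespace FracStar

variable {D K} {A : Subalgebra D K}

theorem ext' {s t : FracStar D K A} (h : s.toFun = t.toFun) : s = t := by
  cases s; cases t; cases h; rfl

instance : PartialOrder (FracStar D K A) where
  le s t := ∀ I, (s.toFun I).1 ≤ (t.toFun I).1
  le_refl _ _ := le_rfl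
  le_trans _ _ _ hab hbc I := (hab I).trans (hbc I)
  le_antisymm _ _ h h' := ext' (funext fun I => Subtype.ext (le_antisymm (h I) (h' I)))

end FracStar

/-- A fractional star operation on the overring `A` is a *star operation* if it
closes `A` itself. -/
def FracStar.IsStarOp {A : Subalgebra D K} (f : FracStar D K A) : Prop :=
  ∀ h : IsFracOf D K A (Subalgebra.toSubmodule A),
    (f.toFun ⟨Subalgebra.toSubmodule A, h⟩).1 = Subalgebra.toSubmodule A

/-- The support of a semistar operation on `D`: the elements `A` of the skeleton
such that `A^⋆` is a fractional ideal of `A`. -/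
def supp (s : Semistar D K) : Set (Subalgebra D K) :=
  {A | A ∈ SkOver D K ∧ IsFracOf D K A (s.toFun (Subalgebra.toSubmodule A))}

/-- The image of an ideal of `D` inside `K`. -/
def idealToK (P : Ideal D) : Submodule D K := Submodule.map (Algebra.linearMap D K) P

end Paper

namespace Paper

/-- An abstract fractional star operation on a commutative ring `A`, acting on
the fractional ideals of `A` inside its fraction ring. -/
structure AFracStar (A : Type*) [CommRing A] where
  toFun : FractionalIdeal (nonZeroDivisors A) (FractionRing A) →
    FractionalIdeal (nonZeroDivisors A) (FractionRing A)
  le_star' : ∀ I, I ≤ toFun I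
  mono' : ∀ ⦃I J⦄, I ≤ J → toFun I ≤ toFun J
  idem' : ∀ I, toFun (toFun I) = toFun I
  smul' : ∀ (x : FractionRing A), x ≠ 0 → ∀ I,
    toFun (FractionalIdeal.spanSingleton (nonZeroDivisors A) x * I) =
      FractionalIdeal.spanSingleton (nonZeroDivisors A) x * toFun I

namespace AFracStar

variable {A : Type*} [CommRing A]

theorem ext' {s t : AFracStar A} (h : s.toFun = t.toFun) : s = t := by
  cases s; cases t; cases h; rfl

instance : PartialOrder (AFracStar A) where
  le s t := ∀ I, s.toFun I ≤ t.toFun I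
  le_refl _ _ := le_rfl
  le_trans _ _ _ hab hbc I := (hab I).trans (hbc I)
  le_antisymm _ _ h h' := ext' (funext fun I => le_antisymm (h I) (h' I))

end AFracStar

/-- Abstract star operations on `A`: fractional star operations closing `A`. -/
def AStar (A : Type*) [CommRing A] : Type _ := {s : AFracStar A // s.toFun 1 = 1}

instance (A : Type*) [CommRing A] : PartialOrder (AStar A) :=
  inferInstanceAs (PartialOrder {s : AFracStar A // s.toFun 1 = 1})

end Paper

namespace Paper

variable (D : Type*) [CommRing D] [IsDomain D]

/-- `P` is a branching point of `Spec(D)`: the infimum (among the primes) of a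
family of pairwise incomparable primes not containing `P`. -/
def IsBranchPoint (P : Ideal D) : Prop :=
  ∃ S : Set (Ideal D), (∀ Q ∈ S, Q.IsPrime) ∧
    (S.Pairwise fun Q₁ Q₂ => ¬Q₁ ≤ Q₂ ∧ ¬Q₂ ≤ Q₁) ∧ P ∉ S ∧
    (∀ Q ∈ S, P ≤ Q) ∧ ∀ P' : Ideal D, P'.IsPrime → (∀ Q ∈ S, P' ≤ Q) → P' ≤ P

/-- The homeomorphically irreducible tree underlying `Spec(D)`: the zero ideal,
the maximal ideals and the branching points, ordered by inclusion. -/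
def hiSpec : Set (Ideal D) :=
  {P | P.IsPrime ∧ (P = ⊥ ∨ P.IsMaximal ∨ IsBranchPoint D P)}

/-- `Q` is the element of `hiSpec D` directly below `P`. -/
def DirectlyBelow (Q P : Ideal D) : Prop :=
  Q ∈ hiSpec D ∧ P ∈ hiSpec D ∧ Q < P ∧ ∀ R ∈ hiSpec D, Q < R → ¬R < P

/-- The localization of `D` at the prime ideal `P`, as an abstract ring. -/
abbrev locRing (P : Ideal D) (hP : P.IsPrime) : Type _ :=
  Localization (@Ideal.primeCompl D _ P hP)

/-- The valuation ring `Z(P) = D_P / Q·D_P`. -/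
abbrev Zring (P Q : Ideal D) (hP : P.IsPrime) : Type _ :=
  locRing D P hP ⧸ Ideal.map (algebraMap D (locRing D P hP)) Q

/-- `ω(P) = |FStar(Z(P))|`, where `Q` is the element of `hiSpec D` directly
below `P`. -/
def omegaAt (P Q : Ideal D) (hP : P.IsPrime) : ℕ :=
  Nat.card (AFracStar (Zring D P Q hP))

open Classical in
/-- `ε(P) = |Star(D_P)| ∈ {1,2}` for a (nonzero) prime `P`. -/
def epsilonOf (A : Ideal D) : ℕ :=
  if h : A.IsPrime then Nat.card (AStar (locRing D A h)) else 0

end Paper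

namespace Paper

theorem mem_hiSpec_prime {D : Type*} [CommRing D] [IsDomain D] {P : Ideal D}
    (h : P ∈ hiSpec D) : P.IsPrime := h.1

theorem maximal_mem_hiSpec {D : Type*} [CommRing D] [IsDomain D] {M : Ideal D}
    (h : M.IsMaximal) : M ∈ hiSpec D := ⟨h.isPrime, Or.inr (Or.inl h)⟩

end Paper

namespace Paper

/-- A closure operator on a poset commuting with the action of `G`. -/
structure EqClosure (G X : Type*) [PartialOrder X] [SMul G X] where
  toFun : X → X
  le_apply : ∀ x, x ≤ toFun x
  mono : ∀ ⦃x y⦄, x ≤ y → toFun x ≤ toFun y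
  idem : ∀ x, toFun (toFun x) = toFun x
  map_smul : ∀ (g : G) x, toFun (g • x) = g • toFun x

namespace EqClosure

variable {G X : Type*} [PartialOrder X] [SMul G X]

instance : CoeFun (EqClosure G X) fun _ => X → X := ⟨toFun⟩

theorem ext' {e f : EqClosure G X} (h : ∀ x, e x = f x) : e = f := by
  cases e; cases f; congr; exact funext h

instance : PartialOrder (EqClosure G X) where
  le e f := ∀ x, e x ≤ f x
  le_refl _ _ := le_rfl
  le_trans _ _ _ hab hbc x := (hab x).trans (hbc x)
  le_antisymm _ _ hab hba := ext' fun x => le_antisymm (hab x) (hba x)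

/-- The identity closure. -/
def refl (G X : Type*) [PartialOrder X] [SMul G X] : EqClosure G X where
  toFun x := x
  le_apply _ := le_rfl
  mono _ _ h := h
  idem _ := rfl
  map_smul _ _ := rfl

theorem refl_le (e : EqClosure G X) : refl G X ≤ e := e.le_apply

/-- To be closed below `y` it suffices to be below the closed element `y`. -/
theorem apply_le_apply (e : EqClosure G X) {x y : X} (h : x ≤ e y) : e x ≤ e y :=
  (e.mono h).trans_eq (e.idem y)

/-- Transport along an order isomorphism matching the two actions. -/
def congr {G' X' : Type*} [PartialOrder X'] [SMul G' X'] (φ : X ≃o X')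
    (h : ∀ g : G, ∃ g' : G', ∀ x, φ (g • x) = g' • φ x)
    (h' : ∀ g' : G', ∃ g : G, ∀ x, φ (g • x) = g' • φ x) :
    EqClosure G X ≃o EqClosure G' X' where
  toFun e :=
    { toFun := fun y => φ (e (φ.symm y))
      le_apply := fun y => by simpa using φ.monotone (e.le_apply (φ.symm y))
      mono := fun _ _ hxy => φ.monotone (e.mono (φ.symm.monotone hxy))
      idem := fun y => by simp [e.idem]
      map_smul := fun g' y => by
        obtain ⟨g, hg⟩ := h' g'
        have : φ.symm (g' • y) = g • φ.symm y := by
          rw [φ.symm_apply_eq, hg, φ.apply_symm_apply]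
        rw [this, e.map_smul, hg] }
  invFun e :=
    { toFun := fun x => φ.symm (e (φ x))
      le_apply := fun x => by simpa using φ.symm.monotone (e.le_apply (φ x))
      mono := fun _ _ hxy => φ.symm.monotone (e.mono (φ.monotone hxy))
      idem := fun y => by simp [e.idem]
      map_smul := fun g x => by
        obtain ⟨g', hg⟩ := h g
        rw [hg, e.map_smul, φ.symm_apply_eq, hg, φ.apply_symm_apply] }
  left_inv e := ext' fun x => by simp
  right_inv e := ext' fun x => by simp
  map_rel_iff' {e f} := by
    refine ⟨fun hef x => ?_, fun hef y => φ.monotone (hef _)⟩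
    have := hef (φ x)
    simpa using this

theorem congr_apply {G' X' : Type*} [PartialOrder X'] [SMul G' X'] (φ : X ≃o X')
    (h : ∀ g : G, ∃ g' : G', ∀ x, φ (g • x) = g' • φ x)
    (h' : ∀ g' : G', ∃ g : G, ∀ x, φ (g • x) = g' • φ x) (e : EqClosure G X) (x : X) :
    congr φ h h' e (φ x) = φ (e x) :=
  congrArg φ (congrArg e.toFun (φ.symm_apply_apply x))

end EqClosure

/-- An order-reflecting surjection, as an order isomorphism. -/
def orderIsoOfSurjective {α β : Type*} [PartialOrder α] [PartialOrder β] (f : α → β)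
    (hf : ∀ a b, f a ≤ f b ↔ a ≤ b) (hs : Function.Surjective f) : α ≃o β :=
  RelIso.ofSurjective (OrderEmbedding.ofMapLEIff f hf) hs

@[simp] theorem orderIsoOfSurjective_apply {α β : Type*} [PartialOrder α] [PartialOrder β]
    (f : α → β) (hf : ∀ a b, f a ≤ f b ↔ a ≤ b) (hs : Function.Surjective f) (a : α) :
    orderIsoOfSurjective f hf hs a = f a := rfl

instance WithTop.instSMulMap {G Y : Type*} [SMul G Y] : SMul G (WithTop Y) :=
  ⟨fun g => WithTop.map (g • ·)⟩

theorem WithTop.smul_coe {G Y : Type*} [SMul G Y] (g : G) (y : Y) :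
    g • (y : WithTop Y) = ((g • y : Y) : WithTop Y) := rfl

theorem WithTop.smul_top {G Y : Type*} [SMul G Y] (g : G) : g • (⊤ : WithTop Y) = ⊤ := rfl

/-- Evaluation of a closure, with `⊤` standing for the constant closure `⊤`. -/
def evalTop {G Y : Type*} [PartialOrder Y] [SMul G Y] :
    WithTop (EqClosure G Y) → WithTop Y → WithTop Y :=
  WithTop.map₂ fun e y => e y

section evalTop
variable {G Y : Type*} [PartialOrder Y] [SMul G Y]

@[simp] theorem evalTop_coe_coe (e : EqClosure G Y) (y : Y) :
    evalTop (e : WithTop (EqClosure G Y)) (y : WithTop Y) = (e y : Y) := rfl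
@[simp] theorem evalTop_top_left (y : WithTop Y) :
    evalTop (⊤ : WithTop (EqClosure G Y)) y = ⊤ := by cases y <;> rfl
@[simp] theorem evalTop_top_right (e : WithTop (EqClosure G Y)) : evalTop e ⊤ = ⊤ := by
  cases e <;> rfl

theorem evalTop_mono {e f : WithTop (EqClosure G Y)} {y z : WithTop Y} (h : e ≤ f)
    (h' : y ≤ z) : evalTop e y ≤ evalTop f z := by
  induction f using WithTop.recTopCoe with
  | top => simp
  | coe f =>
    induction z using WithTop.recTopCoe with
    | top => simp
    | coe z =>
      obtain ⟨e, rfl, he⟩ := WithTop.le_coe_iff.1 h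
      obtain ⟨y, rfl, hy⟩ := WithTop.le_coe_iff.1 h'
      rw [evalTop_coe_coe, evalTop_coe_coe, WithTop.coe_le_coe]
      exact (e.mono hy).trans (he z)

theorem le_evalTop (e : WithTop (EqClosure G Y)) (y : WithTop Y) : y ≤ evalTop e y := by
  cases e <;> cases y <;> simp [EqClosure.le_apply]

theorem evalTop_idem (e : WithTop (EqClosure G Y)) (y : WithTop Y) :
    evalTop e (evalTop e y) = evalTop e y := by
  cases e <;> cases y <;> simp [EqClosure.idem]

theorem evalTop_smul (e : WithTop (EqClosure G Y)) (g : G) (y : WithTop Y) :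
    evalTop e (g • y) = g • evalTop e y := by
  cases e <;> cases y <;> simp [WithTop.smul_coe, WithTop.smul_top, EqClosure.map_smul]

theorem evalTop_ne_top {e : WithTop (EqClosure G Y)} {y : WithTop Y} :
    evalTop e y ≠ ⊤ ↔ e ≠ ⊤ ∧ y ≠ ⊤ := by
  cases e <;> cases y <;> simp

end evalTop

/-- Compatible families of elements of the `A i`, indexed by subsets of `ι`, with `⊤` as
an absorbing value: the combinatorial shape of an equivariant closure on a product of
posets with top. -/
structure SupportedFamily {ι : Type*} (A : ι → Type*) [∀ i, PartialOrder (A i)] where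
  val : Set ι → ∀ i, WithTop (A i)
  eq_top : ∀ S i, i ∉ S → val S i = ⊤
  anti : ∀ S S', S ⊆ S' → ∀ i, val S' i ≤ val S i
  stable : ∀ S i, val {j | val S j ≠ ⊤} i = val S i

namespace SupportedFamily
variable {ι ι' : Type*} {A : ι → Type*} {B : ι' → Type*} [∀ i, PartialOrder (A i)]
  [∀ i, PartialOrder (B i)]

theorem ext' {g g' : SupportedFamily A} (h : ∀ S i, g.val S i = g'.val S i) : g = g' := by
  cases g; cases g'; congr; exact funext fun S => funext (h S)

instance : PartialOrder (SupportedFamily A) where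
  le g g' := ∀ S i, g.val S i ≤ g'.val S i
  le_refl _ _ _ := le_rfl
  le_trans _ _ _ hab hbc S i := (hab S i).trans (hbc S i)
  le_antisymm _ _ hab hba := ext' fun S i => le_antisymm (hab S i) (hba S i)

/-- The underlying function of a reindexed family. -/
def reindexFun (σ : ι ≃ ι') (e : ∀ i, A i ≃o B (σ i)) (g : Set ι → ∀ i, WithTop (A i)) :
    Set ι' → ∀ j, WithTop (B j) := fun S' =>
  (Equiv.piCongrLeft (fun j => WithTop (B j)) σ) fun i => (e i).withTopCongr (g (σ ⁻¹' S') i)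

theorem reindexFun_apply (σ : ι ≃ ι') (e : ∀ i, A i ≃o B (σ i))
    (g : Set ι → ∀ i, WithTop (A i)) (S' : Set ι') (i : ι) :
    reindexFun σ e g S' (σ i) = (e i).withTopCongr (g (σ ⁻¹' S') i) :=
  Equiv.piCongrLeft_apply_apply (fun j => WithTop (B j)) σ _ i

/-- Reindexing of compatible families. -/
def congr (σ : ι ≃ ι') (e : ∀ i, A i ≃o B (σ i)) : SupportedFamily A ≃o SupportedFamily B :=
  orderIsoOfSurjective
    (fun g =>
      { val := reindexFun σ e g.val
        eq_top := fun S' j hj => by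
          obtain ⟨i, rfl⟩ := σ.surjective j
          rw [reindexFun_apply, g.eq_top _ _ (by exact hj), OrderIso.map_top]
        anti := fun S S' h j => by
          obtain ⟨i, rfl⟩ := σ.surjective j
          rw [reindexFun_apply, reindexFun_apply]
          exact (OrderIso.monotone _) (g.anti _ _ (Set.preimage_mono h) i)
        stable := fun S' j => by
          obtain ⟨i, rfl⟩ := σ.surjective j
          rw [reindexFun_apply, reindexFun_apply, ← g.stable (σ ⁻¹' S')]
          congr 2
          ext k
          simp only [Set.mem_preimage, Set.mem_ofPred_eq, reindexFun_apply, ne_eq,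
            map_eq_top_iff] })
    (fun g g' => by
      constructor
      · intro h S i
        have := h (σ '' S) (σ i)
        dsimp only at this
        rwa [reindexFun_apply, reindexFun_apply, OrderIso.le_iff_le,
          Set.preimage_image_eq _ σ.injective] at this
      · intro h S j
        obtain ⟨i, rfl⟩ := σ.surjective j
        dsimp only
        rw [reindexFun_apply, reindexFun_apply]
        exact (OrderIso.monotone _) (h _ _))
    (fun g => by
      refine ⟨⟨fun S i => (e i).withTopCongr.symm (g.val (σ '' S) (σ i)), ?_, ?_, ?_⟩, ?_⟩
      · intro S i hi
        rw [g.eq_top _ _ (fun h => hi (σ.injective.mem_set_image.1 h)), OrderIso.map_top]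
      · intro S S' h i
        exact (OrderIso.monotone _) (g.anti _ _ (Set.image_mono h) _)
      · intro S i
        rw [← g.stable (σ '' S)]
        congr 2
        ext k
        obtain ⟨k, rfl⟩ := σ.surjective k
        simp only [σ.injective.mem_set_image, Set.mem_ofPred_eq, ne_eq, map_eq_top_iff]
      · refine ext' fun S j => ?_
        obtain ⟨i, rfl⟩ := σ.surjective j
        dsimp only
        rw [reindexFun_apply, OrderIso.apply_symm_apply, Set.image_preimage_eq _ σ.surjective])

theorem congr_apply (σ : ι ≃ ι') (e : ∀ i, A i ≃o B (σ i)) (g : SupportedFamily A)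
    (S : Set ι') (i : ι) :
    (congr σ e g).val S (σ i) = (e i).withTopCongr (g.val (σ ⁻¹' S) i) :=
  reindexFun_apply ..

end SupportedFamily
end Paper

namespace Paper

/-- Posets `Y i` on which `G` acts cofinally and independently of each other. -/
structure IndependentActions {ι : Type*} (G : Type*) (Y : ι → Type*) [∀ i, PartialOrder (Y i)]
    [∀ i, SMul G (Y i)] : Prop where
  exists_one : ∃ g : G, ∀ i (y : Y i), g • y = y
  exists_le : ∀ i (y z : Y i), ∃ g : G, y ≤ g • z
  approx : ∀ γ : ι → G, ∃ h : G, ∀ i (y : Y i), h • y = γ i • y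

namespace IndependentActions
variable {ι : Type*} {G : Type*} {Y : ι → Type*} [∀ i, PartialOrder (Y i)]
    [∀ i, SMul G (Y i)] (hG : IndependentActions G Y)
include hG

theorem exists_le_top (i : ι) (y z : WithTop (Y i)) (h : y = ⊤ → z = ⊤) :
    ∃ g : G, y ≤ g • z := by
  induction z using WithTop.recTopCoe with
  | top =>
    obtain ⟨g, -⟩ := hG.exists_one
    exact ⟨g, le_top⟩
  | coe z =>
    induction y using WithTop.recTopCoe with
    | top => simp at h
    | coe y =>
      obtain ⟨g, hg⟩ := hG.exists_le i y z
      exact ⟨g, WithTop.coe_le_coe.2 hg⟩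

theorem exists_one_top : ∃ g : G, ∀ i (y : WithTop (Y i)), g • y = y := by
  obtain ⟨g, hg⟩ := hG.exists_one
  refine ⟨g, fun i y => ?_⟩
  induction y using WithTop.recTopCoe with
  | top => rfl
  | coe y => rw [WithTop.smul_coe, hg]

theorem approx_top (γ : ι → G) : ∃ h : G, ∀ i (y : WithTop (Y i)), h • y = γ i • y := by
  obtain ⟨g, hg⟩ := hG.approx γ
  refine ⟨g, fun i y => ?_⟩
  induction y using WithTop.recTopCoe with
  | top => rfl
  | coe y => rw [WithTop.smul_coe, WithTop.smul_coe, hg]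

/-- A coordinate of the closure depends only on that coordinate and on the set of
coordinates different from `⊤`. -/
theorem apply_le_smul (f : EqClosure G (∀ i, WithTop (Y i))) {t t' : ∀ i, WithTop (Y i)}
    {i : ι} {g : G} (htop : ∀ j, t j = ⊤ → t' j = ⊤) (h : t i ≤ g • t' i) :
    f t i ≤ g • f t' i := by
  classical
  choose γ hγ using fun j => hG.exists_le_top j (t j) (t' j) (htop j)
  obtain ⟨k, hk⟩ := hG.approx_top (Function.update γ i g)
  have hle : t ≤ k • t' := fun j => by
    rw [Pi.smul_apply, hk]
    by_cases hj : j = i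
    · subst hj; simpa using h
    · simpa [hj] using hγ j
  have := f.mono hle i
  rw [f.map_smul, Pi.smul_apply, hk] at this
  simpa using this

theorem apply_le (f : EqClosure G (∀ i, WithTop (Y i))) {t t' : ∀ i, WithTop (Y i)}
    {i : ι} (htop : ∀ j, t j = ⊤ → t' j = ⊤) (h : t i ≤ t' i) : f t i ≤ f t' i := by
  obtain ⟨g, hg⟩ := hG.exists_one_top
  have := hG.apply_le_smul f (g := g) htop (by rwa [hg])
  rwa [hg] at this

theorem apply_eq_top (f : EqClosure G (∀ i, WithTop (Y i))) {t t' : ∀ i, WithTop (Y i)}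
    {i : ι} (htop : ∀ j, t j = ⊤ → t' j = ⊤) (h : f t i = ⊤) : f t' i = ⊤ := by
  obtain ⟨g, hg⟩ := hG.exists_le_top i (t i) (t' i) (htop i)
  have := hG.apply_le_smul f htop hg
  rw [h, top_le_iff] at this
  revert this
  induction f t' i using WithTop.recTopCoe with
  | top => intro; rfl
  | coe y => intro h; exact absurd h (WithTop.coe_ne_top)

omit hG in
/-- The closure of a product of posets with top given by a compatible family. -/
def ofFamily (g : SupportedFamily fun i => EqClosure G (Y i)) :
    EqClosure G (∀ i, WithTop (Y i)) where
  toFun t i := evalTop (g.val {j | t j ≠ ⊤} i) (t i)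
  le_apply t i := le_evalTop _ _
  mono t t' h i := evalTop_mono
    (g.anti _ _ (fun j (hj : t' j ≠ ⊤) => ne_top_of_le_ne_top hj (h j)) i) (h i)
  idem t := by
    funext i
    have : {j | evalTop (g.val {j | t j ≠ ⊤} j) (t j) ≠ ⊤} =
        {j | g.val {j | t j ≠ ⊤} j ≠ ⊤} := by
      ext j
      simp only [Set.mem_ofPred_eq, evalTop_ne_top]
      refine ⟨fun h => h.1, fun h => ⟨h, fun ht => h (g.eq_top _ _ ?_)⟩⟩
      simpa using ht
    dsimp only
    rw [this, g.stable, evalTop_idem]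
  map_smul h t := by
    funext i
    have : {j | (h • t) j ≠ ⊤} = {j | t j ≠ ⊤} := by
      ext j
      simp only [Set.mem_ofPred_eq, Pi.smul_apply]
      induction t j using WithTop.recTopCoe with
      | top => rfl
      | coe y => simp [WithTop.smul_coe]
    rw [this, Pi.smul_apply, evalTop_smul, Pi.smul_apply]

omit hG in
theorem ofFamily_apply (g : SupportedFamily fun i => EqClosure G (Y i))
    (t : ∀ i, WithTop (Y i)) (i : ι) :
    ofFamily g t i = evalTop (g.val {j | t j ≠ ⊤} i) (t i) := rfl

open Classical in
omit hG in
/-- The base point supported on `S`. -/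
def basePoint (b : ∀ i, Y i) (S : Set ι) (i : ι) : WithTop (Y i) := if i ∈ S then (b i : WithTop (Y i)) else ⊤

omit hG [∀ i, PartialOrder (Y i)] [∀ i, SMul G (Y i)] in
theorem setOf_basePoint_ne_top (b : ∀ i, Y i) (S : Set ι) :
    {i | basePoint b S i ≠ ⊤} = S := by
  ext i
  simp [basePoint]

omit hG in
theorem ofFamily_le_iff (b : ∀ i, Y i) (g g' : SupportedFamily fun i => EqClosure G (Y i)) :
    ofFamily g ≤ ofFamily g' ↔ g ≤ g' := by
  classical
  refine ⟨fun h S i => ?_, fun h t i => evalTop_mono (h _ _) le_rfl⟩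
  by_cases hi : i ∈ S
  · have key : ∀ y : Y i, evalTop (g.val S i) y ≤ evalTop (g'.val S i) y := fun y => by
      have := h (Function.update (basePoint b S) i y) i
      have hS : {j | Function.update (basePoint b S) i (y : WithTop (Y i)) j ≠ ⊤} = S := by
        ext j
        by_cases hj : j = i
        · subst hj; simp [hi]
        · simp [hj, basePoint]
      rw [ofFamily_apply, ofFamily_apply, hS] at this
      simpa using this
    revert key
    induction g'.val S i using WithTop.recTopCoe with
    | top => intro; exact le_top
    | coe e' =>
      induction g.val S i using WithTop.recTopCoe with
      | top => intro key; simpa using key (b i)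
      | coe e => intro key; exact WithTop.coe_le_coe.2 fun y => by simpa using key y
  · rw [g'.eq_top _ _ hi]; exact le_top

/-- The coordinate of a closure at `i`, on the stratum of `t`. -/
def coordClosure (f : EqClosure G (∀ i, WithTop (Y i))) (t : ∀ i, WithTop (Y i)) (i : ι)
    (h : f t i ≠ ⊤) : EqClosure G (Y i) := by
  classical
  have hti : t i ≠ ⊤ := ne_top_of_le_ne_top h (f.le_apply t i)
  have htop : ∀ y : Y i, ∀ j, t j = ⊤ ↔ Function.update t i (y : WithTop (Y i)) j = ⊤ :=
    fun y j => by
      by_cases hj : j = i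
      · subst hj; simp [hti]
      · simp [hj]
  have hne : ∀ y : Y i, f (Function.update t i y) i ≠ ⊤ := fun y h' =>
    h (hG.apply_eq_top f (fun j => (htop y j).2) h')
  exact
  { toFun := fun y => (f (Function.update t i y) i).untop (hne y)
    le_apply := fun y => by
      rw [WithTop.le_untop_iff]
      simpa using f.le_apply (Function.update t i (y : WithTop (Y i))) i
    mono := fun y z hyz => by
      rw [WithTop.le_untop_iff, WithTop.coe_untop]
      refine hG.apply_le f (fun j hj => (htop z j).1 ((htop y j).2 hj)) (by simpa using hyz)
    idem := fun y => by
      rw [WithTop.untop_eq_iff, WithTop.coe_untop]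
      refine le_antisymm ?_ ?_
      · conv_rhs => rw [← f.idem]
        refine hG.apply_le f (fun j hj => top_le_iff.1 ?_) (by simp)
        by_cases hji : j = i
        · subst hji; simpa using hj.ge
        · refine le_trans ?_ (f.le_apply _ j)
          simpa [hji] using hj.ge
      · simpa using f.le_apply (Function.update t i (f (Function.update t i y) i)) i
    map_smul := fun g y => by
      rw [WithTop.untop_eq_iff, ← WithTop.smul_coe _ ((f _ i).untop _), WithTop.coe_untop]
      obtain ⟨o, ho⟩ := hG.exists_one_top
      obtain ⟨k, hk⟩ := hG.approx_top (Function.update (fun _ => o) i g)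
      have : Function.update t i ((g • y : Y i) : WithTop (Y i)) =
          k • Function.update t i (y : WithTop (Y i)) := by
        funext j
        rw [Pi.smul_apply, hk]
        by_cases hj : j = i
        · subst hj; simp [WithTop.smul_coe]
        · simp [hj, ho]
      rw [this, f.map_smul, Pi.smul_apply, hk]; simp }

theorem coe_coordClosure (f : EqClosure G (∀ i, WithTop (Y i))) {t t' : ∀ i, WithTop (Y i)}
    {i : ι} (h : f t i ≠ ⊤) (htop : ∀ j, t j = ⊤ ↔ t' j = ⊤) (y : Y i) (hy : t' i = y) :
    ((hG.coordClosure f t i h y : Y i) : WithTop (Y i)) = f t' i := by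
  classical
  have hti : t i ≠ ⊤ := ne_top_of_le_ne_top h (f.le_apply t i)
  have htop' : ∀ j, t j = ⊤ ↔ Function.update t i (y : WithTop (Y i)) j = ⊤ := fun j => by
    by_cases hj : j = i
    · subst hj; simp [hti]
    · simp [hj]
  have e : ((hG.coordClosure f t i h y : Y i) : WithTop (Y i)) =
      f (Function.update t i (y : WithTop (Y i))) i := WithTop.coe_untop ..
  rw [e]
  refine le_antisymm (hG.apply_le f (fun j hj => ?_) (by simp [hy]))
    (hG.apply_le f (fun j hj => ?_) (by simp [hy]))
  · exact (htop j).1 ((htop' j).2 hj)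
  · exact (htop' j).1 ((htop j).2 hj)

theorem ofFamily_surjective (b : ∀ i, Y i) :
    Function.Surjective (ofFamily (G := G) (Y := Y)) := by
  classical
  intro f
  let v : Set ι → ∀ i, WithTop (EqClosure G (Y i)) := fun S i =>
    if h : f (basePoint b S) i = ⊤ then ⊤ else hG.coordClosure f (basePoint b S) i h
  have hv : ∀ S i, v S i ≠ ⊤ ↔ f (basePoint b S) i ≠ ⊤ := fun S i => by
    by_cases h : f (basePoint b S) i = ⊤ <;> simp [v, h]
  have htop : ∀ (t : ∀ i, WithTop (Y i)) j, basePoint b {i | t i ≠ ⊤} j = ⊤ ↔ t j = ⊤ :=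
    fun t j => by simp [basePoint]
  have eval : ∀ (t : ∀ i, WithTop (Y i)) i,
      evalTop (v {j | t j ≠ ⊤} i) (t i) = f t i := fun t i => by
    by_cases h : f (basePoint b {j | t j ≠ ⊤}) i = ⊤
    · rw [hG.apply_eq_top f (fun j => (htop t j).1) h]
      simp [v, h]
    · have hti : t i ≠ ⊤ := fun h' =>
        ne_top_of_le_ne_top h (f.le_apply _ i) ((htop t i).2 h')
      obtain ⟨y, hy⟩ := WithTop.ne_top_iff_exists.1 hti
      rw [← hG.coe_coordClosure f h (htop t) y hy.symm, ← hy]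
      simp [v, h]
  have evalS : ∀ S i (y : Y i), i ∈ S →
      evalTop (v S i) y = f (Function.update (basePoint b S) i (y : WithTop (Y i))) i := by
    intro S i y hi
    rw [← eval]
    have : {j | Function.update (basePoint b S) i (y : WithTop (Y i)) j ≠ ⊤} = S := by
      ext j
      by_cases hj : j = i
      · subst hj; simp [hi]
      · simp [hj, basePoint]
    rw [this]; simp
  have le_of : ∀ S S' i, i ∈ S → i ∈ S' → (∀ y : Y i, evalTop (v S i) y ≤ evalTop (v S' i) y) →
      v S i ≤ v S' i := by
    intro S S' i _ _ key
    revert key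
    induction v S' i using WithTop.recTopCoe with
    | top => intro; exact le_top
    | coe e' =>
      induction v S i using WithTop.recTopCoe with
      | top => intro key; simpa using key (b i)
      | coe e => intro key; exact WithTop.coe_le_coe.2 fun y => by simpa using key y
  have hvtop : ∀ S i, i ∉ S → v S i = ⊤ := fun S i hi => by
    by_contra h
    exact ne_top_of_le_ne_top ((hv S i).1 h) (f.le_apply _ i) (by simp [basePoint, hi])
  have hanti : ∀ S S', S ⊆ S' → ∀ i, v S' i ≤ v S i := fun S S' hSS i => by
    by_cases hi : i ∈ S
    · refine le_of _ _ _ (hSS hi) hi fun y => ?_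
      rw [evalS _ _ _ (hSS hi), evalS _ _ _ hi]
      refine hG.apply_le f (fun j => ?_) (by simp)
      by_cases hj : j = i
      · subst hj; simp
      · simpa [hj, basePoint] using fun h h' => h (hSS h')
    · rw [hvtop S i hi]; exact le_top
  refine ⟨⟨v, hvtop, hanti, fun S i => le_antisymm ?_
    (hanti {j | v S j ≠ ⊤} S (fun j hj => by_contra fun h => hj (hvtop S j h)) i)⟩, ?_⟩
  · by_cases hi : v S i = ⊤
    · rw [hi]; exact le_top
    have hiS : i ∈ S := by_contra fun h => hi (hvtop S i h)
    refine le_of _ _ _ hi hiS fun y => ?_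
    rw [evalS _ _ _ hi, evalS _ _ _ hiS]
    conv_rhs => rw [← f.idem]
    refine hG.apply_le f (fun j hj => ?_) ?_
    · have hji : j ≠ i := by rintro rfl; simp at hj
      have : v S j = ⊤ := by simpa [hji, basePoint] using hj
      have h2 : f (basePoint b S) j = ⊤ := by_contra fun h => (hv S j).2 h this
      refine hG.apply_eq_top f (fun k hk => ?_) h2
      have hki : k ≠ i := by rintro rfl; simp [basePoint, hiS] at hk
      simpa [hki] using hk
    · simpa using f.le_apply (Function.update (basePoint b S) i (y : WithTop (Y i))) i
  · exact EqClosure.ext' fun t => funext fun i => eval t i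

/-- Equivariant closures of a product of posets with top, as compatible families. -/
def familyIso (b : ∀ i, Y i) :
    SupportedFamily (fun i => EqClosure G (Y i)) ≃o EqClosure G (∀ i, WithTop (Y i)) :=
  orderIsoOfSurjective ofFamily (ofFamily_le_iff b) (hG.ofFamily_surjective b)

theorem familyIso_apply (b : ∀ i, Y i) (g : SupportedFamily fun i => EqClosure G (Y i))
    (t : ∀ i, WithTop (Y i)) (i : ι) :
    hG.familyIso b g t i = evalTop (g.val {j | t j ≠ ⊤} i) (t i) := rfl

/-- A coordinate of a closure on a product depends only on that coordinate. -/
theorem apply_le_of_coord_le (f : EqClosure G (∀ i, Y i)) {t t' : ∀ i, Y i} {i : ι}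
    (h : t i ≤ t' i) : f t i ≤ f t' i := by
  classical
  obtain ⟨o, ho⟩ := hG.exists_one
  choose γ hγ using fun j => hG.exists_le j (t j) (t' j)
  obtain ⟨k, hk⟩ := hG.approx (Function.update γ i o)
  have hle : t ≤ k • t' := fun j => by
    rw [Pi.smul_apply, hk]
    by_cases hj : j = i
    · subst hj; simpa [ho] using h
    · simpa [hj] using hγ j
  have := f.mono hle i
  rw [f.map_smul, Pi.smul_apply, hk] at this
  simpa [ho] using this

/-- The coordinate at `i` of an equivariant closure on a product. -/
def coord (b : ∀ i, Y i) (f : EqClosure G (∀ i, Y i)) (i : ι) : EqClosure G (Y i) := by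
  classical
  exact
  { toFun := fun y => f (Function.update b i y) i
    le_apply := fun y => by simpa using f.le_apply (Function.update b i y) i
    mono := fun y z hyz => f.mono (update_le_update_iff.2 ⟨hyz, fun _ _ => le_rfl⟩) i
    idem := fun y => by
      refine le_antisymm ?_ (by simpa using f.le_apply (Function.update b i _) i)
      conv_rhs => rw [← f.idem]
      exact hG.apply_le_of_coord_le f (by simp)
    map_smul := fun g y => by
      obtain ⟨o, ho⟩ := hG.exists_one
      obtain ⟨k, hk⟩ := hG.approx (Function.update (fun _ => o) i g)
      have : Function.update b i (g • y) = k • Function.update b i y := by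
        funext j
        rw [Pi.smul_apply, hk]
        by_cases hj : j = i
        · subst hj; simp
        · simp [hj, ho]
      rw [this, f.map_smul, Pi.smul_apply, hk]; simp }

/-- Equivariant closures of a product, as families of equivariant closures. -/
def piIso (b : ∀ i, Y i) : (∀ i, EqClosure G (Y i)) ≃o EqClosure G (∀ i, Y i) :=
  orderIsoOfSurjective
    (fun e =>
      { toFun := fun t i => e i (t i)
        le_apply := fun t i => (e i).le_apply _
        mono := fun t t' h i => (e i).mono (h i)
        idem := fun t => funext fun i => (e i).idem _
        map_smul := fun g t => funext fun i => (e i).map_smul _ _ })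
    (fun e e' => ⟨fun h i y => by
        classical
        simpa using h (Function.update b i y) i, fun h t i => h i _⟩)
    (fun f => by
      classical
      refine ⟨fun i => hG.coord b f i, EqClosure.ext' fun t => funext fun i => ?_⟩
      exact le_antisymm (hG.apply_le_of_coord_le f (by simp))
        (hG.apply_le_of_coord_le f (by simp)))

end IndependentActions
end Paper

namespace Paper

/-- A poset `X` with an action of `G`, glued out of translates of a poset `L` (with an action
of `H`) and a `G`-stable part `W`: the translates of `L` fill the gaps `(P, V]` of `W`. -/
structure Gluing (G H X L W : Type*) [Group G] [PartialOrder X] [PartialOrder L] [PartialOrder W]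
    [MulAction G X] [SMul H L] [MulAction G W] where
  jL : L → X
  jW : W → X
  incl : H → G
  hull : X → W
  P : W
  V : W
  smul_mono : ∀ (g : G) (x y : X), x ≤ y → g • x ≤ g • y
  jL_le : ∀ l l', jL l ≤ jL l' ↔ l ≤ l'
  jW_le : ∀ w w', jW w ≤ jW w' ↔ w ≤ w'
  jL_smul : ∀ (h : H) (l : L), jL (h • l) = incl h • jL l
  jW_smul : ∀ (g : G) (w : W), jW (g • w) = g • jW w
  hull_le : ∀ x w, hull x ≤ w ↔ x ≤ jW w
  lt_jL : ∀ l, jW P < jL l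
  jL_le_V : ∀ l, jL l ≤ jW V
  exists_jL : ∀ x, jW P < x → x ≤ jW V → ∃ l, jL l = x
  P_le_V : P ≤ V
  le_or_le : ∀ w, w ≤ P ∨ V ≤ w
  cover : ∀ x, (∃ w, jW w = x) ∨ ∃ (g : G) (l : L), x = g • jL l
  exists_incl : ∀ g : G, g • V = V → ∃ h, incl h = g
  separate : ∀ w w', ¬ w' ≤ w → ∃ g : G, w ≤ g • P ∧ ¬ w' ≤ g • P
  of_fixed : ∀ x, (∀ h : H, incl h • x = x) → ∃ w, jW w = x
  incl_smul : ∀ (h : H) (w : W), incl h • w = w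

namespace Gluing
variable {G H X L W : Type*} [Group G] [PartialOrder X] [PartialOrder L] [PartialOrder W]
    [MulAction G X] [SMul H L] [MulAction G W] (γ : Gluing G H X L W)
include γ

theorem smul_le_smul (g : G) {x y : X} : g • x ≤ g • y ↔ x ≤ y :=
  ⟨fun h => by simpa using γ.smul_mono g⁻¹ _ _ h, γ.smul_mono g _ _⟩

theorem smul_le_smul' (g : G) {w w' : W} : g • w ≤ g • w' ↔ w ≤ w' := by
  rw [← γ.jW_le, γ.jW_smul, γ.jW_smul, γ.smul_le_smul, γ.jW_le]

theorem jW_injective : Function.Injective γ.jW := fun _ _ h =>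
  le_antisymm ((γ.jW_le _ _).1 h.le) ((γ.jW_le _ _).1 h.ge)

theorem jL_injective : Function.Injective γ.jL := fun _ _ h =>
  le_antisymm ((γ.jL_le _ _).1 h.le) ((γ.jL_le _ _).1 h.ge)

theorem hull_jW (w : W) : γ.hull (γ.jW w) = w :=
  le_antisymm ((γ.hull_le _ _).2 le_rfl) ((γ.jW_le _ _).1 ((γ.hull_le _ _).1 le_rfl))

theorem le_hull (x : X) : x ≤ γ.jW (γ.hull x) := (γ.hull_le _ _).1 le_rfl

theorem hull_mono {x y : X} (h : x ≤ y) : γ.hull x ≤ γ.hull y :=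
  (γ.hull_le _ _).2 (h.trans (γ.le_hull y))

theorem hull_smul (g : G) (x : X) : γ.hull (g • x) = g • γ.hull x := by
  have key : ∀ (g : G) x, γ.hull (g • x) ≤ g • γ.hull x := fun g x => by
    rw [γ.hull_le, γ.jW_smul, γ.smul_le_smul]
    exact γ.le_hull x
  refine le_antisymm (key g x) ?_
  have := key g⁻¹ (g • x)
  rwa [inv_smul_smul, ← γ.smul_le_smul' g, smul_inv_smul] at this

theorem hull_jL (l : L) : γ.hull (γ.jL l) = γ.V := by
  refine le_antisymm ((γ.hull_le _ _).2 (γ.jL_le_V l)) ((γ.le_or_le _).resolve_left fun h => ?_)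
  exact (γ.lt_jL l).not_ge ((γ.hull_le _ _).1 h)

/-- An element of `L` lying in `W` is fixed by every closure. -/
theorem apply_eq_of_jW (s : EqClosure H L) {l : L} {w : W} (h : γ.jW w = γ.jL l) : s l = l := by
  refine le_antisymm ?_ (s.le_apply l)
  have hw : γ.V ≤ w := (γ.le_or_le w).resolve_left fun hw =>
    (γ.lt_jL l).not_ge (h ▸ (γ.jW_le _ _).2 hw)
  rw [← γ.jL_le, ← h]
  exact (γ.jL_le_V _).trans ((γ.jW_le _ _).2 hw)

theorem exists_incl_eq {g g' : G} {l l' : L} (h : γ.hull (g • γ.jL l) = γ.hull (g' • γ.jL l')) :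
    ∃ k : H, g = g' * γ.incl k := by
  rw [γ.hull_smul, γ.hull_smul, γ.hull_jL, γ.hull_jL] at h
  obtain ⟨k, hk⟩ := γ.exists_incl (g'⁻¹ * g) (by rw [mul_smul, h, inv_smul_smul])
  exact ⟨k, by rw [hk, mul_inv_cancel_left]⟩

theorem smul_jL_apply_eq (s : EqClosure H L) {g g' : G} {l l' : L}
    (h : g • γ.jL l = g' • γ.jL l') : g • γ.jL (s l) = g' • γ.jL (s l') := by
  obtain ⟨k, rfl⟩ := γ.exists_incl_eq (congrArg γ.hull h)
  rw [mul_smul] at h ⊢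
  rw [← γ.jL_smul] at h ⊢
  rw [← s.map_smul, γ.jL_injective (smul_left_cancel _ h)]

open Classical in
/-- The extension of a closure on `L` to `X`, by the identity on `W`. -/
def extendFun (s : EqClosure H L) (x : X) : X :=
  if h : ∃ w, γ.jW w = x then x
  else
    let e := (γ.cover x).resolve_left h
    e.choose • γ.jL (s e.choose_spec.choose)

theorem extendFun_jW (s : EqClosure H L) (w : W) : γ.extendFun s (γ.jW w) = γ.jW w :=
  dif_pos ⟨w, rfl⟩

theorem extendFun_smul_jL (s : EqClosure H L) (g : G) (l : L) :
    γ.extendFun s (g • γ.jL l) = g • γ.jL (s l) := by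
  by_cases h : ∃ w, γ.jW w = g • γ.jL l
  · obtain ⟨w, hw⟩ := h
    rw [← hw, extendFun_jW, hw, γ.apply_eq_of_jW s (w := g⁻¹ • w)]
    rw [γ.jW_smul, hw, inv_smul_smul]
  · rw [extendFun, dif_neg h]
    exact γ.smul_jL_apply_eq s ((γ.cover _).resolve_left h).choose_spec.choose_spec.symm

theorem extendFun_eq (s : EqClosure H L) (x : X) :
    (∃ w, x = γ.jW w ∧ γ.extendFun s x = γ.jW w) ∨
      ∃ (g : G) (l : L), x = g • γ.jL l ∧ γ.extendFun s x = g • γ.jL (s l) := by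
  rcases γ.cover x with ⟨w, rfl⟩ | ⟨g, l, rfl⟩
  · exact Or.inl ⟨w, rfl, γ.extendFun_jW s w⟩
  · exact Or.inr ⟨g, l, rfl, γ.extendFun_smul_jL s g l⟩

/-- The extension of a closure on `L` to `X`, by the identity on `W`. -/
def extend (s : EqClosure H L) : EqClosure G X where
  toFun := γ.extendFun s
  le_apply x := by
    rcases γ.extendFun_eq s x with ⟨w, rfl, h⟩ | ⟨g, l, rfl, h⟩ <;> rw [h]
    exact γ.smul_mono _ _ _ ((γ.jL_le _ _).2 (s.le_apply l))
  mono x y hxy := by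
    rcases γ.extendFun_eq s x with ⟨w, rfl, h⟩ | ⟨g, l, rfl, h⟩ <;>
      rcases γ.extendFun_eq s y with ⟨w', rfl, h'⟩ | ⟨g', l', rfl, h'⟩ <;> rw [h, h']
    · exact hxy
    · exact hxy.trans (γ.smul_mono _ _ _ ((γ.jL_le _ _).2 (s.le_apply l')))
    · refine (γ.smul_mono g _ _ (γ.jL_le_V _)).trans ?_
      rw [← γ.jW_smul, γ.jW_le, ← γ.hull_jL l, ← γ.hull_smul, γ.hull_le]
      exact hxy
    · have hle := γ.hull_mono hxy
      by_cases he : γ.hull (g • γ.jL l) = γ.hull (g' • γ.jL l')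
      · obtain ⟨k, rfl⟩ := γ.exists_incl_eq he
        rw [mul_smul, γ.smul_le_smul, ← γ.jL_smul, γ.jL_le] at hxy ⊢
        rw [← s.map_smul]
        exact s.mono hxy
      · rw [γ.hull_smul, γ.hull_smul, γ.hull_jL, γ.hull_jL] at hle he
        have : g'⁻¹ • g • γ.V ≤ γ.P := (γ.le_or_le _).resolve_right fun hV => he <| by
          refine le_antisymm hle ?_
          rwa [← γ.smul_le_smul' g', smul_inv_smul] at hV
        rw [← γ.smul_le_smul' g', smul_inv_smul, ← γ.jW_le, γ.jW_smul, γ.jW_smul] at this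
        exact (γ.smul_mono g _ _ (γ.jL_le_V _)).trans
          (this.trans (γ.smul_mono _ _ _ (γ.lt_jL _).le))
  idem x := by
    rcases γ.extendFun_eq s x with ⟨w, rfl, h⟩ | ⟨g, l, rfl, h⟩ <;> rw [h]
    · exact h
    · rw [extendFun_smul_jL, s.idem]
  map_smul g x := by
    rcases γ.extendFun_eq s x with ⟨w, rfl, h⟩ | ⟨g', l, rfl, h⟩ <;> rw [h]
    · rw [← γ.jW_smul, extendFun_jW]
    · rw [← mul_smul, extendFun_smul_jL, mul_smul]

theorem extend_jW (s : EqClosure H L) (w : W) : γ.extend s (γ.jW w) = γ.jW w :=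
  γ.extendFun_jW s w

theorem extend_jL [Nonempty L] (s : EqClosure H L) (l : L) :
    γ.extend s (γ.jL l) = γ.jL (s l) := by
  have := γ.extendFun_smul_jL s 1 l
  rwa [one_smul, one_smul] at this

/-- The closure on `X` induced by a closure on `W`. -/
def ofHull (φ : EqClosure G W) : EqClosure G X where
  toFun x := γ.jW (φ (γ.hull x))
  le_apply x := (γ.hull_le _ _).1 (φ.le_apply _)
  mono x y h := (γ.jW_le _ _).2 (φ.mono (γ.hull_mono h))
  idem x := by rw [γ.hull_jW, φ.idem]
  map_smul g x := by rw [γ.hull_smul, φ.map_smul, γ.jW_smul]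

theorem ofHull_apply (φ : EqClosure G W) (x : X) : γ.ofHull φ x = γ.jW (φ (γ.hull x)) := rfl

/-- A closure fixing `P` is the identity on `W`. -/
theorem eq_refl_of_apply_P (φ : EqClosure G W) (h : φ γ.P = γ.P) : φ = EqClosure.refl G W := by
  refine EqClosure.ext' fun w => le_antisymm (by_contra fun hw => ?_) (φ.le_apply w)
  obtain ⟨g, hg, hg'⟩ := γ.separate w (φ w) hw
  refine hg' ((φ.mono hg).trans_eq ?_)
  rw [φ.map_smul, h]

theorem exists_jW_apply (f : EqClosure G X) (w : W) : ∃ w', γ.jW w' = f (γ.jW w) :=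
  γ.of_fixed _ fun h => by rw [← f.map_smul, ← γ.jW_smul, γ.incl_smul]

/-- The restriction of a closure on `X` to `W`. -/
def restrict (f : EqClosure G X) : EqClosure G W where
  toFun w := (γ.exists_jW_apply f w).choose
  le_apply w := by
    rw [← γ.jW_le, (γ.exists_jW_apply f w).choose_spec]; exact f.le_apply _
  mono w w' h := by
    rw [← γ.jW_le, (γ.exists_jW_apply f w).choose_spec, (γ.exists_jW_apply f w').choose_spec]
    exact f.mono ((γ.jW_le _ _).2 h)
  idem w := γ.jW_injective <| by
    rw [(γ.exists_jW_apply f _).choose_spec, (γ.exists_jW_apply f w).choose_spec, f.idem]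
  map_smul g w := γ.jW_injective <| by
    rw [(γ.exists_jW_apply f _).choose_spec, γ.jW_smul, γ.jW_smul,
      (γ.exists_jW_apply f w).choose_spec, f.map_smul]

theorem jW_restrict (f : EqClosure G X) (w : W) : γ.jW (γ.restrict f w) = f (γ.jW w) :=
  (γ.exists_jW_apply f w).choose_spec

theorem eq_ofHull (f : EqClosure G X) (hf : γ.restrict f ≠ EqClosure.refl G W) :
    γ.ofHull (γ.restrict f) = f := by
  have hP : γ.V ≤ γ.restrict f γ.P := (γ.le_or_le _).resolve_left fun h =>
    hf (γ.eq_refl_of_apply_P _ (le_antisymm h ((γ.restrict f).le_apply _)))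
  refine EqClosure.ext' fun x => ?_
  rw [γ.ofHull_apply, γ.jW_restrict]
  rcases γ.cover x with ⟨w, rfl⟩ | ⟨g, l, rfl⟩
  · rw [γ.hull_jW]
  · rw [γ.hull_smul, γ.hull_jL, γ.jW_smul, f.map_smul, f.map_smul]
    congr 1
    refine le_antisymm (f.apply_le_apply ?_) (f.mono (γ.jL_le_V l))
    refine ((γ.jW_le _ _).2 hP).trans ?_
    rw [γ.jW_restrict]
    exact f.mono (γ.lt_jL l).le

theorem exists_extend [Nonempty L] (f : EqClosure G X)
    (hf : γ.restrict f = EqClosure.refl G W) : ∃ s, γ.extend s = f := by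
  have hW : ∀ w, f (γ.jW w) = γ.jW w := fun w => by rw [← γ.jW_restrict, hf]; rfl
  have hL : ∀ l, ∃ l', γ.jL l' = f (γ.jL l) := fun l =>
    γ.exists_jL _ ((γ.lt_jL l).trans_le (f.le_apply _)) ((f.mono (γ.jL_le_V l)).trans_eq (hW _))
  choose s hs using hL
  refine ⟨⟨s, fun l => ?_, fun l l' h => ?_, fun l => γ.jL_injective ?_,
    fun h l => γ.jL_injective ?_⟩, EqClosure.ext' fun x => ?_⟩
  · rw [← γ.jL_le, hs]; exact f.le_apply _
  · rw [← γ.jL_le, hs, hs]; exact f.mono ((γ.jL_le _ _).2 h)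
  · rw [hs, hs, f.idem]
  · rw [hs, γ.jL_smul, γ.jL_smul, hs, f.map_smul]
  · rcases γ.cover x with ⟨w, rfl⟩ | ⟨g, l, rfl⟩
    · rw [extend_jW, hW]
    · rw [(γ.extend _).map_smul, extend_jL, f.map_smul, hs]

/-- Equivariant closures on a glued poset. -/
def sumLexIso [Nonempty L] :
    EqClosure H L ⊕ₗ {φ : EqClosure G W // φ ≠ EqClosure.refl G W} ≃o EqClosure G X := by
  refine orderIsoOfSurjective
    (fun c => Sum.elim γ.extend (fun φ => γ.ofHull φ.1) (ofLex c)) ?_ ?_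
  · rintro (s | φ) (s' | φ')
    · refine Iff.trans ?_ Sum.Lex.inl_le_inl_iff.symm
      refine ⟨fun h l => ?_, fun h x => ?_⟩
      · rw [← γ.jL_le, ← γ.extend_jL, ← γ.extend_jL]; exact h _
      · change γ.extendFun s x ≤ γ.extendFun s' x
        rcases γ.cover x with ⟨w, rfl⟩ | ⟨g, l, rfl⟩
        · rw [extendFun_jW, extendFun_jW]
        · rw [extendFun_smul_jL, extendFun_smul_jL]
          exact γ.smul_mono _ _ _ ((γ.jL_le _ _).2 (h l))
    · refine iff_of_true (fun x => ?_) (Sum.Lex.inl_le_inr _ _)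
      change γ.extendFun s x ≤ γ.jW (φ'.1 (γ.hull x))
      rcases γ.cover x with ⟨w, rfl⟩ | ⟨g, l, rfl⟩
      · rw [extendFun_jW, γ.hull_jW, γ.jW_le]
        exact φ'.1.le_apply w
      · rw [extendFun_smul_jL, γ.hull_smul, φ'.1.map_smul, γ.jW_smul, γ.hull_jL]
        exact γ.smul_mono _ _ _ ((γ.jL_le_V _).trans ((γ.jW_le _ _).2 (φ'.1.le_apply _)))
    · refine iff_of_false (fun h => φ.2 (γ.eq_refl_of_apply_P φ.1 ?_)) Sum.Lex.not_inr_le_inl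
      have : γ.jW (φ.1 (γ.hull (γ.jW γ.P))) ≤ γ.extendFun s' (γ.jW γ.P) := h (γ.jW γ.P)
      rw [extendFun_jW, γ.hull_jW, γ.jW_le] at this
      exact le_antisymm this (φ.1.le_apply _)
    · refine Iff.trans ?_ Sum.Lex.inr_le_inr_iff.symm
      refine ⟨fun h w => ?_, fun h x => (γ.jW_le _ _).2 (h _)⟩
      have : γ.jW (φ.1 (γ.hull (γ.jW w))) ≤ γ.jW (φ'.1 (γ.hull (γ.jW w))) := h (γ.jW w)
      rwa [γ.hull_jW, γ.jW_le] at this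
  · intro f
    by_cases hf : γ.restrict f = EqClosure.refl G W
    · obtain ⟨s, rfl⟩ := γ.exists_extend f hf
      exact ⟨toLex (Sum.inl s), rfl⟩
    · exact ⟨toLex (Sum.inr ⟨_, hf⟩), γ.eq_ofHull f hf⟩

theorem sumLexIso_inl [Nonempty L] (s : EqClosure H L) (l : L) :
    γ.sumLexIso (toLex (Sum.inl s)) (γ.jL l) = γ.jL (s l) := γ.extend_jL s l

theorem sumLexIso_inr [Nonempty L] (φ : {φ : EqClosure G W // φ ≠ EqClosure.refl G W}) (x : X) :
    γ.sumLexIso (toLex (Sum.inr φ)) x = γ.jW (φ.1 (γ.hull x)) := rfl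

/-- A nontrivial closure fixing `V` is the least nontrivial closure. -/
theorem le_of_apply_V {φ ψ : EqClosure G W} (hφ : φ γ.V = γ.V)
    (hψ : ψ ≠ EqClosure.refl G W) : φ ≤ ψ := by
  intro w
  by_contra h
  obtain ⟨g, hg, hg'⟩ := γ.separate (ψ w) (φ w) h
  have hwg : w ≤ g • γ.P := (ψ.le_apply w).trans hg
  by_cases hgw : g • γ.P ≤ w
  · obtain rfl := le_antisymm hwg hgw
    refine hψ (γ.eq_refl_of_apply_P ψ (le_antisymm ?_ (ψ.le_apply _)))
    rwa [ψ.map_smul, γ.smul_le_smul'] at hg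
  · obtain ⟨g', hg₁, hg₂⟩ := γ.separate w _ hgw
    have hV : γ.V ≤ g'⁻¹ • g • γ.P := (γ.le_or_le _).resolve_left fun h => hg₂ <| by
      rwa [← γ.smul_le_smul' g', smul_inv_smul] at h
    rw [← γ.smul_le_smul' g', smul_inv_smul] at hV
    refine hg' ((φ.mono (hg₁.trans ((γ.smul_le_smul' g').2 γ.P_le_V))).trans ?_)
    rwa [φ.map_smul, hφ]

end Gluing
end Paper

namespace Paper

/-- A valuation ring of `K` containing the image of `D`. -/
structure ValOver (D K : Type*) [CommRing D] [Field K] [Algebra D K] where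
  ring : ValuationSubring K
  algebraMap_mem : ∀ d, algebraMap D K d ∈ ring

section units
variable {D K : Type*} [CommRing D] [Field K] [Algebra D K]

theorem mem_units_smul_iff (u : Kˣ) (I : Submodule D K) (x : K) :
    x ∈ u • I ↔ (u : K)⁻¹ * x ∈ I := by
  rw [Units.smul_def, Submodule.mem_smul_pointwise_iff_exists]
  constructor
  · rintro ⟨y, hy, rfl⟩
    rwa [smul_eq_mul, inv_mul_cancel_left₀ u.ne_zero]
  · intro h
    exact ⟨_, h, by rw [smul_eq_mul, mul_inv_cancel_left₀ u.ne_zero]⟩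

theorem mem_subgroup_smul_iff {G : Subgroup Kˣ} (u : G) (I : Submodule D K) (x : K) :
    x ∈ u • I ↔ ((u : Kˣ) : K)⁻¹ * x ∈ I := mem_units_smul_iff u.1 I x

theorem span_singleton_mul_eq_smul (u : Kˣ) (I : Submodule D K) :
    Submodule.span D {(u : K)} * I = u • I := by
  ext x
  rw [Submodule.mem_span_singleton_mul, Units.smul_def, Submodule.mem_smul_pointwise_iff_exists]
  rfl

end units

namespace ValOver
variable {D K : Type*} [CommRing D] [Field K] [Algebra D K]

instance : LE (ValOver D K) := ⟨fun A B => A.ring ≤ B.ring⟩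

/-- The valuation. -/
abbrev v (A : ValOver D K) : Valuation K A.ring.ValueGroup := A.ring.valuation

/-- The group of units. -/
abbrev units (A : ValOver D K) : Subgroup Kˣ := A.ring.unitGroup

theorem v_algebraMap_le (A : ValOver D K) (d : D) : A.v (algebraMap D K d) ≤ 1 :=
  (A.ring.valuation_le_one_iff _).2 (A.algebraMap_mem d)

theorem v_smul_le (A : ValOver D K) (d : D) (x : K) : A.v (d • x) ≤ A.v x := by
  rw [Algebra.smul_def, map_mul]
  exact mul_le_of_le_one_left' (A.v_algebraMap_le d)

/-- The valuation ring as a `D`-module. -/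
def toMod (A : ValOver D K) : Submodule D K where
  carrier := {x | A.v x ≤ 1}
  add_mem' {x y} hx hy := by
    have hx : A.v x ≤ 1 := hx
    have hy : A.v y ≤ 1 := hy
    exact (A.v.map_add _ _).trans (max_le hx hy)
  zero_mem' := by simp
  smul_mem' d x hx := by
    have hx : A.v x ≤ 1 := hx
    exact (A.v_smul_le d x).trans hx

/-- The maximal ideal as a `D`-module. -/
def maxMod (A : ValOver D K) : Submodule D K where
  carrier := {x | A.v x < 1}
  add_mem' {x y} hx hy := by
    have hx : A.v x < 1 := hx
    have hy : A.v y < 1 := hy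
    exact (A.v.map_add _ _).trans_lt (max_lt hx hy)
  zero_mem' := by simp
  smul_mem' d x hx := by
    have hx : A.v x < 1 := hx
    exact (A.v_smul_le d x).trans_lt hx

variable {A B : ValOver D K}

theorem mem_toMod {x : K} : x ∈ A.toMod ↔ A.v x ≤ 1 := Iff.rfl
theorem mem_maxMod {x : K} : x ∈ A.maxMod ↔ A.v x < 1 := Iff.rfl
theorem mem_toMod_iff_mem_ring {x : K} : x ∈ A.toMod ↔ x ∈ A.ring :=
  A.ring.valuation_le_one_iff x

theorem mem_units {u : Kˣ} : u ∈ A.units ↔ A.v (u : K) = 1 := A.ring.mem_unitGroup_iff u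

theorem v_unit (u : A.units) : A.v ((u : Kˣ) : K) = 1 := mem_units.1 u.2

theorem ne_zero_of_v_eq_one {x : K} (h : A.v x = 1) : x ≠ 0 := by
  rintro rfl; simp at h

/-- An element of value one, as a unit. -/
def mkUnit (x : K) (h : A.v x = 1) : A.units :=
  ⟨Units.mk0 x (ne_zero_of_v_eq_one h), mem_units.2 h⟩

@[simp] theorem coe_mkUnit (x : K) (h : A.v x = 1) : ((mkUnit x h : A.units) : Kˣ) = (x : K) := rfl

theorem maxMod_lt_toMod (A : ValOver D K) : A.maxMod < A.toMod :=
  SetLike.lt_iff_le_and_exists.2 ⟨fun x h => le_of_lt (show A.v x < 1 from h), 1, by simp [mem_toMod], by simp [mem_maxMod]⟩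

theorem toMod_le_toMod (h : A ≤ B) : A.toMod ≤ B.toMod := fun _ hx =>
  mem_toMod_iff_mem_ring.2 (h (mem_toMod_iff_mem_ring.1 hx))

theorem le_of_toMod_le_toMod (h : A.toMod ≤ B.toMod) : A ≤ B := fun _ hx =>
  mem_toMod_iff_mem_ring.1 (h (mem_toMod_iff_mem_ring.2 hx))

theorem v_inv_lt_one_iff {x : K} (hx : x ≠ 0) : A.v x⁻¹ < 1 ↔ 1 < A.v x := by
  rw [map_inv₀, inv_lt_one₀ (zero_lt_iff.2 ((A.v.ne_zero_iff).2 hx))]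

theorem maxMod_le_maxMod (h : A ≤ B) : B.maxMod ≤ A.maxMod := fun x hx => by
  by_cases h0 : x = 0
  · subst h0; exact zero_mem _
  · rw [mem_maxMod] at hx ⊢
    rw [← inv_inv x, v_inv_lt_one_iff (inv_ne_zero h0)] at hx ⊢
    exact lt_of_not_ge fun hle => hx.not_ge (toMod_le_toMod h hle)

theorem units_le_units (h : A ≤ B) : A.units ≤ B.units :=
  ValuationSubring.unitGroup_le_unitGroup.2 h

/-- `I` is stable under multiplication by the valuation ring. -/
def Stable (A : ValOver D K) (I : Submodule D K) : Prop :=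
  ∀ a x, A.v a ≤ 1 → x ∈ I → a * x ∈ I

/-- `I` is stable under multiplication by the maximal ideal. -/
def MaxStable (A : ValOver D K) (I : Submodule D K) : Prop :=
  ∀ a x, A.v a < 1 → x ∈ I → a * x ∈ I

theorem Stable.maxStable {I : Submodule D K} (h : A.Stable I) : A.MaxStable I :=
  fun a x ha hx => h a x ha.le hx

theorem Stable.mem_of_le {I : Submodule D K} (h : A.Stable I) {x y : K} (hx : x ∈ I)
    (hxy : A.v y ≤ A.v x) : y ∈ I := by
  by_cases h0 : x = 0
  · subst h0
    rw [map_zero, le_zero_iff, map_eq_zero] at hxy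
    subst hxy; exact hx
  · have := h (y / x) x (by rw [map_div₀]; exact div_le_one_of_le₀ hxy zero_le) hx
    rwa [div_mul_cancel₀ _ h0] at this

theorem MaxStable.mem_of_lt {I : Submodule D K} (h : A.MaxStable I) {x y : K} (hx : x ∈ I)
    (hxy : A.v y < A.v x) : y ∈ I := by
  have h0 : x ≠ 0 := by rintro rfl; simp at hxy
  have := h (y / x) x (by
    rw [map_div₀]
    exact (div_lt_one₀ (zero_lt_iff.2 ((A.v.ne_zero_iff).2 h0))).2 hxy) hx
  rwa [div_mul_cancel₀ _ h0] at this

theorem stable_toMod : A.Stable A.toMod := fun a x ha hx => by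
  rw [mem_toMod, map_mul]; exact mul_le_one' ha hx

theorem stable_maxMod : A.Stable A.maxMod := fun a x ha hx => by
  rw [mem_maxMod, map_mul]; exact (mul_le_of_le_one_left' ha).trans_lt hx

theorem Stable.anti {I : Submodule D K} (hI : B.Stable I) (h : A ≤ B) : A.Stable I :=
  fun a x ha hx => hI a x (toMod_le_toMod h ha) hx

theorem Stable.smul {I : Submodule D K} (hI : A.Stable I) (u : Kˣ) : A.Stable (u • I) :=
  fun a x ha hx => by
    rw [mem_units_smul_iff] at hx ⊢
    rw [mul_left_comm]; exact hI _ _ ha hx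

theorem MaxStable.smul {I : Submodule D K} (hI : A.MaxStable I) (u : Kˣ) : A.MaxStable (u • I) :=
  fun a x ha hx => by
    rw [mem_units_smul_iff] at hx ⊢
    rw [mul_left_comm]; exact hI _ _ ha hx

theorem Stable.smul_eq {I : Submodule D K} (hI : A.Stable I) {u : Kˣ} (hu : u ∈ A.units) :
    u • I = I := by
  have hu' := mem_units.1 hu
  ext x
  rw [mem_units_smul_iff]
  refine ⟨fun h => ?_, fun h => ?_⟩ <;> refine hI.mem_of_le h ?_ <;> simp [hu']

theorem units_smul_le_units_smul (u : Kˣ) {I J : Submodule D K} (h : I ≤ J) : u • I ≤ u • J :=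
  fun x hx => by rw [mem_units_smul_iff] at hx ⊢; exact h hx

theorem units_smul_lt_units_smul (u : Kˣ) {I J : Submodule D K} (h : I < J) : u • I < u • J := by
  refine lt_of_le_not_ge (units_smul_le_units_smul u h.le) fun hle => h.not_ge ?_
  have := units_smul_le_units_smul u⁻¹ hle
  rwa [inv_smul_smul, inv_smul_smul] at this

variable (A B)

/-- The modules strictly above the maximal ideal and contained in the valuation ring. -/
def window : SubMulAction A.units (Submodule D K) where
  carrier := {I | A.maxMod < I ∧ I ≤ A.toMod}
  smul_mem' u _ h :=
    ⟨(stable_maxMod.smul_eq u.2).symm.trans_lt (units_smul_lt_units_smul u.1 h.1),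
      (units_smul_le_units_smul u.1 h.2).trans_eq (stable_toMod.smul_eq u.2)⟩

/-- The modules strictly between the maximal ideal of `B` and `B`, stable under the maximal
ideal of `A`. -/
def strictWindow : SubMulAction B.units (Submodule D K) where
  carrier := {I | (B.maxMod < I ∧ I < B.toMod) ∧ A.MaxStable I}
  smul_mem' u _ h :=
    ⟨⟨(stable_maxMod.smul_eq u.2).symm.trans_lt (units_smul_lt_units_smul u.1 h.1.1),
      (units_smul_lt_units_smul u.1 h.1.2).trans_eq (stable_toMod.smul_eq u.2)⟩, h.2.smul u.1⟩

/-- The `A`-modules strictly between the maximal ideal of `B` and `B`. -/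
def stableWindow : SubMulAction B.units (Submodule D K) where
  carrier := {I | (B.maxMod < I ∧ I < B.toMod) ∧ A.Stable I}
  smul_mem' u _ h :=
    ⟨⟨(stable_maxMod.smul_eq u.2).symm.trans_lt (units_smul_lt_units_smul u.1 h.1.1),
      (units_smul_lt_units_smul u.1 h.1.2).trans_eq (stable_toMod.smul_eq u.2)⟩, h.2.smul u.1⟩

variable {A B}

theorem mem_window {I : Submodule D K} : I ∈ A.window ↔ A.maxMod < I ∧ I ≤ A.toMod := Iff.rfl
theorem exists_mem_not_mem (h' : ¬ B ≤ A) : ∃ t, B.v t ≤ 1 ∧ 1 < A.v t := by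
  by_contra! hn
  exact h' (le_of_toMod_le_toMod fun x hx => hn x hx)

theorem maxMod_lt_maxMod (h : A ≤ B) (h' : ¬ B ≤ A) : B.maxMod < A.maxMod := by
  obtain ⟨t, ht, ht'⟩ := exists_mem_not_mem h'
  have h0 : t ≠ 0 := by rintro rfl; simp at ht'
  refine SetLike.lt_iff_le_and_exists.2 ⟨maxMod_le_maxMod h, t⁻¹, (v_inv_lt_one_iff h0).2 ht', ?_⟩
  rw [mem_maxMod, v_inv_lt_one_iff h0]
  exact ht.not_gt

theorem toMod_lt_toMod (h : A ≤ B) (h' : ¬ B ≤ A) : A.toMod < B.toMod := by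
  obtain ⟨t, ht, ht'⟩ := exists_mem_not_mem h'
  exact SetLike.lt_iff_le_and_exists.2 ⟨toMod_le_toMod h, t, ht, ht'.not_ge⟩

theorem maxStable_of_mem_window {I : Submodule D K} (hI : I ∈ A.window) : A.MaxStable I :=
  fun a x ha hx => hI.1.le (by
    rw [mem_maxMod, map_mul]; exact (mul_le_of_le_one_right' (hI.2 hx)).trans_lt ha)

theorem mem_strictWindow_of_mem_window (h : A ≤ B) (h' : ¬ B ≤ A) {I : Submodule D K}
    (hI : I ∈ A.window) : I ∈ A.strictWindow B :=
  ⟨⟨(maxMod_lt_maxMod h h').trans hI.1, hI.2.trans_lt (toMod_lt_toMod h h')⟩,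
    maxStable_of_mem_window hI⟩

variable (A) in
/-- The `A`-module generated by `I`. -/
def hull (I : Submodule D K) : Submodule D K where
  carrier := {y | ∃ x ∈ I, A.v y ≤ A.v x}
  add_mem' := by
    rintro y z ⟨x, hx, hxy⟩ ⟨w, hw, hwz⟩
    rcases le_total (A.v x) (A.v w) with h | h
    · exact ⟨w, hw, (A.v.map_add _ _).trans (max_le (hxy.trans h) hwz)⟩
    · exact ⟨x, hx, (A.v.map_add _ _).trans (max_le hxy (hwz.trans h))⟩
  zero_mem' := ⟨0, zero_mem _, le_rfl⟩
  smul_mem' := by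
    rintro d y ⟨x, hx, hxy⟩
    exact ⟨x, hx, (A.v_smul_le d y).trans hxy⟩

theorem le_hull (I : Submodule D K) : I ≤ A.hull I := fun x hx => ⟨x, hx, le_rfl⟩

theorem stable_hull (I : Submodule D K) : A.Stable (A.hull I) := by
  rintro a y ha ⟨x, hx, h⟩
  exact ⟨x, hx, by rw [map_mul]; exact (mul_le_of_le_one_left' ha).trans h⟩

theorem hull_le_iff {I J : Submodule D K} (hJ : A.Stable J) : A.hull I ≤ J ↔ I ≤ J :=
  ⟨(le_hull I).trans, fun h _ ⟨_, hx, hyx⟩ => hJ.mem_of_le (h hx) hyx⟩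

theorem hull_mem_stableWindow (h : A ≤ B) (h' : ¬ B ≤ A) {I : Submodule D K}
    (hI : I ∈ A.strictWindow B) : A.hull I ∈ A.stableWindow B := by
  refine ⟨⟨hI.1.1.trans_le (le_hull I), lt_of_le_of_ne
    ((hull_le_iff (stable_toMod.anti h)).2 hI.1.2.le) fun he => ?_⟩, stable_hull I⟩
  obtain ⟨w, hw, hwI⟩ := SetLike.exists_of_lt hI.1.2
  obtain ⟨t, ht, ht'⟩ := exists_mem_not_mem h'
  have : t * w ∈ A.hull I := by rw [he]; exact stable_toMod _ _ ht hw
  obtain ⟨x, hx, hxw⟩ := this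
  have hw0 : w ≠ 0 := by rintro rfl; exact hwI (zero_mem _)
  refine hwI (hI.2.mem_of_lt hx (lt_of_lt_of_le ?_ hxw))
  rw [map_mul]
  exact lt_mul_of_one_lt_left (zero_lt_iff.2 ((A.v.ne_zero_iff).2 hw0)) ht'

theorem exists_smul_mem_window {I : Submodule D K} (h : A ≤ B) (hI : I ∈ A.strictWindow B)
    (hI' : ¬ A.Stable I) : ∃ u : B.units, ∃ J ∈ A.window, I = u • J := by
  rw [Stable] at hI'
  push Not at hI'
  obtain ⟨a, i, ha, hi, hai⟩ := hI'
  have hiB : B.v i = 1 := by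
    refine le_antisymm (hI.1.2.le hi) (le_of_not_gt fun hlt => hai (hI.1.1.le ?_))
    exact (stable_maxMod.anti h) _ _ ha hlt
  refine ⟨mkUnit i hiB, (mkUnit i hiB)⁻¹ • I, ⟨?_, ?_⟩, (smul_inv_smul _ _).symm⟩
  · refine SetLike.lt_iff_le_and_exists.2 ⟨fun x hx => ?_, 1, ?_, by simp [mem_maxMod]⟩
    · rw [mem_subgroup_smul_iff]
      simpa [mul_comm] using hI.2 x i hx hi
    · rw [mem_subgroup_smul_iff]; simpa using hi
  · intro x hx
    rw [mem_subgroup_smul_iff] at hx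
    have hx' : i * x ∈ I := by simpa using hx
    by_contra hlt
    have hi0 := ne_zero_of_v_eq_one hiB
    refine hai (hI.2.mem_of_lt hx' ?_)
    rw [map_mul, map_mul, mul_comm]
    refine mul_lt_mul_of_pos_left (lt_of_le_of_lt ha (lt_of_not_ge hlt)) ?_
    exact zero_lt_iff.2 ((A.v.ne_zero_iff).2 hi0)

theorem stable_of_fixed {I : Submodule D K} (h : ∀ u : A.units, (u : Kˣ) • I = I) :
    A.Stable I := by
  have key : ∀ a x, A.v a = 1 → x ∈ I → a * x ∈ I := fun a x ha hx => by
    rw [← h (mkUnit a ha), mem_units_smul_iff]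
    simpa [ne_zero_of_v_eq_one ha] using hx
  intro a x ha hx
  rcases ha.lt_or_eq with ha | ha
  · have : A.v (1 + a) = 1 := by simpa using A.v.map_one_add_of_lt ha
    have := sub_mem (key _ _ this hx) hx
    rwa [add_mul, one_mul, add_sub_cancel_left] at this
  · exact key a x ha hx

/-- The strict window of a pair of valuation rings, glued out of the window of the smaller one
and of its modules. -/
def gluing (h : A ≤ B) (h' : ¬ B ≤ A) :
    Gluing B.units A.units (A.strictWindow B) A.window (A.stableWindow B) where
  jL I := ⟨I.1, mem_strictWindow_of_mem_window h h' I.2⟩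
  jW I := ⟨I.1, I.2.1, I.2.2.maxStable⟩
  incl := Subgroup.inclusion (units_le_units h)
  hull I := ⟨A.hull I.1, hull_mem_stableWindow h h' I.2⟩
  P := ⟨A.maxMod, ⟨maxMod_lt_maxMod h h', (maxMod_lt_toMod A).trans (toMod_lt_toMod h h')⟩,
    stable_maxMod⟩
  V := ⟨A.toMod, ⟨(maxMod_lt_maxMod h h').trans (maxMod_lt_toMod A), toMod_lt_toMod h h'⟩,
    stable_toMod⟩
  smul_mono u I J hIJ := units_smul_le_units_smul u.1 hIJ
  jL_le _ _ := Iff.rfl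
  jW_le _ _ := Iff.rfl
  jL_smul _ _ := rfl
  jW_smul _ _ := rfl
  hull_le I J := hull_le_iff J.2.2
  lt_jL I := I.2.1
  jL_le_V I := I.2.2
  exists_jL I hI hI' := ⟨⟨I.1, hI, hI'⟩, rfl⟩
  P_le_V := (maxMod_lt_toMod A).le
  le_or_le I := by
    by_contra! hn
    obtain ⟨x, hx, hx'⟩ := SetLike.not_le_iff_exists.1 (show ¬ I.1 ≤ A.maxMod from hn.1)
    refine hn.2 fun y hy => I.2.2.mem_of_le hx (le_trans hy (le_of_not_gt hx'))
  cover I := by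
    by_cases hI : A.Stable I.1
    · exact Or.inl ⟨⟨I.1, I.2.1, hI⟩, rfl⟩
    · obtain ⟨u, J, hJ, hu⟩ := exists_smul_mem_window h I.2 hI
      exact Or.inr ⟨u, ⟨J, hJ⟩, Subtype.ext hu⟩
  exists_incl u hu := by
    have hu : u • A.toMod = A.toMod := congrArg Subtype.val hu
    have h1 : ((u : Kˣ) : K) ∈ A.toMod := by
      rw [← hu, mem_subgroup_smul_iff, inv_mul_cancel₀ (Units.ne_zero _)]
      simp [mem_toMod]
    have h2 : (1 : K) ∈ u • A.toMod := by rw [hu]; simp [mem_toMod]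
    rw [mem_subgroup_smul_iff, mul_one, mem_toMod, map_inv₀, inv_le_one₀
      (zero_lt_iff.2 ((A.v.ne_zero_iff).2 (Units.ne_zero _)))] at h2
    exact ⟨⟨u.1, mem_units.2 (le_antisymm h1 h2)⟩, rfl⟩
  separate I J hIJ := by
    obtain ⟨x, hx, hx'⟩ := SetLike.not_le_iff_exists.1 (show ¬ J.1 ≤ I.1 from hIJ)
    have hxB : B.v x = 1 := le_antisymm (J.2.1.2.le hx) (le_of_not_gt fun hlt =>
      hx' (I.2.1.1.le hlt))
    have hx0 := ne_zero_of_v_eq_one hxB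
    have hmem : ∀ y, y ∈ mkUnit x hxB • A.maxMod ↔ A.v y < A.v x := fun y => by
      rw [mem_subgroup_smul_iff, mem_maxMod, map_mul, coe_mkUnit, map_inv₀, mul_comm, ← div_eq_mul_inv,
        div_lt_one₀ (zero_lt_iff.2 ((A.v.ne_zero_iff).2 hx0))]
    refine ⟨mkUnit x hxB, fun y hy => (hmem y).2 (lt_of_not_ge fun hle =>
      hx' (I.2.2.mem_of_le hy hle)), fun hle => ?_⟩
    exact lt_irrefl _ ((hmem x).1 (hle hx))
  of_fixed I hI := ⟨⟨I.1, I.2.1, stable_of_fixed fun u => congrArg Subtype.val (hI u)⟩, rfl⟩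
  incl_smul u I := Subtype.ext (I.2.2.smul_eq u.2)

end ValOver
end Paper

namespace Paper

theorem EqClosure.map_refl {G X G' X' : Type*} [PartialOrder X] [SMul G X] [PartialOrder X']
    [SMul G' X'] (e : EqClosure G X ≃o EqClosure G' X') :
    e (EqClosure.refl G X) = EqClosure.refl G' X' :=
  le_antisymm ((e.monotone (EqClosure.refl_le (e.symm (EqClosure.refl G' X')))).trans_eq
    (e.apply_symm_apply _)) (EqClosure.refl_le _)

/-- The restriction of an order isomorphism to the nontrivial closures. -/
def EqClosure.neReflCongr {G X G' X' : Type*} [PartialOrder X] [SMul G X] [PartialOrder X']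
    [SMul G' X'] (e : EqClosure G X ≃o EqClosure G' X') :
    {φ : EqClosure G X // φ ≠ EqClosure.refl G X} ≃o
      {φ : EqClosure G' X' // φ ≠ EqClosure.refl G' X'} where
  toEquiv := e.toEquiv.subtypeEquiv fun φ => not_congr (by
    rw [← EqClosure.map_refl e]; exact e.injective.eq_iff.symm)
  map_rel_iff' := e.map_rel_iff

namespace ValOver
variable {D K : Type*} [CommRing D] [Field K] [Algebra D K]

/-- The module generated by `1` and the maximal ideal. -/
def base (A : ValOver D K) : Submodule D K := 1 ⊔ A.maxMod

/-- The maximal ideal is principal. -/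
def Principal (A : ValOver D K) : Prop := ∃ π, A.v π < 1 ∧ ∀ x, A.v x < 1 → A.v x ≤ A.v π

variable {A B : ValOver D K}

theorem one_le_toMod : (1 : Submodule D K) ≤ A.toMod := by
  rintro _ ⟨d, rfl⟩
  rw [LinearMap.toSpanSingleton_apply, mem_toMod, ← Algebra.algebraMap_eq_smul_one]
  exact A.v_algebraMap_le d

theorem one_mem_base : (1 : K) ∈ A.base := Submodule.mem_sup_left (Submodule.mem_one.2 ⟨1, map_one _⟩)

theorem base_mem_window : A.base ∈ A.window :=
  ⟨SetLike.lt_iff_le_and_exists.2 ⟨le_sup_right, 1, one_mem_base, by simp [mem_maxMod]⟩,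
    sup_le one_le_toMod (maxMod_lt_toMod A).le⟩

instance : Nonempty A.window := ⟨⟨A.base, base_mem_window⟩⟩

variable (A) in
/-- The base module as an element of the window. -/
def baseX : A.window := ⟨A.base, base_mem_window⟩

/-- The base module as an element of the strict window. -/
def baseXF (h : A ≤ B) (h' : ¬ B ≤ A) : A.strictWindow B :=
  ⟨A.base, mem_strictWindow_of_mem_window h h' base_mem_window⟩

theorem gluing_jL_baseX (h : A ≤ B) (h' : ¬ B ≤ A) :
    (gluing h h').jL A.baseX = baseXF h h' := rfl

theorem sumLexIso_inl_baseXF (h : A ≤ B) (h' : ¬ B ≤ A) (s : EqClosure A.units A.window) :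
    (gluing h h').sumLexIso (toLex (Sum.inl s)) (baseXF h h') = baseXF h h' ↔
      s A.baseX = A.baseX := by
  rw [← gluing_jL_baseX, Gluing.sumLexIso_inl, (gluing h h').jL_injective.eq_iff]

theorem sumLexIso_inr_baseXF (h : A ≤ B) (h' : ¬ B ≤ A)
    (φ : {φ : EqClosure B.units (A.stableWindow B) // φ ≠ EqClosure.refl _ _}) :
    (gluing h h').sumLexIso (toLex (Sum.inr φ)) (baseXF h h') = baseXF h h' ↔
      φ.1 (gluing h h').V = (gluing h h').V ∧ A.base = A.toMod := by
  rw [Gluing.sumLexIso_inr, ← gluing_jL_baseX, Gluing.hull_jL]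
  constructor
  · intro he
    have h1 : (gluing h h').V ≤ φ.1 (gluing h h').V := φ.1.le_apply _
    have h2 : A.toMod ≤ A.base := le_trans (show A.toMod ≤ (φ.1 (gluing h h').V).1 from h1)
      (congrArg Subtype.val he).le
    have h3 := le_antisymm base_mem_window.2 h2
    refine ⟨le_antisymm ?_ h1, h3⟩
    exact ((congrArg Subtype.val he).le.trans h3.le :)
  · rintro ⟨h1, h2⟩
    rw [h1]
    exact Subtype.ext h2.symm

/-- When the maximal ideal is principal, a closure fixing the valuation ring is trivial. -/
theorem eq_refl_of_principal (h : A ≤ B) (h' : ¬ B ≤ A) (hA : A.Principal)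
    (φ : EqClosure B.units (A.stableWindow B)) (hφ : φ (gluing h h').V = (gluing h h').V) :
    φ = EqClosure.refl _ _ := by
  obtain ⟨π, hπ, hle⟩ := hA
  have hBπ : B.v π = 1 := by
    refine le_antisymm (toMod_le_toMod h hπ.le) (le_of_not_gt fun hlt => ?_)
    refine (maxMod_lt_maxMod h h').not_ge fun x hx => ?_
    exact (stable_maxMod.anti h).mem_of_le (A := A) (x := π) hlt (hle x hx)
  have hP : (gluing h h').P = mkUnit π hBπ • (gluing h h').V := by
    refine Subtype.ext (Submodule.ext fun x => ?_)
    refine Iff.trans ?_ (mem_subgroup_smul_iff (mkUnit π hBπ) A.toMod x).symm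
    have hπ0 := zero_lt_iff.2 ((A.v.ne_zero_iff).2 (ne_zero_of_v_eq_one hBπ))
    rw [mem_toMod, map_mul, coe_mkUnit, map_inv₀, mul_comm, ← div_eq_mul_inv, div_le_one₀ hπ0]
    exact ⟨hle x, fun hx => lt_of_le_of_lt hx hπ⟩
  refine (gluing h h').eq_refl_of_apply_P φ ?_
  rw [hP, φ.map_smul, hφ]

variable (A) in
/-- The elements multiplied into `I` by the maximal ideal. -/
def colon (I : Submodule D K) : Submodule D K where
  carrier := {x | ∀ a, A.v a < 1 → a * x ∈ I}
  add_mem' {x y} hx hy a ha := by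
    rw [mul_add]; exact add_mem (hx a ha) (hy a ha)
  zero_mem' a _ := by simp
  smul_mem' d x hx a ha := by
    rw [mul_smul_comm]; exact I.smul_mem d (hx a ha)

theorem colon_mem_stableWindow (h' : ¬ B ≤ A) {I : Submodule D K}
    (hI : I ∈ A.stableWindow B) : A.colon I ∈ A.stableWindow B := by
  obtain ⟨t, ht, ht'⟩ := exists_mem_not_mem h'
  have ht0 : t ≠ 0 := by rintro rfl; simp at ht'
  have hti : A.v t⁻¹ < 1 := (v_inv_lt_one_iff ht0).2 ht'
  refine ⟨⟨hI.1.1.trans_le fun x hx a ha => hI.2 a x ha.le hx,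
    SetLike.lt_iff_le_and_exists.2 ⟨fun x hx => ?_, ?_⟩⟩, fun b x hb hx a ha => ?_⟩
  · have := stable_toMod t _ ht (hI.1.2.le (hx _ hti))
    rwa [mul_inv_cancel_left₀ ht0] at this
  · obtain ⟨w, hw, hwI⟩ := SetLike.exists_of_lt hI.1.2
    refine ⟨t * w, stable_toMod t w ht hw, fun hc => hwI ?_⟩
    have := hc _ hti
    rwa [inv_mul_cancel_left₀ ht0] at this
  · rw [mul_left_comm]; exact hI.2 b _ hb (hx a ha)

theorem exists_lt_of_not_principal (hA : ¬ A.Principal) {a : K} (ha : A.v a < 1) :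
    ∃ b, A.v b < 1 ∧ A.v a < A.v b := by
  by_contra! hn
  exact hA ⟨a, ha, hn⟩

/-- The closure given by the colon with a nonprincipal maximal ideal. -/
def colonClosure (h' : ¬ B ≤ A) (hA : ¬ A.Principal) :
    EqClosure B.units (A.stableWindow B) where
  toFun I := ⟨A.colon I.1, colon_mem_stableWindow h' I.2⟩
  le_apply I x hx a ha := I.2.2 a x ha.le hx
  mono I J hIJ x hx a ha := hIJ (hx a ha)
  idem I := by
    refine Subtype.ext (le_antisymm (fun x hx a ha => ?_) fun x hx a ha b hb =>
      I.2.2 b _ hb.le (hx a ha))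
    obtain ⟨b, hb, hab⟩ := exists_lt_of_not_principal hA ha
    have hb0 : b ≠ 0 := by rintro rfl; simp at hab
    have := hx b hb (a / b) (by
      rw [map_div₀]; exact (div_lt_one₀ (zero_lt_iff.2 ((A.v.ne_zero_iff).2 hb0))).2 hab)
    rwa [← mul_assoc, div_mul_cancel₀ _ hb0] at this
  map_smul g I := by
    refine Subtype.ext (Submodule.ext fun x => ?_)
    refine Iff.trans ?_ (mem_subgroup_smul_iff g (A.colon I.1) x).symm
    refine forall₂_congr fun a ha => ?_
    refine (mem_subgroup_smul_iff g I.1 _).trans ?_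
    rw [mul_left_comm]

theorem colonClosure_V (h : A ≤ B) (h' : ¬ B ≤ A) (hA : ¬ A.Principal) :
    colonClosure h' hA (gluing h h').V = (gluing h h').V := by
  refine le_antisymm (fun x hx => ?_) ((colonClosure h' hA).le_apply _)
  have hx : ∀ a, A.v a < 1 → A.v (a * x) ≤ 1 := hx
  refine le_of_not_gt fun hlt : 1 < A.v x => ?_
  have hx0 : x ≠ 0 := by rintro rfl; simp at hlt
  obtain ⟨b, hb, hxb⟩ := exists_lt_of_not_principal hA ((v_inv_lt_one_iff hx0).2 hlt)
  refine (hx b hb).not_gt ?_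
  rw [map_inv₀] at hxb
  rw [map_mul]
  exact (inv_lt_iff_one_lt_mul₀ (zero_lt_iff.2 ((A.v.ne_zero_iff).2 hx0))).1 hxb

theorem colonClosure_ne_refl (h : A ≤ B) (h' : ¬ B ≤ A) (hA : ¬ A.Principal) :
    colonClosure h' hA ≠ EqClosure.refl _ _ := by
  intro he
  have h1 : (1 : K) ∈ (colonClosure h' hA (gluing h h').P).1 := fun a ha => by
    rw [mul_one]; exact ha
  rw [he] at h1
  have h1 : A.v 1 < 1 := h1
  simp at h1

/-- The nontrivial closures fixing the valuation ring are the least nontrivial closure, if the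
maximal ideal is not principal. -/
theorem apply_V_iff (h : A ≤ B) (h' : ¬ B ≤ A)
    (φ : {φ : EqClosure B.units (A.stableWindow B) // φ ≠ EqClosure.refl _ _}) :
    φ.1 (gluing h h').V = (gluing h h').V ↔ ¬ A.Principal ∧ IsBot φ := by
  constructor
  · intro hφ
    exact ⟨fun hA => φ.2 (eq_refl_of_principal h h' hA φ.1 hφ),
      fun ψ => (gluing h h').le_of_apply_V hφ ψ.2⟩
  · rintro ⟨hA, hb⟩
    refine le_antisymm ?_ (φ.1.le_apply _)
    exact (hb ⟨_, colonClosure_ne_refl h h' hA⟩ _).trans_eq (colonClosure_V h h' hA)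

variable {D' L : Type*} [CommRing D'] [Field L] [Algebra D' L] {A' B' : ValOver D' L}

/-- Isomorphisms between the closures on the windows of `A` and `A'` and on their modules inside
`B` and `B'` combine to an isomorphism between the closures on the strict windows. -/
theorem exists_strictWindow_iso (h : A ≤ B) (h₁ : ¬ B ≤ A) (h' : A' ≤ B') (h₁' : ¬ B' ≤ A')
    (hbase : A.base = A.toMod ↔ A'.base = A'.toMod)
    (hprinc : A.base = A.toMod → (A.Principal ↔ A'.Principal))
    (eX : EqClosure A.units A.window ≃o EqClosure A'.units A'.window)
    (heX : ∀ s, s A.baseX = A.baseX ↔ eX s A'.baseX = A'.baseX)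
    (eW : EqClosure B.units (A.stableWindow B) ≃o EqClosure B'.units (A'.stableWindow B')) :
    ∃ e : EqClosure B.units (A.strictWindow B) ≃o EqClosure B'.units (A'.strictWindow B'),
      ∀ s, s (baseXF h h₁) = baseXF h h₁ ↔ e s (baseXF h' h₁') = baseXF h' h₁' := by
  let e := (gluing h h₁).sumLexIso.symm.trans
    ((OrderIso.sumLexCongr eX (EqClosure.neReflCongr eW)).trans (gluing h' h₁').sumLexIso)
  refine ⟨e, fun s => ?_⟩
  obtain ⟨c, rfl⟩ := (gluing h h₁).sumLexIso.surjective s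
  have hc : e ((gluing h h₁).sumLexIso c) = (gluing h' h₁').sumLexIso
      (OrderIso.sumLexCongr eX (EqClosure.neReflCongr eW) c) := by simp [e]
  rw [hc]
  obtain s | φ := c
  · exact (sumLexIso_inl_baseXF h h₁ s).trans
      ((heX s).trans (sumLexIso_inl_baseXF h' h₁' (eX s)).symm)
  · refine (sumLexIso_inr_baseXF h h₁ φ).trans
      (Iff.trans ?_ (sumLexIso_inr_baseXF h' h₁' (EqClosure.neReflCongr eW φ)).symm)
    rw [apply_V_iff, apply_V_iff, ← hbase]
    refine and_congr_left fun hb => and_congr (not_congr (hprinc hb)) ?_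
    refine ⟨fun hφ ψ => ?_, fun hφ ψ => ?_⟩
    · obtain ⟨ψ, rfl⟩ := (EqClosure.neReflCongr eW).surjective ψ
      exact (EqClosure.neReflCongr eW).monotone (hφ ψ)
    · exact (EqClosure.neReflCongr eW).le_iff_le.1 (hφ _)

end ValOver
end Paper

namespace Paper

section valAt
variable {D : Type*} [CommRing D] [IsDomain D] {K : Type*} [Field K] [Algebra D K]
  [IsFractionRing D K]

theorem primeCompl_le_nonZeroDivisors (P : Ideal D) [P.IsPrime] :
    P.primeCompl ≤ nonZeroDivisors D :=
  fun _ hx => mem_nonZeroDivisors_of_ne_zero fun h => hx (h ▸ P.zero_mem)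

theorem mem_locAt_iff {P : Ideal D} {hP : P.IsPrime} {x : K} :
    x ∈ locAt D K P hP ↔ ∃ s ∉ P, ∃ a, s • x = algebraMap D K a := by
  constructor
  · rintro ⟨a, s, hs, rfl⟩
    refine ⟨s, hs, a, ?_⟩
    rw [Algebra.smul_def]
    exact IsLocalization.mk'_spec' K a
      (⟨s, primeCompl_le_nonZeroDivisors P hs⟩ : nonZeroDivisors D)
  · rintro ⟨s, hs, a, h⟩
    refine ⟨a, s, hs, ?_⟩
    rw [IsLocalization.eq_mk'_iff_mul_eq, mul_comm, ← Algebra.smul_def]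
    exact h

variable (K) in
theorem algebraMap_ne_zero {d : D} (h : d ≠ 0) : algebraMap D K d ≠ 0 := by
  rwa [Ne, IsFractionRing.to_map_eq_zero_iff]

theorem exists_smul_eq_algebraMap (x : K) : ∃ d : D, d ≠ 0 ∧ ∃ a : D, d • x = algebraMap D K a := by
  obtain ⟨a, d, hd, h⟩ := IsFractionRing.div_surjective (A := D) x
  have hd0 := nonZeroDivisors.ne_zero hd
  refine ⟨d, hd0, a, ?_⟩
  rw [Algebra.smul_def, ← h, mul_div_cancel₀ _ (algebraMap_ne_zero K hd0)]

/-- The valuation ring of a Prüfer domain at a prime. -/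
def valAt (hp : IsPrufer D K) (P : Ideal D) [hP : P.IsPrime] : ValOver D K where
  ring :=
    { (locAt D K P hP).toSubring with
      mem_or_inv_mem' := fun x => by
        change x ∈ locAt D K P hP ∨ x⁻¹ ∈ locAt D K P hP
        obtain ⟨d, hd, a, h⟩ := exists_smul_eq_algebraMap (D := D) x
        have hd' := algebraMap_ne_zero K hd
        rw [Algebra.smul_def] at h
        obtain ⟨z, hz | hz⟩ := hp P hP (algebraMap D _ d) (algebraMap D _ a)
        · left
          have : algebraMap D K d * z.1 = algebraMap D K a := congrArg Subtype.val hz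
          rw [mul_left_cancel₀ hd' (h.trans this.symm)]
          exact z.2
        · by_cases hx : x = 0
          · left; rw [hx]; exact zero_mem _
          · right
            have : algebraMap D K a * z.1 = algebraMap D K d := congrArg Subtype.val hz
            rw [← h, mul_assoc] at this
            have := mul_left_cancel₀ hd' (this.trans (mul_one _).symm)
            rw [inv_eq_of_mul_eq_one_right this]
            exact z.2 }
  algebraMap_mem d := (locAt D K P hP).algebraMap_mem d

variable (hp : IsPrufer D K) {P Q : Ideal D} [hP : P.IsPrime] [hQ : Q.IsPrime]

theorem mem_valAt_toMod {x : K} :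
    x ∈ (valAt hp P).toMod ↔ ∃ s ∉ P, ∃ a, s • x = algebraMap D K a :=
  ValOver.mem_toMod_iff_mem_ring.trans mem_locAt_iff

theorem mem_valAt_toMod_iff_mem_locAt {x : K} : x ∈ (valAt hp P).toMod ↔ x ∈ locAt D K P hP :=
  ValOver.mem_toMod_iff_mem_ring

theorem v_algebraMap_eq_one {s : D} (hs : s ∉ P) : (valAt hp P).v (algebraMap D K s) = 1 := by
  have hs0 : s ≠ 0 := fun h => hs (h ▸ P.zero_mem)
  refine le_antisymm ((valAt hp P).v_algebraMap_le s) ?_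
  have : (algebraMap D K s)⁻¹ ∈ (valAt hp P).toMod := (mem_valAt_toMod hp).2
    ⟨s, hs, 1, by rw [Algebra.smul_def, mul_inv_cancel₀ (algebraMap_ne_zero K hs0), map_one]⟩
  rwa [ValOver.mem_toMod, map_inv₀, inv_le_one₀ (zero_lt_iff.2
    ((Valuation.ne_zero_iff _).2 (algebraMap_ne_zero K hs0)))] at this

theorem v_algebraMap_lt_one_iff {a : D} : (valAt hp P).v (algebraMap D K a) < 1 ↔ a ∈ P := by
  refine ⟨fun h => by_contra fun ha => h.ne (v_algebraMap_eq_one hp ha), fun ha => ?_⟩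
  refine lt_of_le_of_ne ((valAt hp P).v_algebraMap_le a) fun h => ?_
  have h0 := ValOver.ne_zero_of_v_eq_one h
  have : (algebraMap D K a)⁻¹ ∈ (valAt hp P).toMod := by
    rw [ValOver.mem_toMod, map_inv₀, h, inv_one]
  obtain ⟨s, hs, b, hb⟩ := (mem_valAt_toMod hp).1 this
  rw [Algebra.smul_def, mul_inv_eq_iff_eq_mul₀ h0, ← map_mul] at hb
  exact hs (IsFractionRing.injective D K hb ▸ P.mul_mem_left b ha)

theorem algebraMap_mem_maxMod_iff {a : D} : algebraMap D K a ∈ (valAt hp P).maxMod ↔ a ∈ P :=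
  v_algebraMap_lt_one_iff hp

theorem v_smul_eq {s : D} (hs : s ∉ P) (x : K) : (valAt hp P).v (s • x) = (valAt hp P).v x := by
  rw [Algebra.smul_def, map_mul, v_algebraMap_eq_one hp hs, one_mul]

theorem v_smul_lt {s : D} (hs : s ∈ P) {x : K} (hx : (valAt hp P).v x ≤ 1) :
    (valAt hp P).v (s • x) < 1 := by
  rw [Algebra.smul_def, map_mul]
  exact (mul_le_of_le_one_right' hx).trans_lt ((v_algebraMap_lt_one_iff hp).2 hs)

theorem mem_valAt_maxMod {x : K} :
    x ∈ (valAt hp P).maxMod ↔ ∃ s ∉ P, ∃ a ∈ P, s • x = algebraMap D K a := by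
  constructor
  · intro hx
    obtain ⟨s, hs, a, h⟩ := (mem_valAt_toMod hp).1 ((ValOver.maxMod_lt_toMod _).le hx)
    refine ⟨s, hs, a, ?_, h⟩
    rw [← v_algebraMap_lt_one_iff hp, ← h, v_smul_eq hp hs]
    exact hx
  · rintro ⟨s, hs, a, ha, h⟩
    rw [ValOver.mem_maxMod, ← v_smul_eq hp hs, h]
    exact (v_algebraMap_lt_one_iff hp).2 ha

theorem valAt_le_valAt_iff : valAt hp P ≤ valAt hp Q ↔ Q ≤ P := by
  refine ⟨fun h q hq => by_contra fun hqP => ?_, fun h => ValOver.le_of_toMod_le_toMod fun x => ?_⟩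
  · have := ValOver.maxMod_le_maxMod h ((v_algebraMap_lt_one_iff hp).2 hq)
    exact hqP ((v_algebraMap_lt_one_iff hp).1 this)
  · rw [mem_valAt_toMod, mem_valAt_toMod]
    rintro ⟨s, hs, a, ha⟩
    exact ⟨s, fun hsQ => hs (h hsQ), a, ha⟩

theorem base_eq_toMod_iff : (valAt hp P).base = (valAt hp P).toMod ↔ P.IsMaximal := by
  constructor
  · intro h
    refine Ideal.isMaximal_iff.2 ⟨(Ideal.ne_top_iff_one P).1 hP.ne_top, fun J x hPJ hx hxJ => ?_⟩
    have hx0 : x ≠ 0 := fun h => hx (h ▸ P.zero_mem)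
    have hxi : (algebraMap D K x)⁻¹ ∈ (valAt hp P).base := by
      rw [h, ValOver.mem_toMod, map_inv₀, v_algebraMap_eq_one hp hx, inv_one]
    obtain ⟨_, hd, m, hm, h⟩ := Submodule.mem_sup.1 hxi
    obtain ⟨d, rfl⟩ := Submodule.mem_one.1 hd
    have : algebraMap D K (1 - x * d) = x • m := by
      rw [Algebra.smul_def, eq_sub_of_add_eq' h, mul_sub,
        mul_inv_cancel₀ (algebraMap_ne_zero K hx0), map_sub, map_one, map_mul]
    have h1 : 1 - x * d ∈ P := by
      rw [← v_algebraMap_lt_one_iff hp, this]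
      exact (ValOver.maxMod _).smul_mem x hm
    have := J.add_mem (hPJ h1) (J.mul_mem_right d hxJ)
    rwa [sub_add_cancel] at this
  · intro hM
    refine le_antisymm ValOver.base_mem_window.2 fun x hx => ?_
    obtain ⟨s, hs, a, h⟩ := (mem_valAt_toMod hp).1 hx
    obtain ⟨y, i, hi, hy⟩ := hM.exists_inv hs
    have : x = algebraMap D K (y * a) + i • x := by
      rw [map_mul, ← h, ← Algebra.smul_def, smul_smul, ← add_smul, hy, one_smul]
    rw [this]
    exact add_mem (Submodule.mem_sup_left (Submodule.mem_one.2 ⟨_, rfl⟩))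
      (Submodule.mem_sup_right (v_smul_lt hp hi hx))

variable (K) in
/-- The embedding of the localization at a prime into the field. -/
def locMap (P : Ideal D) (hP : P.IsPrime) : locRing D P hP →ₐ[D] K :=
  Localization.mapToFractionRing K P.primeCompl _ (primeCompl_le_nonZeroDivisors P)

theorem locMap_injective : Function.Injective (locMap K P hP) := by
  refine (IsLocalization.lift_injective_iff _).2 fun a b => ?_
  exact ⟨fun h => congrArg _ (IsLocalization.injective _ (primeCompl_le_nonZeroDivisors P) h),
    fun h => congrArg _ (IsFractionRing.injective D K h)⟩

theorem exists_smul_locMap (y : locRing D P hP) : ∃ s ∉ P, ∃ a, s • y = algebraMap D _ a := by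
  obtain ⟨a, s, rfl⟩ := IsLocalization.exists_mk'_eq P.primeCompl y
  exact ⟨s, s.2, a, by rw [Algebra.smul_def]; exact IsLocalization.mk'_spec' _ a s⟩

theorem exists_locMap_eq_iff {x : K} :
    (∃ y, locMap K P hP y = x) ↔ x ∈ (valAt hp P).toMod := by
  constructor
  · rintro ⟨y, rfl⟩
    obtain ⟨s, hs, a, h⟩ := exists_smul_locMap y
    exact (mem_valAt_toMod hp).2 ⟨s, hs, a, by rw [← map_smul, h, AlgHom.commutes]⟩
  · rw [mem_valAt_toMod]
    rintro ⟨s, hs, a, h⟩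
    have hs0 : s ≠ 0 := fun h => hs (h ▸ P.zero_mem)
    refine ⟨IsLocalization.mk' _ a (⟨s, hs⟩ : P.primeCompl), ?_⟩
    refine mul_left_cancel₀ (algebraMap_ne_zero K hs0) ?_
    rw [← Algebra.smul_def, ← Algebra.smul_def, ← map_smul, h, Algebra.smul_def,
      IsLocalization.mk'_spec' _ a (⟨s, hs⟩ : P.primeCompl), AlgHom.commutes]

theorem mem_map_algebraMap_iff (h : Q ≤ P) (y : locRing D P hP) :
    y ∈ Ideal.map (algebraMap D (locRing D P hP)) Q ↔ locMap K P hP y ∈ (valAt hp Q).maxMod := by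
  rw [IsLocalization.mem_map_algebraMap_iff P.primeCompl]
  constructor
  · rintro ⟨⟨a, s⟩, h'⟩
    refine (mem_valAt_maxMod hp).2 ⟨s, fun hs => s.2 (h hs), a, a.2, ?_⟩
    rw [← map_smul, Algebra.smul_def, mul_comm]
    exact (congrArg _ h').trans (AlgHom.commutes _ _)
  · intro hy
    obtain ⟨s, hs, a, h'⟩ := exists_smul_locMap y
    refine ⟨⟨⟨a, ?_⟩, ⟨s, hs⟩⟩, by rw [mul_comm, ← Algebra.smul_def]; exact h'⟩
    rw [← v_algebraMap_lt_one_iff hp, ← AlgHom.commutes (locMap K P hP), ← h', map_smul,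
      v_smul_eq hp fun hsQ => hs (h hsQ)]
    exact hy

theorem isPrincipal_map_iff :
    (Ideal.map (algebraMap D (locRing D P hP)) P).IsPrincipal ↔ (valAt hp P).Principal := by
  constructor
  · rintro ⟨p, h⟩
    refine ⟨locMap K P hP p, (mem_map_algebraMap_iff hp le_rfl p).1
      (h ▸ Submodule.mem_span_singleton_self p), fun x hx => ?_⟩
    obtain ⟨y, rfl⟩ := (exists_locMap_eq_iff hp).2 ((ValOver.maxMod_lt_toMod _).le hx)
    have hy := (mem_map_algebraMap_iff hp le_rfl y).2 hx
    rw [h, Submodule.mem_span_singleton] at hy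
    obtain ⟨z, rfl⟩ := hy
    rw [smul_eq_mul, map_mul, map_mul]
    exact mul_le_of_le_one_left' ((exists_locMap_eq_iff hp).1 ⟨z, rfl⟩)
  · rintro ⟨π, hπ, hle⟩
    obtain ⟨p, rfl⟩ := (exists_locMap_eq_iff hp).2 ((ValOver.maxMod_lt_toMod _).le hπ)
    have hpm := (mem_map_algebraMap_iff hp le_rfl p).2 hπ
    refine ⟨p, le_antisymm (fun y hy => ?_)
      ((Submodule.span_singleton_le_iff_mem _ _).2 hpm)⟩
    have hv := hle _ ((mem_map_algebraMap_iff hp le_rfl y).1 hy)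
    by_cases hp0 : p = 0
    · subst hp0
      rw [map_zero, map_zero, le_zero_iff, map_eq_zero, map_eq_zero_iff _ locMap_injective] at hv
      rw [hv]; exact zero_mem _
    have hp0' : locMap K P hP p ≠ 0 := (map_ne_zero_iff _ locMap_injective).2 hp0
    obtain ⟨z, hz⟩ := (exists_locMap_eq_iff hp (x := locMap K P hP y / locMap K P hP p)).2 (by
      rw [ValOver.mem_toMod, map_div₀]; exact div_le_one_of_le₀ hv zero_le)
    rw [Submodule.mem_span_singleton]
    refine ⟨z, locMap_injective (K := K) ?_⟩
    rw [smul_eq_mul, map_mul, hz, div_mul_cancel₀ _ hp0']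

end valAt
end Paper

namespace Paper

section tree
variable {D : Type*} [CommRing D] [IsDomain D] {K : Type*} [Field K] [Algebra D K]
  [IsFractionRing D K] (hp : IsPrufer D K) {P Q R M : Ideal D}
include hp

theorem le_or_le_of_le [hP : P.IsPrime] [hQ : Q.IsPrime] [hM : M.IsPrime] (hPM : P ≤ M)
    (hQM : Q ≤ M) : P ≤ Q ∨ Q ≤ P := by
  have key : ∀ {P Q : Ideal D} [P.IsPrime], P ≤ M → ∀ {a b}, a ∈ P → b ∈ Q → b ∉ P →
      ¬ (valAt hp M).v (algebraMap D K b) ≤ (valAt hp M).v (algebraMap D K a) := by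
    intro P Q hP hPM a b ha hb hbP hle
    have hle := (ValOver.Stable.mem_of_le (x := algebraMap D K a) (y := algebraMap D K b)
      (I := (valAt hp P).maxMod)
      (ValOver.stable_maxMod.anti ((valAt_le_valAt_iff hp).2 hPM))
      ((v_algebraMap_lt_one_iff hp).2 ha) hle)
    exact hbP ((v_algebraMap_lt_one_iff hp).1 hle)
  by_contra! hn
  obtain ⟨a, ha, haQ⟩ := SetLike.not_le_iff_exists.1 hn.1
  obtain ⟨b, hb, hbP⟩ := SetLike.not_le_iff_exists.1 hn.2
  rcases le_total ((valAt hp M).v (algebraMap D K a)) ((valAt hp M).v (algebraMap D K b)) with h | h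
  · exact key hQM hb ha haQ h
  · exact key hPM ha hb hbP h

/-- A prime containing a branching point `P` and lying below every maximal ideal over `P`
is `P`. -/
theorem le_of_isBranchPoint (hbr : IsBranchPoint D P) [hQ : Q.IsPrime]
    (h : ∀ M : Ideal D, M.IsMaximal → P ≤ M → Q ≤ M) : Q ≤ P := by
  obtain ⟨S, hS, hinc, hPS, hle, hinf⟩ := hbr
  refine hinf Q hQ fun R hR => ?_
  have hcomp : ∀ R ∈ S, R ≤ Q ∨ Q ≤ R := fun R hR => by
    have := hS R hR
    obtain ⟨M, hM, hRM⟩ := Ideal.exists_le_maximal R this.ne_top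
    have := hM.isPrime
    exact le_or_le_of_le hp hRM (h M hM ((hle R hR).trans hRM))
  refine (hcomp R hR).resolve_left fun hRQ => ?_
  have hRp := hS R hR
  have hsing : ∀ R' ∈ S, R' = R := fun R' hR' => by
    by_contra hne
    have hi := hinc hR' hR hne
    have hR'p := hS R' hR'
    rcases hcomp R' hR' with h' | h'
    · exact (le_or_le_of_le hp h' hRQ).elim hi.1 hi.2
    · exact hi.2 (hRQ.trans h')
  have : R ≤ P := hinf R hRp fun R' hR' => (hsing R' hR').ge
  exact hPS (le_antisymm this (hle R hR) ▸ hR)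

theorem hiSpec_finite (hsl : IsSemilocal D) : (hiSpec D).Finite := by
  have hfin : ({P | P ∈ hiSpec D ∧ P ≠ ⊥} : Set (Ideal D)).Finite := by
    refine Set.Finite.of_finite_image (f := fun P => {M : Ideal D | M.IsMaximal ∧ P ≤ M})
      (hsl.finite_subsets.subset ?_) ?_
    · rintro _ ⟨P, -, rfl⟩ M hM
      exact hM.1
    · have key : ∀ P Q : Ideal D, P ∈ hiSpec D → P ≠ ⊥ → Q.IsPrime →
          {M : Ideal D | M.IsMaximal ∧ P ≤ M} = {M : Ideal D | M.IsMaximal ∧ Q ≤ M} → Q ≤ P := by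
        intro P Q hP h0 hQ he
        have hM : ∀ M : Ideal D, M.IsMaximal → P ≤ M → Q ≤ M := fun M hM hPM =>
          (he.subset ⟨hM, hPM⟩ : _ ∈ {M : Ideal D | M.IsMaximal ∧ Q ≤ M}).2
        rcases hP.2 with h | h | h
        · exact absurd h h0
        · exact hM P h le_rfl
        · exact le_of_isBranchPoint hp h hM
      rintro P ⟨hP, hP0⟩ Q ⟨hQ, hQ0⟩ he
      exact le_antisymm (key Q P hQ hQ0 hP.1 he.symm) (key P Q hP hP0 hQ.1 he)
  refine (hfin.insert ⊥).subset fun P hP => ?_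
  by_cases h : P = ⊥
  · exact Or.inl h
  · exact Or.inr ⟨hP, h⟩

end tree

section child
variable {D : Type*} [CommRing D] [IsDomain D]

instance (P : hiSpec D) : P.1.IsPrime := P.2.1

/-- The points of `hiSpec D` directly above `Q`. -/
abbrev Child (Q : hiSpec D) := {P : hiSpec D // Q ⋖ P}

theorem directlyBelow_iff {Q P : hiSpec D} : DirectlyBelow D Q.1 P.1 ↔ Q ⋖ P :=
  ⟨fun h => ⟨h.2.2.1, fun R hQR hRP => h.2.2.2 R.1 R.2 hQR hRP⟩,
    fun h => ⟨Q.2, P.2, h.1, fun R hR hQR hRP => h.2 (c := ⟨R, hR⟩) hQR hRP⟩⟩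

/-- An order isomorphism of trees restricts to the children of a point. -/
def childCongr {D' : Type*} [CommRing D'] [IsDomain D'] (ν : hiSpec D ≃o hiSpec D')
    (Q : hiSpec D) : Child Q ≃ Child (ν Q) :=
  ν.toEquiv.subtypeEquiv fun _ => (apply_covBy_apply_iff ν).symm

variable {Q : hiSpec D}

theorem Child.lt (P : Child Q) : Q.1 < P.1.1 := P.2.1

theorem Child.eq_of_le {i j : Child Q} (h : i.1.1 ≤ j.1.1) : i = j := by
  by_contra hne
  exact j.2.2 i.2.1 (lt_of_le_of_ne h fun he => hne (Subtype.ext he))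

theorem isMaximal_of_isEmpty (hfin : (hiSpec D).Finite) [hE : IsEmpty (Child Q)] :
    Q.1.IsMaximal := by
  have : Finite (hiSpec D) := hfin
  obtain ⟨M, hM, hQM⟩ := Ideal.exists_le_maximal Q.1 Q.2.1.ne_top
  rcases hQM.eq_or_lt with h | h
  · rwa [h]
  · obtain ⟨P, hP, -⟩ := LT.lt.exists_covby_le (a := Q) (b := ⟨M, maximal_mem_hiSpec hM⟩) h
    exact hE.elim ⟨P, hP⟩

theorem eq_or_exists_child_le (hfin : (hiSpec D).Finite) {M : Ideal D} (hM : M.IsMaximal)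
    (hQM : Q.1 ≤ M) : M = Q.1 ∨ ∃ P : Child Q, P.1.1 ≤ M := by
  have : Finite (hiSpec D) := hfin
  rcases hQM.eq_or_lt with h | h
  · exact Or.inl h.symm
  · obtain ⟨P, hP, hPM⟩ := LT.lt.exists_covby_le (a := Q) (b := ⟨M, maximal_mem_hiSpec hM⟩) h
    exact Or.inr ⟨⟨P, hP⟩, hPM⟩

/-- The union of a nonempty chain of prime ideals is prime. -/
theorem isPrime_sSup_of_isChain {S : Set (Ideal D)} (hS : ∀ R ∈ S, R.IsPrime)
    (hne : S.Nonempty) (hc : IsChain (· ≤ ·) S) : (sSup S).IsPrime := by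
  have hmem : ∀ x, x ∈ sSup S ↔ ∃ R ∈ S, x ∈ R := fun x =>
    Submodule.mem_sSup_of_directed hne hc.directedOn
  constructor
  · rw [Ideal.ne_top_iff_one, hmem]
    rintro ⟨R, hR, h⟩
    exact (Ideal.ne_top_iff_one R).1 (hS R hR).ne_top h
  · intro x y hxy
    obtain ⟨R, hR, h⟩ := (hmem _).1 hxy
    exact ((hS R hR).mem_or_mem h).imp (fun h => (hmem _).2 ⟨R, hR, h⟩)
      fun h => (hmem _).2 ⟨R, hR, h⟩

variable {K : Type*} [Field K] [Algebra D K] [IsFractionRing D K] (hp : IsPrufer D K)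
include hp

theorem le_of_le_children {i j : Child Q} (hij : i ≠ j) {R : Ideal D} (hR : R.IsPrime)
    (hRi : R ≤ i.1.1) (hRj : R ≤ j.1.1) : R ≤ Q.1 := by
  let S : Set (Ideal D) := {R | R.IsPrime ∧ R ≤ i.1.1 ∧ R ≤ j.1.1}
  have hQS : Q.1 ∈ S := ⟨Q.2.1, i.lt.le, j.lt.le⟩
  have hprime : (sSup S).IsPrime := isPrime_sSup_of_isChain (fun R h => h.1) ⟨_, hQS⟩
    fun R hR R' hR' _ => by
      have := hR.1; have := hR'.1
      exact le_or_le_of_le hp hR.2.1 hR'.2.1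
  have hi : sSup S ≤ i.1.1 := sSup_le fun R h => h.2.1
  have hj : sSup S ≤ j.1.1 := sSup_le fun R h => h.2.2
  have hmem : sSup S ∈ hiSpec D := by
    refine ⟨hprime, Or.inr (Or.inr ⟨{i.1.1, j.1.1}, ?_, ?_, ?_, ?_, ?_⟩)⟩
    · rintro R (rfl | rfl)
      exacts [i.1.2.1, j.1.2.1]
    · rintro R (rfl | rfl) R' (rfl | rfl) hne
      · exact absurd rfl hne
      · exact ⟨fun h => hij (Child.eq_of_le h), fun h => hij (Child.eq_of_le h).symm⟩
      · exact ⟨fun h => hij (Child.eq_of_le h).symm, fun h => hij (Child.eq_of_le h)⟩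
      · exact absurd rfl hne
    · rintro (h | h)
      · exact hij (Child.eq_of_le (h ▸ hj))
      · exact hij (Child.eq_of_le (h ▸ hi)).symm
    · rintro R (rfl | rfl)
      exacts [hi, hj]
    · intro R hR h
      exact le_sSup ⟨hR, h _ (Or.inl rfl), h _ (Or.inr rfl)⟩
  have hQ : Q.1 = sSup S := (le_sSup hQS).eq_or_lt.resolve_right fun hlt => by
    refine i.2.2 (c := ⟨sSup S, hmem⟩) hlt (lt_of_le_of_ne hi fun he => ?_)
    exact hij (Child.eq_of_le (he ▸ hj))
  exact (le_sSup (show R ∈ S from ⟨hR, hRi, hRj⟩)).trans_eq hQ.symm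

theorem not_le_of_child_le {i j : Child Q} (hij : i ≠ j) {M : Ideal D} (hM : M.IsPrime)
    (hi : i.1.1 ≤ M) : ¬ j.1.1 ≤ M := fun hj =>
  (le_or_le_of_le hp hi hj).elim (fun h => hij (Child.eq_of_le h))
    fun h => hij (Child.eq_of_le h).symm

/-- An element close to one at `i` multiplying a given element of the valuation ring of `Q` into
the maximal ideal at `j`. -/
theorem exists_separating {i j : Child Q} (hij : i ≠ j) {z : K}
    (hz : (valAt hp Q.1).v z ≤ 1) :
    ∃ e : D, e - 1 ∈ i.1.1 ∧ (valAt hp j.1.1).v (e • z) < 1 := by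
  let J : Ideal D := (valAt hp j.1.1).maxMod.comap (LinearMap.toSpanSingleton D K z)
  have htop : J ⊔ i.1.1 = ⊤ := by
    by_contra hne
    obtain ⟨M, hM, hle⟩ := Ideal.exists_le_maximal _ hne
    have hMp := hM.isPrime
    have hiM : i.1.1 ≤ M := le_sup_right.trans hle
    have hJM : J ≤ M := le_sup_left.trans hle
    obtain ⟨p, hpj, hpM⟩ := SetLike.not_le_iff_exists.1 (not_le_of_child_le hp hij hMp hiM)
    obtain ⟨s, hs, a, hsa⟩ := (mem_valAt_toMod hp).1 hz
    obtain ⟨t, hts, ht⟩ : ∃ t ∈ Ideal.span {s}, t ∈ j.1.1.primeCompl ⊔ M.primeCompl := by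
      by_contra! hdis
      obtain ⟨R, hR, hsR, hRd⟩ := Ideal.exists_le_prime_disjoint (Ideal.span {s})
        (j.1.1.primeCompl ⊔ M.primeCompl) (Set.disjoint_left.2 hdis)
      rw [Set.disjoint_left] at hRd
      have hRj : R ≤ j.1.1 := fun x hx => by_contra fun h => hRd hx
        ((le_sup_left : j.1.1.primeCompl ≤ _) h)
      have hRM : R ≤ M := fun x hx => by_contra fun h => hRd hx
        ((le_sup_right : M.primeCompl ≤ _) h)
      rcases le_or_le_of_le hp hRM hiM with h | h
      · exact hs (le_of_le_children hp hij hR h hRj (hsR (Ideal.mem_span_singleton_self s)))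
      · exact hij (Child.eq_of_le (h.trans hRj))
    obtain ⟨c, hc, b, hb, rfl⟩ := Submonoid.mem_sup.1 ht
    obtain ⟨d, hd⟩ := Ideal.mem_span_singleton'.1 hts
    have hbz : b • z ∈ (valAt hp j.1.1).toMod := (mem_valAt_toMod hp).2
      ⟨c, hc, d * a, by rw [smul_smul, ← hd, mul_smul, hsa, map_mul, Algebra.smul_def]⟩
    have : p * b ∈ J := by
      change (p * b) • z ∈ (valAt hp j.1.1).maxMod
      rw [mul_smul]; exact v_smul_lt hp hpj hbz
    exact (hMp.mem_or_mem (hJM this)).elim hpM hb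
  obtain ⟨e, he, q, hq, heq⟩ := Submodule.mem_sup.1 ((Ideal.eq_top_iff_one _).1 htop)
  exact ⟨e, by rw [← heq, sub_add_cancel_left]; exact neg_mem hq, he⟩

theorem exists_separating_family (hfin : (hiSpec D).Finite) (i : Child Q) (z : Child Q → K)
    (hz : ∀ j, (valAt hp Q.1).v (z j) ≤ 1) :
    ∃ e : D, e - 1 ∈ i.1.1 ∧ ∀ j, j ≠ i → (valAt hp j.1.1).v (e • z j) < 1 := by
  classical
  have : Finite (hiSpec D) := hfin
  have := Fintype.ofFinite (Child Q)
  have h : ∀ j, ∃ e : D, e - 1 ∈ i.1.1 ∧ (j ≠ i → (valAt hp j.1.1).v (e • z j) < 1) := fun j => by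
    by_cases hj : j = i
    · exact ⟨1, by simp, fun h => absurd hj h⟩
    · obtain ⟨e, he, he'⟩ := exists_separating hp (Ne.symm hj) (hz j)
      exact ⟨e, he, fun _ => he'⟩
  choose e he he' using h
  refine ⟨∏ j, e j, ?_, fun j hj => ?_⟩
  · rw [← Ideal.Quotient.mk_eq_mk_iff_sub_mem, map_prod, map_one]
    exact Finset.prod_eq_one fun j _ => by
      rw [← map_one (Ideal.Quotient.mk _), Ideal.Quotient.mk_eq_mk_iff_sub_mem]; exact he j
  · rw [← Finset.prod_erase_mul _ _ (Finset.mem_univ j), mul_smul]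
    exact ((valAt hp j.1.1).v_smul_le _ _).trans_lt (he' j hj)

end child
end Paper

namespace Paper

namespace ValOver
variable {D K : Type*} [CommRing D] [Field K] [Algebra D K] {A B : ValOver D K}

theorem exists_unit_mem {I : Submodule D K} (h : A.maxMod < I) (h' : I ≤ A.toMod) :
    ∃ w ∈ I, A.v w = 1 := by
  obtain ⟨w, hw, hw'⟩ := SetLike.exists_of_lt h
  exact ⟨w, hw, le_antisymm (h' hw) (le_of_not_gt hw')⟩

theorem v_eq_one_of_le (h : A ≤ B) {x : K} (hx : A.v x = 1) : B.v x = 1 :=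
  mem_units.1 (units_le_units h (mkUnit x hx).2)

theorem v_eq_one_of_sub_one {x : K} (hx : A.v (x - 1) < 1) : A.v x = 1 := by
  have := A.v.map_one_add_of_lt hx
  rwa [add_sub_cancel] at this

theorem MaxStable.mem_of_sub {I : Submodule D K} (hI : A.MaxStable I) {x y : K} (hx : x ∈ I)
    (hx0 : x ≠ 0) (h : A.v (y / x - 1) < 1) : y ∈ I := by
  have := add_mem hx (hI _ x h hx)
  rwa [sub_mul, one_mul, div_mul_cancel₀ _ hx0, add_sub_cancel] at this

theorem MaxStable.smul_eq_of_sub_one {I : Submodule D K} (hI : A.MaxStable I) {u : Kˣ}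
    (hu : A.v ((u : K) - 1) < 1) : u • I = I := by
  have h1 := v_eq_one_of_sub_one hu
  have hu' : A.v ((u : K)⁻¹ - 1) < 1 := by
    have : (u : K)⁻¹ - 1 = -((u : K)⁻¹ * (u - 1)) := by
      rw [mul_sub, inv_mul_cancel₀ u.ne_zero]; ring
    rwa [this, Valuation.map_neg, map_mul, map_inv₀, h1, inv_one, one_mul]
  ext x
  rw [mem_units_smul_iff]
  constructor <;> intro h
  · have := add_mem h (hI _ _ hu h)
    rwa [sub_mul, one_mul, add_sub_cancel, mul_inv_cancel_left₀ u.ne_zero] at this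
  · have := add_mem h (hI _ _ hu' h)
    rwa [sub_mul, one_mul, add_sub_cancel] at this

end ValOver

section coord
variable {D : Type*} [CommRing D] [IsDomain D] {K : Type*} [Field K] [Algebra D K]
  [IsFractionRing D K] (hp : IsPrufer D K) (Q : hiSpec D)

/-- The group of units of the valuation ring at a point. -/
abbrev Grp : Subgroup Kˣ := (valAt hp Q.1).units

/-- The window of the valuation ring at a point. -/
abbrev Win : SubMulAction (Grp hp Q) (Submodule D K) := (valAt hp Q.1).window

variable {Q}

/-- The strict window of a child in the valuation ring of its parent. -/
abbrev Coord (j : Child Q) : SubMulAction (Grp hp Q) (Submodule D K) :=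
  (valAt hp j.1.1).strictWindow (valAt hp Q.1)

theorem valAt_child_le (j : Child Q) : valAt hp j.1.1 ≤ valAt hp Q.1 :=
  (valAt_le_valAt_iff hp).2 j.lt.le

theorem not_valAt_le_child (j : Child Q) : ¬ valAt hp Q.1 ≤ valAt hp j.1.1 := fun h =>
  j.lt.not_ge ((valAt_le_valAt_iff hp).1 h)

/-- The base module of a child, as a coordinate. -/
def baseCoord (j : Child Q) : Coord hp j :=
  ValOver.baseXF (valAt_child_le hp j) (not_valAt_le_child hp j)

variable {hp}

/-- The module underlying a coordinate, with the whole valuation ring on top. -/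
def coordMod {j : Child Q} (t : WithTop (Coord hp j)) : Submodule D K :=
  t.recTopCoe (valAt hp Q.1).toMod Subtype.val

variable {j : Child Q}

@[simp] theorem coordMod_top : coordMod (⊤ : WithTop (Coord hp j)) = (valAt hp Q.1).toMod := rfl
@[simp] theorem coordMod_coe (I : Coord hp j) : coordMod (I : WithTop (Coord hp j)) = I.1 := rfl

theorem coordMod_le_toMod (t : WithTop (Coord hp j)) : coordMod t ≤ (valAt hp Q.1).toMod := by
  cases t with
  | top => exact le_rfl
  | coe I => exact I.2.1.2.le

theorem maxMod_lt_coordMod (t : WithTop (Coord hp j)) : (valAt hp Q.1).maxMod < coordMod t := by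
  cases t with
  | top => exact ValOver.maxMod_lt_toMod _
  | coe I => exact I.2.1.1

theorem maxStable_coordMod (t : WithTop (Coord hp j)) :
    (valAt hp j.1.1).MaxStable (coordMod t) := by
  cases t with
  | top => exact (ValOver.stable_toMod.anti (valAt_child_le hp j)).maxStable
  | coe I => exact I.2.2

theorem coordMod_le_iff {t t' : WithTop (Coord hp j)} : coordMod t ≤ coordMod t' ↔ t ≤ t' := by
  cases t' with
  | top => simpa using coordMod_le_toMod t
  | coe I' => cases t with
    | top => simpa using I'.2.1.2.not_ge
    | coe I => rw [WithTop.coe_le_coe]; rfl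

theorem coordMod_smul (g : Grp hp Q) (t : WithTop (Coord hp j)) :
    coordMod (g • t) = g • coordMod t := by
  cases t with
  | top => exact (ValOver.stable_toMod.smul_eq g.2).symm
  | coe I => rfl

/-- The module with given coordinates. -/
def glueMod (t : ∀ j : Child Q, WithTop (Coord hp j)) : Submodule D K :=
  (valAt hp Q.1).toMod ⊓ ⨅ j, coordMod (t j)

theorem mem_glueMod {t : ∀ j : Child Q, WithTop (Coord hp j)} {x : K} :
    x ∈ glueMod t ↔ (valAt hp Q.1).v x ≤ 1 ∧ ∀ j, x ∈ coordMod (t j) := by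
  rw [glueMod, Submodule.mem_inf, Submodule.mem_iInf]; rfl

theorem exists_approx (hfin : (hiSpec D).Finite) (γ : Child Q → Grp hp Q) :
    ∃ h : Grp hp Q, ∀ j : Child Q, (valAt hp j.1.1).v (((h : Kˣ) : K) / (γ j : Kˣ) - 1) < 1 := by
  classical
  have : Finite (hiSpec D) := hfin
  have := Fintype.ofFinite (Child Q)
  rcases isEmpty_or_nonempty (Child Q) with hE | ⟨⟨j₀⟩⟩
  · exact ⟨1, fun j => hE.elim j⟩
  choose e he he' using fun i => exists_separating_family hp hfin i
    (fun j => ((γ i : Kˣ) : K) / ((γ j : Kˣ) : K)) fun j => by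
      rw [map_div₀, ValOver.v_unit, ValOver.v_unit, div_one]
  have key : ∀ j, (valAt hp j.1.1).v ((∑ i, e i • ((γ i : Kˣ) : K)) / (γ j : Kˣ) - 1) < 1 := by
    intro j
    have : (∑ i, e i • ((γ i : Kˣ) : K)) / ((γ j : Kˣ) : K) - 1 = algebraMap D K (e j - 1) +
        ∑ i ∈ Finset.univ.erase j, e i • (((γ i : Kˣ) : K) / ((γ j : Kˣ) : K)) := by
      rw [← Finset.sum_erase_add _ _ (Finset.mem_univ j), add_div, Finset.sum_div, map_sub,
        map_one, Algebra.smul_def (e j), mul_div_cancel_right₀ _ (Units.ne_zero _)]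
      simp_rw [smul_div_assoc]
      ring
    rw [this]
    refine ((valAt hp j.1.1).maxMod).add_mem ((v_algebraMap_lt_one_iff hp).2 (he j))
      (Submodule.sum_mem _ fun i hi => he' i j (Finset.ne_of_mem_erase hi).symm)
  have hQ : (valAt hp Q.1).v (∑ i, e i • ((γ i : Kˣ) : K)) = 1 := by
    have := ValOver.v_eq_one_of_le (valAt_child_le hp j₀) (ValOver.v_eq_one_of_sub_one (key j₀))
    rwa [map_div₀, ValOver.v_unit, div_one] at this
  exact ⟨ValOver.mkUnit _ hQ, key⟩

theorem le_of_glueMod_le (hfin : (hiSpec D).Finite)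
    {t t' : ∀ j : Child Q, WithTop (Coord hp j)} (h : glueMod t ≤ glueMod t') : t ≤ t' := by
  intro i
  rw [← coordMod_le_iff]
  intro x hx
  choose w hw hw1 using fun j => ValOver.exists_unit_mem (maxMod_lt_coordMod (t j))
    (coordMod_le_toMod (t j))
  have hxQ := coordMod_le_toMod _ hx
  obtain ⟨e, he, he'⟩ := exists_separating_family hp hfin i (fun j => x / w j) fun j => by
    rw [map_div₀, hw1, div_one]; exact hxQ
  have hex : e • x ∈ glueMod t := mem_glueMod.2
    ⟨((valAt hp Q.1).v_smul_le _ _).trans hxQ, fun j => by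
      by_cases hj : j = i
      · subst hj; exact Submodule.smul_mem _ _ hx
      · have := maxStable_coordMod (t j) _ _ (he' j hj) (hw j)
        rwa [smul_mul_assoc, div_mul_cancel₀ _ (ValOver.ne_zero_of_v_eq_one (hw1 j))] at this⟩
  have hmem := (mem_glueMod.1 (h hex)).2 i
  have he1 : (valAt hp i.1.1).v (algebraMap D K e - 1) < 1 := by
    rw [← map_one (algebraMap D K), ← map_sub]; exact (v_algebraMap_lt_one_iff hp).2 he
  by_cases hx0 : x = 0
  · rw [hx0]; exact zero_mem _
  have hv := ValOver.v_eq_one_of_sub_one he1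
  have he0 := ValOver.ne_zero_of_v_eq_one hv
  refine (maxStable_coordMod (t' i)).mem_of_sub hmem ?_ ?_
  · rw [Algebra.smul_def]; exact mul_ne_zero he0 hx0
  · have : x / (e • x) - 1 = -((algebraMap D K e - 1) / algebraMap D K e) := by
      rw [Algebra.smul_def]; field_simp; ring
    rw [this, Valuation.map_neg, map_div₀, hv, div_one]
    exact he1

theorem glueMod_mem_window (hfin : (hiSpec D).Finite)
    (t : ∀ j : Child Q, WithTop (Coord hp j)) : glueMod t ∈ Win hp Q := by
  choose w hw hw1 using fun j => ValOver.exists_unit_mem (maxMod_lt_coordMod (t j))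
    (coordMod_le_toMod (t j))
  obtain ⟨h, hh⟩ := exists_approx hfin fun j => ValOver.mkUnit (w j) (hw1 j)
  refine ⟨SetLike.lt_iff_le_and_exists.2 ⟨le_inf (ValOver.maxMod_lt_toMod _).le
    (le_iInf fun j => (maxMod_lt_coordMod (t j)).le), ((h : Kˣ) : K), ?_, ?_⟩, inf_le_left⟩
  · exact mem_glueMod.2 ⟨(ValOver.v_unit h).le, fun j =>
      (maxStable_coordMod (t j)).mem_of_sub (hw j) (ValOver.ne_zero_of_v_eq_one (hw1 j)) (hh j)⟩
  · rw [ValOver.mem_maxMod, ValOver.v_unit]; exact lt_irrefl _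

variable (hp) in
/-- The coordinate of a module. -/
def compMod (j : Child Q) (I : Submodule D K) : Submodule D K := I ⊔ (valAt hp j.1.1).maxMod * I

theorem maxStable_compMod (j : Child Q) (I : Submodule D K) :
    (valAt hp j.1.1).MaxStable (compMod hp j I) := by
  intro a x ha hx
  have hx' : a * x ∈ (valAt hp j.1.1).maxMod * compMod hp j I := Submodule.mul_mem_mul ha hx
  refine (?_ : (valAt hp j.1.1).maxMod * compMod hp j I ≤ _) hx'
  rw [compMod, Submodule.mul_sup, ← mul_assoc]
  refine sup_le le_sup_right (le_sup_of_le_right (mul_le_mul_left ?_ _))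
  exact Submodule.mul_le.2 fun m hm n hn =>
    ValOver.stable_maxMod m n (le_of_lt (show (valAt hp j.1.1).v m < 1 from hm)) hn

theorem compMod_le_toMod (j : Child Q) {I : Submodule D K} (hI : I ≤ (valAt hp Q.1).toMod) :
    compMod hp j I ≤ (valAt hp Q.1).toMod :=
  sup_le hI (Submodule.mul_le.2 fun m hm n hn => ValOver.stable_toMod m n
    (ValOver.toMod_le_toMod (valAt_child_le hp j) ((ValOver.maxMod_lt_toMod _).le hm)) (hI hn))

theorem mem_of_forall_mem_compMod (hfin : (hiSpec D).Finite) {I : Submodule D K}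
    (hI : I ∈ Win hp Q) {x : K} (hx : x ∈ (valAt hp Q.1).toMod)
    (h : ∀ j : Child Q, x ∈ compMod hp j I) : x ∈ I := by
  let c : Ideal D := I.comap (LinearMap.toSpanSingleton D K x)
  suffices hc : c = ⊤ by
    have : (1 : D) • x ∈ I := (Ideal.eq_top_iff_one _).1 hc
    rwa [one_smul] at this
  by_contra hne
  obtain ⟨M, hM, hcM⟩ := Ideal.exists_le_maximal _ hne
  have hMp := hM.isPrime
  suffices ∃ s ∉ M, s • x ∈ I from this.elim fun s hs => hs.1 (hcM hs.2)
  by_cases hQM : Q.1 ≤ M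
  · rcases eq_or_exists_child_le hfin hM hQM with rfl | ⟨j, hj⟩
    · obtain ⟨w, hw, hw1⟩ := ValOver.exists_unit_mem hI.1 hI.2
      have hw0 := ValOver.ne_zero_of_v_eq_one hw1
      obtain ⟨s, hs, a, hsa⟩ := (mem_valAt_toMod hp (P := Q.1) (x := x / w)).1 (by
        rw [ValOver.mem_toMod, map_div₀, hw1, div_one]; exact hx)
      refine ⟨s, hs, ?_⟩
      have : s • x = a • w := by
        rw [Algebra.smul_def a, ← hsa, smul_mul_assoc, div_mul_cancel₀ _ hw0]
      rw [this]
      exact I.smul_mem _ hw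
    · let L : Submodule D K :=
        { carrier := {z | ∃ s ∉ M, s • z ∈ I}
          add_mem' := by
            rintro y z ⟨s, hs, hsy⟩ ⟨t, ht, htz⟩
            refine ⟨s * t, hMp.mul_notMem hs ht, ?_⟩
            rw [smul_add]
            refine add_mem ?_ ?_
            · rw [mul_comm, mul_smul]; exact I.smul_mem _ hsy
            · rw [mul_smul]; exact I.smul_mem _ htz
          zero_mem' := ⟨1, hMp.one_notMem, by simp⟩
          smul_mem' := by
            rintro d z ⟨s, hs, hsz⟩
            exact ⟨s, hs, by rw [smul_comm]; exact I.smul_mem _ hsz⟩ }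
      refine (?_ : compMod hp j I ≤ L) (h j)
      refine sup_le (fun z hz => ⟨1, hMp.one_notMem, by rwa [one_smul]⟩)
        (Submodule.mul_le.2 fun m hm z hz => ?_)
      have hmM : m ∈ (valAt hp M).toMod := (ValOver.maxMod_lt_toMod _).le
        (ValOver.maxMod_le_maxMod ((valAt_le_valAt_iff hp).2 hj) hm)
      obtain ⟨s, hs, a, hsa⟩ := (mem_valAt_toMod hp).1 hmM
      refine ⟨s, hs, ?_⟩
      rw [← smul_mul_assoc, hsa, ← Algebra.smul_def]
      exact I.smul_mem _ hz
  · obtain ⟨q, hq, hqM⟩ := SetLike.not_le_iff_exists.1 hQM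
    exact ⟨q, hqM, hI.1.le (v_smul_lt hp hq hx)⟩

open Classical in
/-- The coordinates of a module in the window. -/
def coords (I : Win hp Q) (j : Child Q) : WithTop (Coord hp j) :=
  if h : compMod hp j I.1 = (valAt hp Q.1).toMod then ⊤ else
    ((⟨compMod hp j I.1, ⟨I.2.1.trans_le le_sup_left,
      lt_of_le_of_ne (compMod_le_toMod j I.2.2) h⟩, maxStable_compMod j I.1⟩ : Coord hp j) :
      WithTop (Coord hp j))

theorem coordMod_coords (I : Win hp Q) (j : Child Q) :
    coordMod (coords I j) = compMod hp j I.1 := by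
  rw [coords]
  split_ifs with h
  · rw [h]; rfl
  · rfl

theorem glueMod_coords (hfin : (hiSpec D).Finite) (I : Win hp Q) : glueMod (coords I) = I.1 := by
  refine le_antisymm (fun x hx => ?_) (le_inf I.2.2 (le_iInf fun j => ?_))
  · obtain ⟨h1, h2⟩ := mem_glueMod.1 hx
    exact mem_of_forall_mem_compMod hfin I.2 h1 fun j => coordMod_coords I j ▸ h2 j
  · rw [coordMod_coords]; exact le_sup_left

variable (hp Q) in
/-- Modules in the window correspond to their families of coordinates. -/
def winIso (hfin : (hiSpec D).Finite) : (∀ j : Child Q, WithTop (Coord hp j)) ≃o Win hp Q :=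
  orderIsoOfSurjective (fun t => ⟨glueMod t, glueMod_mem_window hfin t⟩)
    (fun _ _ => ⟨fun h => le_of_glueMod_le hfin h, fun h =>
      inf_le_inf_left _ (iInf_mono fun j => coordMod_le_iff.2 (h j))⟩)
    fun I => ⟨coords I, Subtype.ext (glueMod_coords hfin I)⟩

theorem coe_winIso (hfin : (hiSpec D).Finite) (t : ∀ j : Child Q, WithTop (Coord hp j)) :
    (winIso hp Q hfin t).1 = glueMod t := rfl

theorem winIso_smul (hfin : (hiSpec D).Finite) (g : Grp hp Q)
    (t : ∀ j : Child Q, WithTop (Coord hp j)) :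
    winIso hp Q hfin (g • t) = g • winIso hp Q hfin t := by
  refine Subtype.ext (Submodule.ext fun x => ?_)
  refine Iff.trans ?_ (mem_subgroup_smul_iff g (glueMod t) x).symm
  rw [coe_winIso, mem_glueMod, mem_glueMod, map_mul, map_inv₀, ValOver.v_unit, inv_one, one_mul]
  refine and_congr_right fun _ => forall_congr' fun j => ?_
  rw [Pi.smul_apply, coordMod_smul, mem_subgroup_smul_iff]

theorem compMod_base (j : Child Q) :
    compMod hp j (valAt hp Q.1).base = (valAt hp j.1.1).base := by
  have h1 : (valAt hp Q.1).base ≤ (valAt hp j.1.1).base :=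
    sup_le_sup_left (ValOver.maxMod_le_maxMod (valAt_child_le hp j)) _
  refine le_antisymm (sup_le h1 ?_) (sup_le (le_sup_of_le_left le_sup_left) fun m hm => ?_)
  · refine (Submodule.mul_le.2 fun m hm z hz => ?_).trans le_sup_right
    rw [mul_comm]
    exact ValOver.stable_maxMod z m (ValOver.base_mem_window.2 (h1 hz)) hm
  · rw [← mul_one m]
    exact Submodule.mem_sup_right (Submodule.mul_mem_mul hm ValOver.one_mem_base)

theorem winIso_baseCoord (hfin : (hiSpec D).Finite) :
    winIso hp Q hfin (fun j => (baseCoord hp j : WithTop (Coord hp j))) =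
      (valAt hp Q.1).baseX := by
  refine Subtype.ext ?_
  rw [coe_winIso]
  refine Eq.trans ?_ (glueMod_coords hfin (valAt hp Q.1).baseX)
  refine congrArg (_ ⊓ ·) (iInf_congr fun j => ?_)
  rw [coordMod_coords]
  exact (compMod_base j).symm

variable (hp Q) in
theorem independentActions (hfin : (hiSpec D).Finite) :
    IndependentActions (Grp hp Q) fun j : Child Q => Coord hp j where
  exists_one := ⟨1, fun i y => one_smul _ y⟩
  exists_le i y z := by
    obtain ⟨w, hw, hwy⟩ := SetLike.exists_of_lt y.2.1.2
    obtain ⟨b, hb, hb1⟩ := ValOver.exists_unit_mem z.2.1.1 z.2.1.2.le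
    obtain ⟨p, hpi, hpQ⟩ := SetLike.exists_of_lt i.lt
    have hw1 : (valAt hp Q.1).v w = 1 :=
      le_antisymm hw (le_of_not_gt fun h => hwy (y.2.1.1.le h))
    have hp1 := v_algebraMap_eq_one hp hpQ
    have hp' := (v_algebraMap_lt_one_iff hp).2 hpi
    have hw0 := ValOver.ne_zero_of_v_eq_one hw1
    have hb0 := ValOver.ne_zero_of_v_eq_one hb1
    have hp0 := ValOver.ne_zero_of_v_eq_one hp1
    refine ⟨ValOver.mkUnit (w / (algebraMap D K p * b)) (by simp [hw1, hp1, hb1]),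
      fun x hx => ?_⟩
    refine (mem_subgroup_smul_iff _ z.1 x).2 ?_
    have hxw : (valAt hp i.1.1).v x ≤ (valAt hp i.1.1).v w :=
      le_of_not_gt fun h => hwy (y.2.2.mem_of_lt hx h)
    refine z.2.2.mem_of_lt hb ?_
    rw [ValOver.coe_mkUnit]
    have h1 : (w / (algebraMap D K p * b))⁻¹ * x = algebraMap D K p * (x / w) * b := by
      field_simp
    rw [h1, map_mul]
    have hpos : ∀ {c : K}, c ≠ 0 → 0 < (valAt hp i.1.1).v c := fun hc =>
      zero_lt_iff.2 ((Valuation.ne_zero_iff _).2 hc)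
    refine mul_lt_of_lt_one_left (hpos hb0) ?_
    rw [map_mul]
    refine (mul_le_of_le_one_right' ?_).trans_lt hp'
    rw [map_div₀]
    exact div_le_one_of_le₀ hxw zero_le
  approx γ := by
    obtain ⟨h, hh⟩ := exists_approx hfin γ
    refine ⟨h, fun i y => ?_⟩
    have : ((γ i)⁻¹ * h) • y = y := Subtype.ext (y.2.2.smul_eq_of_sub_one (A := valAt hp i.1.1)
      (u := ((γ i)⁻¹ * h : Grp hp Q)) (by
        have := hh i
        rw [div_eq_mul_inv, mul_comm] at this
        simpa using this))
    rw [mul_smul, inv_smul_eq_iff] at this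
    exact this

end coord
end Paper

namespace Paper

section closIso
variable {D : Type*} [CommRing D] [IsDomain D] {K : Type*} [Field K] [Algebra D K]
  [IsFractionRing D K] (hp : IsPrufer D K) (Q : hiSpec D) (hfin : (hiSpec D).Finite)

/-- Closures of the window of a valuation ring, in terms of closures of coordinates. -/
def closIso : (SupportedFamily fun j : Child Q => EqClosure (Grp hp Q) (Coord hp j)) ≃o
    EqClosure (Grp hp Q) (Win hp Q) :=
  ((independentActions hp Q hfin).familyIso (baseCoord hp)).trans
    (EqClosure.congr (winIso hp Q hfin) (fun g => ⟨g, winIso_smul hfin g⟩)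
      fun g => ⟨g, winIso_smul hfin g⟩)

variable {Q}

theorem closIso_apply (g : SupportedFamily fun j : Child Q => EqClosure (Grp hp Q) (Coord hp j))
    (t : ∀ j : Child Q, WithTop (Coord hp j)) :
    closIso hp Q hfin g (winIso hp Q hfin t) =
      winIso hp Q hfin fun j => evalTop (g.val {j | t j ≠ ⊤} j) (t j) :=
  (EqClosure.congr_apply (winIso hp Q hfin) (fun g => ⟨g, winIso_smul hfin g⟩)
    (fun g => ⟨g, winIso_smul hfin g⟩) _ t).trans (congrArg _ (funext fun j =>
    (independentActions hp Q hfin).familyIso_apply (baseCoord hp) g t j))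

theorem closIso_baseX (g : SupportedFamily fun j : Child Q =>
    EqClosure (Grp hp Q) (Coord hp j)) :
    closIso hp Q hfin g (valAt hp Q.1).baseX = (valAt hp Q.1).baseX ↔
      ∀ j, evalTop (g.val Set.univ j) (baseCoord hp j : WithTop (Coord hp j)) =
        (baseCoord hp j : WithTop (Coord hp j)) := by
  have h : {j : Child Q | (baseCoord hp j : WithTop (Coord hp j)) ≠ ⊤} = Set.univ :=
    Set.eq_univ_of_forall fun j => WithTop.coe_ne_top
  rw [← winIso_baseCoord hfin, closIso_apply, (winIso hp Q hfin).injective.eq_iff, funext_iff, h]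
end closIso

section congrIso
variable {D₁ : Type*} [CommRing D₁] [IsDomain D₁] {K₁ : Type*} [Field K₁] [Algebra D₁ K₁]
  [IsFractionRing D₁ K₁] {hp₁ : IsPrufer D₁ K₁} {Q₁ : hiSpec D₁}
  {D₂ : Type*} [CommRing D₂] [IsDomain D₂] {K₂ : Type*} [Field K₂] [Algebra D₂ K₂]
  [IsFractionRing D₂ K₂] {hp₂ : IsPrufer D₂ K₂} {Q₂ : hiSpec D₂}

theorem evalTop_congr_baseCoord {σ : Child Q₁ ≃ Child Q₂}
    {e : ∀ j, EqClosure (Grp hp₁ Q₁) (Coord hp₁ j) ≃o EqClosure (Grp hp₂ Q₂) (Coord hp₂ (σ j))}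
    (he : ∀ j s, s (baseCoord hp₁ j) = baseCoord hp₁ j ↔
      e j s (baseCoord hp₂ (σ j)) = baseCoord hp₂ (σ j)) (j : Child Q₁)
    (s : WithTop (EqClosure (Grp hp₁ Q₁) (Coord hp₁ j))) :
    evalTop s (baseCoord hp₁ j : WithTop (Coord hp₁ j)) =
        (baseCoord hp₁ j : WithTop (Coord hp₁ j)) ↔
      evalTop ((e j).withTopCongr s) (baseCoord hp₂ (σ j) : WithTop (Coord hp₂ (σ j))) =
        (baseCoord hp₂ (σ j) : WithTop (Coord hp₂ (σ j))) := by
  cases s with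
  | top => simp
  | coe s =>
    rw [evalTop_coe_coe, WithTop.coe_inj, he]
    exact WithTop.coe_inj.symm

theorem closIso_congr_baseX (hfin₁ : (hiSpec D₁).Finite) (hfin₂ : (hiSpec D₂).Finite)
    {σ : Child Q₁ ≃ Child Q₂}
    {e : ∀ j, EqClosure (Grp hp₁ Q₁) (Coord hp₁ j) ≃o EqClosure (Grp hp₂ Q₂) (Coord hp₂ (σ j))}
    (he : ∀ j s, s (baseCoord hp₁ j) = baseCoord hp₁ j ↔
      e j s (baseCoord hp₂ (σ j)) = baseCoord hp₂ (σ j))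
    (g : SupportedFamily fun j : Child Q₁ => EqClosure (Grp hp₁ Q₁) (Coord hp₁ j)) :
    closIso hp₁ Q₁ hfin₁ g (valAt hp₁ Q₁.1).baseX = (valAt hp₁ Q₁.1).baseX ↔
      closIso hp₂ Q₂ hfin₂ (SupportedFamily.congr σ e g) (valAt hp₂ Q₂.1).baseX =
        (valAt hp₂ Q₂.1).baseX := by
  rw [closIso_baseX, closIso_baseX, ← σ.forall_congr_right]
  refine forall_congr' fun j => ?_
  rw [SupportedFamily.congr_apply, Set.preimage_univ]
  exact evalTop_congr_baseCoord he j _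

end congrIso
end Paper

namespace Paper

open FractionalIdeal nonZeroDivisors

section AFracStar
variable (Z : Type*) [CommRing Z] [IsDomain Z]

/-- The nonzero fractional ideals. -/
abbrev NonzeroFrac : Type _ := {I : FractionalIdeal Z⁰ (FractionRing Z) // I ≠ 0}

variable {Z}

theorem spanSingleton_mul_ne_zero (x : (FractionRing Z)ˣ) {I : FractionalIdeal Z⁰ (FractionRing Z)}
    (hI : I ≠ 0) : spanSingleton Z⁰ (x : FractionRing Z) * I ≠ 0 :=
  fun h => hI <| by
    rw [← one_mul I, ← spanSingleton_one, ← x.inv_mul, ← spanSingleton_mul_spanSingleton,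
      mul_assoc, h, mul_zero]

instance : SMul (FractionRing Z)ˣ (NonzeroFrac Z) :=
  ⟨fun x I => ⟨spanSingleton Z⁰ (x : FractionRing Z) * I.1, spanSingleton_mul_ne_zero x I.2⟩⟩

theorem coe_smul_nonzeroFrac (x : (FractionRing Z)ˣ) (I : NonzeroFrac Z) :
    (x • I).1 = spanSingleton Z⁰ (x : FractionRing Z) * I.1 := rfl

theorem AFracStar.ne_zero (f : AFracStar Z) {I : FractionalIdeal Z⁰ (FractionRing Z)}
    (hI : I ≠ 0) : f.toFun I ≠ 0 := fun h => hI (FractionalIdeal.le_zero_iff.1 ((f.le_star' I).trans_eq h))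

theorem AFracStar.map_zero (hZ : ¬ IsField Z) (f : AFracStar Z) : f.toFun 0 = 0 := by
  by_contra h
  obtain ⟨y, hy, hy0⟩ := exists_ne_zero_mem_isInteger h
  refine hZ ?_
  have hall : ∀ x : FractionRing Z, x ∈ f.toFun 0 := fun x => by
    by_cases hx : x = 0
    · exact hx ▸ zero_mem _
    have hy1 : algebraMap Z (FractionRing Z) y ≠ 0 := by
      rwa [Ne, IsFractionRing.to_map_eq_zero_iff]
    have := f.smul' (x / algebraMap Z (FractionRing Z) y) (div_ne_zero hx hy1) 0
    rw [mul_zero] at this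
    rw [this, mem_singleton_mul]
    exact ⟨_, hy0, (div_mul_cancel₀ _ hy1).symm⟩
  obtain ⟨a, ha, ha'⟩ := (f.toFun 0).2
  have ha0 : algebraMap Z (FractionRing Z) a ≠ 0 := by
    rw [Ne, IsFractionRing.to_map_eq_zero_iff]; exact nonZeroDivisors.ne_zero ha
  refine ⟨⟨0, 1, zero_ne_one⟩, mul_comm, fun {z} hz => ?_⟩
  have hz0 : algebraMap Z (FractionRing Z) z ≠ 0 := by
    rwa [Ne, IsFractionRing.to_map_eq_zero_iff]
  obtain ⟨w, hw⟩ := ha' ((algebraMap Z (FractionRing Z) a)⁻¹ *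
    (algebraMap Z (FractionRing Z) z)⁻¹) (hall _)
  refine ⟨w, IsFractionRing.injective Z (FractionRing Z) ?_⟩
  rw [map_mul, hw, Algebra.smul_def, mul_inv_cancel_left₀ ha0, mul_inv_cancel₀ hz0, map_one]

/-- Fractional star operations are closures on nonzero fractional ideals. -/
def aFracStarIso (hZ : ¬ IsField Z) :
    AFracStar Z ≃o EqClosure (FractionRing Z)ˣ (NonzeroFrac Z) :=
  orderIsoOfSurjective
    (fun f =>
      { toFun := fun I => ⟨f.toFun I.1, f.ne_zero I.2⟩
        le_apply := fun I => f.le_star' I.1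
        mono := fun _ _ h => f.mono' h
        idem := fun I => Subtype.ext (f.idem' I.1)
        map_smul := fun x I => Subtype.ext (f.smul' x x.ne_zero I.1) })
    (fun f f' => by
      refine ⟨fun h I => ?_, fun h I => h I.1⟩
      by_cases hI : I = 0
      · rw [hI, f.map_zero hZ, f'.map_zero hZ]
      · exact h ⟨I, hI⟩)
    (fun e => by
      classical
      let F : FractionalIdeal Z⁰ (FractionRing Z) → FractionalIdeal Z⁰ (FractionRing Z) :=
        fun I => if h : I = 0 then 0 else (e ⟨I, h⟩).1
      have hF0 : F 0 = 0 := dif_pos rfl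
      have hF : ∀ I (h : I ≠ 0), F I = (e ⟨I, h⟩).1 := fun I h => dif_neg h
      refine ⟨⟨F, fun I => ?_, fun I J hIJ => ?_, fun I => ?_, fun x hx I => ?_⟩,
        EqClosure.ext' fun I => Subtype.ext (hF I.1 I.2)⟩
      · by_cases hI : I = 0
        · rw [hI, hF0]
        · rw [hF I hI]; exact e.le_apply ⟨I, hI⟩
      · by_cases hI : I = 0
        · rw [hI, hF0]; exact zero_le _
        · have hJ : J ≠ 0 := fun h => hI (FractionalIdeal.le_zero_iff.1 (hIJ.trans_eq h))
          rw [hF I hI, hF J hJ]; exact e.mono hIJ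
      · by_cases hI : I = 0
        · rw [hI, hF0, hF0]
        · rw [hF I hI, hF _ (e ⟨I, hI⟩).2]; exact congrArg Subtype.val (e.idem ⟨I, hI⟩)
      · by_cases hI : I = 0
        · rw [hI, mul_zero, hF0, mul_zero]
        · rw [hF I hI]
          exact (hF _ (spanSingleton_mul_ne_zero (Units.mk0 x hx) hI)).trans
            (congrArg Subtype.val (e.map_smul (Units.mk0 x hx) ⟨I, hI⟩)))

end AFracStar

section residue
variable {D K : Type*} [CommRing D] [Field K] [Algebra D K] {A B : ValOver D K}
  {Z : Type*} [CommRing Z] [IsDomain Z]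

/-- A presentation of the fraction field of `Z` as the residue field of `B`, in which `Z` is
the image of `A`. -/
structure ResiduePresentation (A B : ValOver D K) (Z : Type*) [CommRing Z] [IsDomain Z] where
  le : A ≤ B
  not_le : ¬ B ≤ A
  hom : B.ring →+* FractionRing Z
  surj : Function.Surjective hom
  hom_eq_zero_iff : ∀ x, hom x = 0 ↔ (x : K) ∈ B.maxMod
  exists_hom_eq_iff : ∀ x, (∃ z, algebraMap Z (FractionRing Z) z = hom x) ↔ (x : K) ∈ A.toMod

namespace ResiduePresentation

theorem not_isField (ψ : ResiduePresentation A B Z) : ¬ IsField Z := fun h =>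
  ψ.not_le <| ValOver.le_of_toMod_le_toMod fun x hx =>
    (ψ.exists_hom_eq_iff ⟨x, ValOver.mem_toMod_iff_mem_ring.1 hx⟩).1
      (IsFractionRing.surjective_iff_isField.2 h _)

variable (ψ : ResiduePresentation A B Z)

theorem exists_algebraMap_eq {a : K} (ha : A.v a ≤ 1) :
    ∃ (h : a ∈ B.ring) (z : Z), algebraMap Z (FractionRing Z) z = ψ.hom ⟨a, h⟩ := by
  have h := ValOver.mem_toMod_iff_mem_ring.1 (ValOver.toMod_le_toMod ψ.le (show a ∈ A.toMod from ha))
  exact ⟨h, (ψ.exists_hom_eq_iff ⟨a, h⟩).2 ha⟩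

theorem mul_mem_of_v_le_one {I : FractionalIdeal Z⁰ (FractionRing Z)} {a x : K}
    (ha : A.v a ≤ 1) (hx : ∃ h : x ∈ B.ring, ψ.hom ⟨x, h⟩ ∈ I) :
    ∃ h : a * x ∈ B.ring, ψ.hom ⟨a * x, h⟩ ∈ I := by
  obtain ⟨h, hx⟩ := hx
  obtain ⟨h', z, hz⟩ := ψ.exists_algebraMap_eq ha
  refine ⟨mul_mem h' h, ?_⟩
  have : ψ.hom ⟨a * x, mul_mem h' h⟩ = z • ψ.hom ⟨x, h⟩ := by
    rw [Algebra.smul_def, hz, ← map_mul]; rfl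
  rw [this]
  exact Submodule.smul_mem (I : Submodule Z (FractionRing Z)) z hx

/-- The preimage of a fractional ideal. -/
def preimage (I : FractionalIdeal Z⁰ (FractionRing Z)) : Submodule D K where
  carrier := {x | ∃ h : x ∈ B.ring, ψ.hom ⟨x, h⟩ ∈ I}
  add_mem' := by
    rintro x y ⟨hx, hx'⟩ ⟨hy, hy'⟩
    refine ⟨add_mem hx hy, ?_⟩
    have : ψ.hom ⟨x + y, add_mem hx hy⟩ = ψ.hom ⟨x, hx⟩ + ψ.hom ⟨y, hy⟩ := by
      rw [← map_add]; rfl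
    rw [this]
    exact Submodule.add_mem (I : Submodule Z (FractionRing Z)) hx' hy'
  zero_mem' := ⟨zero_mem _, by
    have : ψ.hom ⟨0, zero_mem _⟩ = 0 := map_zero ψ.hom
    rw [this]; exact zero_mem _⟩
  smul_mem' d x hx := by
    rw [Algebra.smul_def]
    exact ψ.mul_mem_of_v_le_one (A.v_algebraMap_le d) hx

variable {ψ}

theorem mem_preimage {I : FractionalIdeal Z⁰ (FractionRing Z)} {x : K} :
    x ∈ ψ.preimage I ↔ ∃ h : x ∈ B.ring, ψ.hom ⟨x, h⟩ ∈ I := Iff.rfl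

theorem coe_mem_preimage {I : FractionalIdeal Z⁰ (FractionRing Z)} {x : B.ring} :
    (x : K) ∈ ψ.preimage I ↔ ψ.hom x ∈ I := ⟨fun ⟨_, h⟩ => h, fun h => ⟨x.2, h⟩⟩

theorem preimage_le_preimage {I J : FractionalIdeal Z⁰ (FractionRing Z)} :
    ψ.preimage I ≤ ψ.preimage J ↔ I ≤ J := by
  refine ⟨fun h y hy => ?_, fun h x ⟨hx, hx'⟩ => ⟨hx, h hx'⟩⟩
  obtain ⟨x, rfl⟩ := ψ.surj y
  exact coe_mem_preimage.1 (h (coe_mem_preimage.2 hy))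

theorem preimage_mem_stableWindow {I : FractionalIdeal Z⁰ (FractionRing Z)} (hI : I ≠ 0) :
    ψ.preimage I ∈ A.stableWindow B := by
  have h1 : B.maxMod ≤ ψ.preimage I := fun x hx => by
    have hx1 := ValOver.mem_toMod_iff_mem_ring.1 ((ValOver.maxMod_lt_toMod B).le hx)
    refine ⟨hx1, ?_⟩
    rw [(ψ.hom_eq_zero_iff ⟨x, hx1⟩).2 hx]
    exact zero_mem _
  have h2 : ψ.preimage I ≤ B.toMod := fun x hx => ValOver.mem_toMod_iff_mem_ring.2 hx.1
  refine ⟨⟨lt_of_le_of_ne h1 fun h => hI ?_, lt_of_le_of_ne h2 fun h => ψ.not_isField ?_⟩,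
    fun a x ha hx => ψ.mul_mem_of_v_le_one ha hx⟩
  · refine eq_zero_iff.2 fun y hy => ?_
    obtain ⟨x, rfl⟩ := ψ.surj y
    exact (ψ.hom_eq_zero_iff x).2 (h ▸ coe_mem_preimage.2 hy)
  · have hall : ∀ y, y ∈ I := fun y => by
      obtain ⟨x, rfl⟩ := ψ.surj y
      exact coe_mem_preimage.1 (h ▸ ValOver.mem_toMod_iff_mem_ring.2 x.2)
    refine (IsFractionRing.surjective_iff_isField (K := FractionRing Z)).1 fun y => ?_
    obtain ⟨a, ha, ha'⟩ := I.2
    have ha0 : algebraMap Z (FractionRing Z) a ≠ 0 := by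
      rw [Ne, IsFractionRing.to_map_eq_zero_iff]; exact nonZeroDivisors.ne_zero ha
    obtain ⟨w, hw⟩ := ha' ((algebraMap Z (FractionRing Z) a)⁻¹ * y) (hall _)
    exact ⟨w, by rw [hw, Algebra.smul_def, mul_inv_cancel_left₀ ha0]⟩

theorem exists_preimage_eq {J : Submodule D K} (hJ : J ∈ A.stableWindow B) :
    ∃ I : FractionalIdeal Z⁰ (FractionRing Z), I ≠ 0 ∧ ψ.preimage I = J := by
  have hker : ∀ x y : B.ring, ψ.hom x = ψ.hom y → (x : K) ∈ J → (y : K) ∈ J := by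
    intro x y h hx
    have : ((y - x : B.ring) : K) ∈ J :=
      hJ.1.1.le ((ψ.hom_eq_zero_iff _).1 (by rw [map_sub, h, sub_self]))
    simpa using add_mem this hx
  let N : Submodule Z (FractionRing Z) :=
    { carrier := {y | ∃ x : B.ring, (x : K) ∈ J ∧ ψ.hom x = y}
      add_mem' := by
        rintro _ _ ⟨x, hx, rfl⟩ ⟨y, hy, rfl⟩
        exact ⟨x + y, add_mem hx hy, map_add _ _ _⟩
      zero_mem' := ⟨0, zero_mem _, map_zero _⟩
      smul_mem' := by
        rintro z _ ⟨x, hx, rfl⟩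
        obtain ⟨a, ha⟩ := ψ.surj (algebraMap Z (FractionRing Z) z)
        refine ⟨a * x, hJ.2 _ _ ((ψ.exists_hom_eq_iff a).1 ⟨z, ha.symm⟩) hx, ?_⟩
        rw [map_mul, ha, Algebra.smul_def] }
  have hN : IsFractional Z⁰ N := by
    obtain ⟨y, hy, hyJ⟩ := SetLike.exists_of_lt hJ.1.2
    let y' : B.ring := ⟨y, ValOver.mem_toMod_iff_mem_ring.1 hy⟩
    have hy0 : ψ.hom y' ≠ 0 := fun h => hyJ (hJ.1.1.le ((ψ.hom_eq_zero_iff y').1 h))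
    obtain ⟨p, q, hq, hpq⟩ := IsFractionRing.div_surjective (A := Z) (ψ.hom y')⁻¹
    have hq0 : algebraMap Z (FractionRing Z) q ≠ 0 := by
      rw [Ne, IsFractionRing.to_map_eq_zero_iff]; exact nonZeroDivisors.ne_zero hq
    have hp0 : p ≠ 0 := by
      rintro rfl
      rw [map_zero, zero_div] at hpq
      exact inv_ne_zero hy0 hpq.symm
    refine ⟨p, mem_nonZeroDivisors_of_ne_zero hp0, ?_⟩
    rintro _ ⟨x, hx, rfl⟩
    have hy0' : y ≠ 0 := fun h => hyJ (h ▸ zero_mem _)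
    have hxy : A.v ((x : K) / y) ≤ 1 := by
      by_contra! hlt
      refine hyJ ?_
      have hx0 : (x : K) ≠ 0 := fun h => by simp [h] at hlt
      have := hJ.2 (y / x) x (by
        rw [← inv_div, map_inv₀]; exact inv_le_one_of_one_le₀ hlt.le) hx
      rwa [div_mul_cancel₀ _ hx0] at this
    obtain ⟨h, z, hz⟩ := ψ.exists_algebraMap_eq hxy
    refine ⟨q * z, ?_⟩
    have hx' : x = ⟨(x : K) / y, h⟩ * y' := Subtype.ext (div_mul_cancel₀ _ hy0').symm
    have hpq' : algebraMap Z (FractionRing Z) p * ψ.hom y' = algebraMap Z (FractionRing Z) q := by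
      field_simp at hpq
      exact hpq
    rw [map_mul, hz, Algebra.smul_def]
    conv_rhs => rw [hx', map_mul]
    rw [← hpq']
    ring
  have hpre : ψ.preimage ⟨N, hN⟩ = J := by
    ext x
    constructor
    · rintro ⟨hx, y, hy, h⟩
      exact hker y ⟨x, hx⟩ h hy
    · intro hx
      have hx' := ValOver.mem_toMod_iff_mem_ring.1 (hJ.1.2.le hx)
      exact ⟨hx', ⟨x, hx'⟩, hx, rfl⟩
  refine ⟨⟨N, hN⟩, fun h => hJ.1.1.not_ge ?_, hpre⟩
  rw [← hpre, h]
  rintro x ⟨hx, hx'⟩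
  exact (ψ.hom_eq_zero_iff ⟨x, hx⟩).1 ((mem_zero_iff _).1 hx')

variable (ψ) in
/-- Nonzero fractional ideals of `Z`, as modules between the maximal ideal of `B` and `B`. -/
def windowIso : NonzeroFrac Z ≃o A.stableWindow B :=
  orderIsoOfSurjective (fun I => ⟨ψ.preimage I.1, preimage_mem_stableWindow I.2⟩)
    (fun _ _ => preimage_le_preimage) fun J => by
      obtain ⟨I, hI, h⟩ := ψ.exists_preimage_eq J.2
      exact ⟨⟨I, hI⟩, Subtype.ext h⟩

theorem windowIso_smul {x : (FractionRing Z)ˣ} {u : B.units} {b : B.ring}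
    (hb : (b : K) = ((u : Kˣ) : K)) (hx : ψ.hom b = x) (I : NonzeroFrac Z) :
    ψ.windowIso (x • I) = u • ψ.windowIso I := by
  have hinv : ((u : Kˣ) : K)⁻¹ ∈ B.ring := ValOver.mem_toMod_iff_mem_ring.1
    (show B.v _ ≤ 1 by rw [map_inv₀, ValOver.v_unit, inv_one])
  have hbinv : b * ⟨_, hinv⟩ = 1 := Subtype.ext (by
    change (b : K) * ((u : Kˣ) : K)⁻¹ = 1
    rw [hb, mul_inv_cancel₀ (Units.ne_zero _)])
  refine Subtype.ext (Submodule.ext fun y => ?_)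
  refine Iff.trans ?_ (mem_subgroup_smul_iff u (ψ.preimage I.1) y).symm
  constructor
  · rintro ⟨hy, hy'⟩
    rw [coe_smul_nonzeroFrac, mem_singleton_mul] at hy'
    obtain ⟨w, hw, h⟩ := hy'
    refine ⟨mul_mem hinv hy, ?_⟩
    have : ψ.hom ⟨((u : Kˣ) : K)⁻¹ * y, mul_mem hinv hy⟩ = w := by
      have h1 : (⟨((u : Kˣ) : K)⁻¹ * y, mul_mem hinv hy⟩ : B.ring) = ⟨_, hinv⟩ * ⟨y, hy⟩ := rfl
      rw [h1, map_mul, h, ← hx, ← mul_assoc, ← map_mul, mul_comm _ b, hbinv, map_one, one_mul]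
    rwa [this]
  · rintro ⟨hy, hy'⟩
    have h1 : y = (b * ⟨_, hy⟩ : B.ring) := by
      change y = (b : K) * _
      rw [hb, mul_inv_cancel_left₀ (Units.ne_zero _)]
    rw [h1]
    refine coe_mem_preimage.2 ?_
    rw [map_mul, hx, coe_smul_nonzeroFrac, mem_singleton_mul]
    exact ⟨_, hy', rfl⟩

variable (ψ) in
/-- Fractional star operations on `Z`, as closures of modules over `A`. -/
def closureIso : AFracStar Z ≃o EqClosure B.units (A.stableWindow B) :=
  (aFracStarIso ψ.not_isField).trans (EqClosure.congr ψ.windowIso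
    (fun x => by
      obtain ⟨b, hb⟩ := ψ.surj x
      have hv : B.v b = 1 := le_antisymm ((B.ring.valuation_le_one_iff _).2 b.2)
        (le_of_not_gt fun h => x.ne_zero (hb ▸ (ψ.hom_eq_zero_iff b).2 h))
      exact ⟨ValOver.mkUnit b hv, windowIso_smul (by rw [ValOver.coe_mkUnit]) hb⟩)
    (fun u => by
      have hu : ((u : Kˣ) : K) ∈ B.ring := ValOver.mem_toMod_iff_mem_ring.1 (ValOver.v_unit u).le
      have h0 : ψ.hom ⟨_, hu⟩ ≠ 0 := fun h =>
        ((ψ.hom_eq_zero_iff _).1 h : B.v _ < 1).ne (ValOver.v_unit u)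
      exact ⟨Units.mk0 _ h0, windowIso_smul (b := ⟨_, hu⟩) rfl rfl⟩))

end ResiduePresentation
end residue
end Paper

namespace Paper

open FractionalIdeal nonZeroDivisors

section Zring
variable {D : Type*} [CommRing D] [IsDomain D] {K : Type*} [Field K] [Algebra D K]
  [IsFractionRing D K] (hp : IsPrufer D K) {P Q : Ideal D} [hP : P.IsPrime] [hQ : Q.IsPrime]

include hp in
theorem isDomain_zring (h : Q ≤ P) : IsDomain (Zring D P Q hP) := by
  have : (Ideal.map (algebraMap D (locRing D P hP)) Q).IsPrime := by
    refine Ideal.isPrime_iff.2 ⟨fun htop => ?_, fun {x y} hxy => ?_⟩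
    · have h1 := (Ideal.eq_top_iff_one _).1 htop
      rw [mem_map_algebraMap_iff hp h, map_one] at h1
      have h1 : (valAt hp Q).v 1 < 1 := h1
      rw [map_one] at h1
      exact lt_irrefl _ h1
    · have hle : ∀ y, (valAt hp Q).v (locMap K P hP y) ≤ 1 := fun y =>
        ValOver.toMod_le_toMod ((valAt_le_valAt_iff hp).2 h) ((exists_locMap_eq_iff hp).1 ⟨y, rfl⟩)
      rw [mem_map_algebraMap_iff hp h, map_mul] at hxy
      rw [mem_map_algebraMap_iff hp h, mem_map_algebraMap_iff hp h]
      by_contra! hn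
      have hx : (valAt hp Q).v (locMap K P hP x) = 1 := le_antisymm (hle x) (le_of_not_gt hn.1)
      have hy : (valAt hp Q).v (locMap K P hP y) = 1 := le_antisymm (hle y) (le_of_not_gt hn.2)
      have hxy : (valAt hp Q).v (_ * _) < 1 := hxy
      rw [map_mul, hx, hy, one_mul] at hxy
      exact lt_irrefl _ hxy
  infer_instance

theorem nonempty_residuePresentation (h : Q < P) {Z : Type*} [CommRing Z] [IsDomain Z]
    (ρ : locRing D P hP →+* Z) (hρ : Function.Surjective ρ)
    (hker : ∀ y, ρ y = 0 ↔ locMap K P hP y ∈ (valAt hp Q).maxMod) :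
    Nonempty (ResiduePresentation (valAt hp P) (valAt hp Q) Z) := by
  let F := FractionRing Z
  let π : locRing D P hP →+* F := (algebraMap Z F).comp ρ
  have hle := (valAt_le_valAt_iff hp).2 h.le
  have hπ : ∀ y, π y = 0 ↔ locMap K P hP y ∈ (valAt hp Q).maxMod := fun y =>
    IsFractionRing.to_map_eq_zero_iff.trans (hker y)
  have hπD : ∀ a : D, π (algebraMap D _ a) = 0 ↔ a ∈ Q := fun a => by
    rw [hπ, AlgHom.commutes, algebraMap_mem_maxMod_iff]
  have hloc : IsLocalization Q.primeCompl (locAt D K Q hQ) :=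
    Localization.subalgebra.isLocalization_subalgebra K Q.primeCompl _
  let φ₀ : locAt D K Q hQ →+* F := IsLocalization.lift (M := Q.primeCompl)
    (g := π.comp (algebraMap D (locRing D P hP)))
    fun s => isUnit_iff_ne_zero.2 fun h0 => s.2 ((hπD s).1 h0)
  let φ : (valAt hp Q).ring →+* F := φ₀
  have hφ₀ : ∀ a (ha : algebraMap D K a ∈ (valAt hp Q).ring),
      φ ⟨algebraMap D K a, ha⟩ = π (algebraMap D _ a) := fun a _ =>
    IsLocalization.lift_eq (M := Q.primeCompl) (S := locAt D K Q hQ) _ a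
  have hφD : ∀ (x : (valAt hp Q).ring) (s a : D), s • (x : K) = algebraMap D K a →
      π (algebraMap D _ s) * φ x = π (algebraMap D _ a) := fun x s a hsa => by
    rw [← hφ₀ s ((valAt hp Q).algebraMap_mem s), ← hφ₀ a ((valAt hp Q).algebraMap_mem a),
      ← map_mul]
    exact congrArg φ (Subtype.ext ((Algebra.smul_def s (x : K)).symm.trans hsa))
  have hφ : ∀ (x : (valAt hp Q).ring) (y : locRing D P hP), (x : K) = locMap K P hP y →
      φ x = π y := fun x y hxy => by
    obtain ⟨s, hs, a, hsa⟩ := exists_smul_locMap y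
    have hs0 : π (algebraMap D _ s) ≠ 0 := fun h0 => hs (h.le ((hπD s).1 h0))
    refine mul_left_cancel₀ hs0 ?_
    rw [← map_mul, ← Algebra.smul_def, hsa]
    refine hφD x s a ?_
    rw [hxy, ← map_smul, hsa, AlgHom.commutes]
  have hmem : ∀ y, locMap K P hP y ∈ (valAt hp Q).ring := fun y =>
    ValOver.mem_toMod_iff_mem_ring.1
      (ValOver.toMod_le_toMod hle ((exists_locMap_eq_iff hp).1 ⟨y, rfl⟩))
  have hzero : ∀ x, φ x = 0 ↔ (x : K) ∈ (valAt hp Q).maxMod := fun x => by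
    obtain ⟨s, hs, a, hsa⟩ := (mem_valAt_toMod hp).1 (ValOver.mem_toMod_iff_mem_ring.2 x.2)
    have hs0 : π (algebraMap D _ s) ≠ 0 := fun h0 => hs ((hπD s).1 h0)
    rw [← mul_eq_zero_iff_left hs0, hφD x s a hsa, hπD, ← v_algebraMap_lt_one_iff hp, ← hsa,
      v_smul_eq hp hs]
    rfl
  refine ⟨⟨hle, fun h' => h.not_ge ((valAt_le_valAt_iff hp).1 h'), φ, fun w => ?_, hzero,
    fun x => ⟨fun ⟨z, hz⟩ => ?_, fun hx => ?_⟩⟩⟩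
  · obtain ⟨p, q, hq, rfl⟩ := IsFractionRing.div_surjective (A := Z) w
    obtain ⟨p, rfl⟩ := hρ p
    obtain ⟨q, rfl⟩ := hρ q
    have hq0 : π q ≠ 0 := fun h0 => nonZeroDivisors.ne_zero hq
      (IsFractionRing.to_map_eq_zero_iff.1 h0)
    have hq1 : (valAt hp Q).v (locMap K P hP q) = 1 :=
      le_antisymm ((ValOver.mem_toMod_iff_mem_ring).2 (hmem q))
        (le_of_not_gt fun h0 => hq0 ((hπ q).2 h0))
    have hx : locMap K P hP p / locMap K P hP q ∈ (valAt hp Q).ring :=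
      ValOver.mem_toMod_iff_mem_ring.1 (show (valAt hp Q).v _ ≤ 1 by
        rw [map_div₀, hq1, _root_.div_one]; exact ValOver.mem_toMod_iff_mem_ring.2 (hmem p))
    refine ⟨⟨_, hx⟩, ?_⟩
    change _ = π p / π q
    rw [eq_div_iff hq0, ← hφ ⟨_, hmem p⟩ p rfl, ← hφ ⟨_, hmem q⟩ q rfl, ← map_mul]
    exact congrArg φ (Subtype.ext (div_mul_cancel₀ _ (ValOver.ne_zero_of_v_eq_one hq1)))
  · obtain ⟨y, rfl⟩ := hρ z
    have hz : φ x = φ ⟨_, hmem y⟩ := hz.symm.trans (hφ ⟨_, hmem y⟩ y rfl).symm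
    have hsub : (x : K) - locMap K P hP y ∈ (valAt hp Q).maxMod :=
      (hzero (x - ⟨_, hmem y⟩)).1 (by rw [map_sub, hz, sub_self])
    have := add_mem ((ValOver.maxMod_lt_toMod _).le (ValOver.maxMod_le_maxMod hle hsub))
      ((exists_locMap_eq_iff hp).1 ⟨y, rfl⟩)
    rwa [sub_add_cancel] at this
  · obtain ⟨y, hy⟩ := (exists_locMap_eq_iff hp).2 hx
    exact ⟨ρ y, (hφ x y hy.symm).symm⟩

/-- Fractional star operations on `Z(P)`, as closures of modules over the localization. -/
theorem nonempty_aFracStar_iso (h : Q < P) : Nonempty (AFracStar (Zring D P Q hP) ≃o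
    EqClosure (valAt hp Q).units ((valAt hp P).stableWindow (valAt hp Q))) := by
  have := isDomain_zring hp (hP := hP) h.le
  obtain ⟨ψ⟩ := nonempty_residuePresentation hp h
    (Ideal.Quotient.mk (Ideal.map (algebraMap D (locRing D P hP)) Q))
    Ideal.Quotient.mk_surjective fun y => by
      rw [Ideal.Quotient.eq_zero_iff_mem, mem_map_algebraMap_iff hp h.le]
  exact ⟨ψ.closureIso⟩

end Zring
end Paper

namespace Paper

section maximal
variable {D : Type*} [CommRing D] [IsDomain D]

theorem isMaximal_iff_isMax {P : hiSpec D} : P.1.IsMaximal ↔ IsMax P := by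
  constructor
  · intro h R hR
    exact (h.eq_of_le R.2.1.ne_top hR).ge
  · intro h
    obtain ⟨N, hN, hPN⟩ := Ideal.exists_le_maximal P.1 P.2.1.ne_top
    have : N ≤ P.1 := h (show P ≤ ⟨N, maximal_mem_hiSpec hN⟩ from hPN)
    rwa [hPN.antisymm this]
end maximal

section induction
variable {D₁ : Type*} [CommRing D₁] [IsDomain D₁] {K₁ : Type*} [Field K₁] [Algebra D₁ K₁]
  [IsFractionRing D₁ K₁] {hp₁ : IsPrufer D₁ K₁}
  {D₂ : Type*} [CommRing D₂] [IsDomain D₂] {K₂ : Type*} [Field K₂] [Algebra D₂ K₂]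
  [IsFractionRing D₂ K₂] {hp₂ : IsPrufer D₂ K₂}

theorem isMaximal_map_iff (ν : hiSpec D₁ ≃o hiSpec D₂) (P : hiSpec D₁) :
    P.1.IsMaximal ↔ (ν P).1.IsMaximal := by
  rw [isMaximal_iff_isMax, isMaximal_iff_isMax, ν.isMax_apply]

theorem exists_coord_iso (ν : hiSpec D₁ ≃o hiSpec D₂)
    (hZ : ∀ P Q : hiSpec D₁, DirectlyBelow D₁ Q.1 P.1 →
      Nonempty (AFracStar (Zring D₁ P.1 Q.1 (mem_hiSpec_prime P.2)) ≃o
        AFracStar (Zring D₂ (ν P).1 (ν Q).1 (mem_hiSpec_prime (ν P).2))))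
    (hprinc : ∀ P : hiSpec D₁, P.1.IsMaximal →
      ((valAt hp₁ P.1).Principal ↔ (valAt hp₂ (ν P).1).Principal))
    {Q : hiSpec D₁} (j : Child Q)
    (hj : ∃ E : EqClosure (Grp hp₁ j.1) (Win hp₁ j.1) ≃o
        EqClosure (Grp hp₂ (ν j.1)) (Win hp₂ (ν j.1)),
      ∀ s, s (valAt hp₁ j.1.1).baseX = (valAt hp₁ j.1.1).baseX ↔
        E s (valAt hp₂ (ν j.1).1).baseX = (valAt hp₂ (ν j.1).1).baseX) :
    ∃ e : EqClosure (Grp hp₁ Q) (Coord hp₁ j) ≃o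
        EqClosure (Grp hp₂ (ν Q)) (Coord hp₂ (childCongr ν Q j)),
      ∀ s, s (baseCoord hp₁ j) = baseCoord hp₁ j ↔
        e s (baseCoord hp₂ (childCongr ν Q j)) = baseCoord hp₂ (childCongr ν Q j) := by
  obtain ⟨E, hE⟩ := hj
  obtain ⟨z⟩ := hZ j.1 Q (directlyBelow_iff.2 j.2)
  obtain ⟨w₁⟩ := nonempty_aFracStar_iso hp₁ (P := j.1.1) (Q := Q.1) j.lt
  obtain ⟨w₂⟩ := nonempty_aFracStar_iso hp₂ (P := (ν j.1).1) (Q := (ν Q).1)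
    (childCongr ν Q j).lt
  refine ValOver.exists_strictWindow_iso (valAt_child_le hp₁ j) (not_valAt_le_child hp₁ j)
    (valAt_child_le hp₂ (childCongr ν Q j)) (not_valAt_le_child hp₂ (childCongr ν Q j))
    ?_ ?_ E hE ((w₁.symm.trans z).trans w₂)
  · rw [base_eq_toMod_iff, base_eq_toMod_iff]
    exact isMaximal_map_iff ν j.1
  · rw [base_eq_toMod_iff]
    exact hprinc j.1

theorem exists_win_iso (hfin₁ : (hiSpec D₁).Finite) (hfin₂ : (hiSpec D₂).Finite)
    (ν : hiSpec D₁ ≃o hiSpec D₂)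
    (hZ : ∀ P Q : hiSpec D₁, DirectlyBelow D₁ Q.1 P.1 →
      Nonempty (AFracStar (Zring D₁ P.1 Q.1 (mem_hiSpec_prime P.2)) ≃o
        AFracStar (Zring D₂ (ν P).1 (ν Q).1 (mem_hiSpec_prime (ν P).2))))
    (hprinc : ∀ P : hiSpec D₁, P.1.IsMaximal →
      ((valAt hp₁ P.1).Principal ↔ (valAt hp₂ (ν P).1).Principal)) (Q : hiSpec D₁) :
    ∃ E : EqClosure (Grp hp₁ Q) (Win hp₁ Q) ≃o EqClosure (Grp hp₂ (ν Q)) (Win hp₂ (ν Q)),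
      ∀ s, s (valAt hp₁ Q.1).baseX = (valAt hp₁ Q.1).baseX ↔
        E s (valAt hp₂ (ν Q).1).baseX = (valAt hp₂ (ν Q).1).baseX := by
  have : Finite (hiSpec D₁) := hfin₁
  induction Q using WellFoundedGT.induction with
  | ind Q ih =>
    choose e he using fun j : Child Q => exists_coord_iso ν hZ hprinc j (ih j.1 j.lt)
    refine ⟨((closIso hp₁ Q hfin₁).symm.trans (SupportedFamily.congr (childCongr ν Q) e)).trans
      (closIso hp₂ (ν Q) hfin₂), fun s => ?_⟩
    obtain ⟨g, rfl⟩ := (closIso hp₁ Q hfin₁).surjective s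
    refine (closIso_congr_baseX hfin₁ hfin₂ he g).trans ?_
    rw [OrderIso.trans_apply, OrderIso.trans_apply, OrderIso.symm_apply_apply]

end induction
end Paper

namespace Paper

section root
variable {D : Type*} [CommRing D] [IsDomain D] {K : Type*} [Field K] [Algebra D K]
  [IsFractionRing D K] (hp : IsPrufer D K) {Q : hiSpec D} (hQ : Q.1 = ⊥)

include hQ

theorem root_toMod : (valAt hp Q.1).toMod = ⊤ := eq_top_iff.2 fun x _ => by
  obtain ⟨d, hd, h⟩ := exists_smul_eq_algebraMap (D := D) x
  exact (mem_valAt_toMod hp).2 ⟨d, fun h' => hd (by rwa [hQ, Ideal.mem_bot] at h'), h⟩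

theorem root_maxMod : (valAt hp Q.1).maxMod = ⊥ := eq_bot_iff.2 fun x hx => by
  obtain ⟨s, hs, a, ha, h⟩ := (mem_valAt_maxMod hp).1 hx
  rw [hQ, Ideal.mem_bot] at ha hs
  rw [ha, map_zero, Algebra.smul_def] at h
  exact (mul_eq_zero.1 h).resolve_left (algebraMap_ne_zero K hs)

theorem root_v {x : K} (hx : x ≠ 0) : (valAt hp Q.1).v x = 1 := by
  refine le_antisymm (show x ∈ (valAt hp Q.1).toMod from root_toMod hp hQ ▸ trivial)
    (le_of_not_gt fun h => hx ?_)
  have h : x ∈ (valAt hp Q.1).maxMod := h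
  rwa [root_maxMod hp hQ, Submodule.mem_bot] at h

/-- A nonzero element of the quotient field, in the group of units of the root. -/
def rootUnit {x : K} (hx : x ≠ 0) : Grp hp Q := ValOver.mkUnit x (root_v hp hQ hx)

theorem coe_rootUnit {x : K} (hx : x ≠ 0) : ((rootUnit hp hQ hx : Kˣ) : K) = x :=
  ValOver.coe_mkUnit _ _

theorem rootUnit_smul {x : K} (hx : x ≠ 0) (I : Submodule D K) :
    rootUnit hp hQ hx • I = Submodule.span D {x} * I := by
  have := span_singleton_mul_eq_smul (rootUnit hp hQ hx : Kˣ) I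
  rw [coe_rootUnit] at this
  exact this.symm

theorem mem_root_win {I : Submodule D K} : I ∈ Win hp Q ↔ I ≠ ⊥ := by
  rw [ValOver.mem_window, root_toMod hp hQ, root_maxMod hp hQ, bot_lt_iff_ne_bot]
  simp

theorem root_base : (valAt hp Q.1).base = 1 := by
  rw [ValOver.base, root_maxMod hp hQ, sup_bot_eq]

include hp in
theorem one_eq_top_iff : (1 : Submodule D K) = ⊤ ↔ Q.1.IsMaximal := by
  rw [← base_eq_toMod_iff hp, root_base hp hQ, root_toMod hp hQ]

omit hQ [IsDomain D] [IsFractionRing D K] in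
theorem Semistar.map_bot (s : Semistar D K) : s.toFun ⊥ = ⊥ ∨ ∀ I, s.toFun I = ⊤ := by
  refine or_iff_not_imp_left.2 fun h I => ?_
  obtain ⟨y, hy, hy0⟩ := (Submodule.ne_bot_iff _).1 h
  suffices s.toFun ⊥ = ⊤ from eq_top_iff.2 (this.ge.trans (s.mono' bot_le))
  refine eq_top_iff.2 fun x _ => ?_
  by_cases hx : x = 0
  · exact hx ▸ zero_mem _
  have := s.smul' (x / y) (div_ne_zero hx hy0) ⊥
  rw [Submodule.mul_bot] at this
  rw [this, Submodule.mem_span_singleton_mul]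
  exact ⟨y, hy, div_mul_cancel₀ _ hy0⟩

open Classical in
/-- The semistar operation attached to a closure of nonzero modules. -/
def toSemistar (e : EqClosure (Grp hp Q) (Win hp Q)) : Semistar D K :=
  let F : Submodule D K → Submodule D K := fun I =>
    if h : I = ⊥ then ⊥ else (e ⟨I, (mem_root_win hp hQ).2 h⟩).1
  have hF0 : F ⊥ = ⊥ := dif_pos rfl
  have hF : ∀ I : Win hp Q, F I.1 = (e I).1 := fun I => dif_neg ((mem_root_win hp hQ).1 I.2)
  { toFun := F
    le_star' := fun I => by
      by_cases h : I = ⊥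
      · rw [h]; exact bot_le
      · lift I to Win hp Q using (mem_root_win hp hQ).2 h
        rw [hF]
        exact e.le_apply I
    mono' := fun I J hIJ => by
      by_cases h : I = ⊥
      · rw [h, hF0]; exact bot_le
      · lift I to Win hp Q using (mem_root_win hp hQ).2 h
        lift J to Win hp Q using (mem_root_win hp hQ).2 fun h' => h (le_bot_iff.1 (h' ▸ hIJ))
        rw [hF, hF]
        exact e.mono hIJ
    idem' := fun I => by
      by_cases h : I = ⊥
      · rw [h, hF0, hF0]
      · lift I to Win hp Q using (mem_root_win hp hQ).2 h
        rw [hF, hF, e.idem]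
    smul' := fun x hx I => by
      rw [← rootUnit_smul hp hQ hx, ← rootUnit_smul hp hQ hx]
      by_cases h : I = ⊥
      · rw [h, rootUnit_smul, Submodule.mul_bot, hF0, rootUnit_smul, Submodule.mul_bot]
      · lift I to Win hp Q using (mem_root_win hp hQ).2 h
        rw [hF]
        exact (hF (rootUnit hp hQ hx • I)).trans (congrArg Subtype.val (e.map_smul _ I)) }

theorem toSemistar_bot (e : EqClosure (Grp hp Q) (Win hp Q)) :
    (toSemistar hp hQ e).toFun ⊥ = ⊥ := dif_pos rfl

theorem toSemistar_apply (e : EqClosure (Grp hp Q) (Win hp Q)) (I : Win hp Q) :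
    (toSemistar hp hQ e).toFun I.1 = (e I).1 := dif_neg ((mem_root_win hp hQ).1 I.2)

omit hQ in
variable (D K) in
/-- The semistar operation sending every module to the quotient field. -/
def topSemistar : Semistar D K where
  toFun _ := ⊤
  le_star' _ := le_top
  mono' _ _ _ := le_rfl
  idem' _ := rfl
  smul' x hx _ := (eq_top_iff.2 fun y _ => Submodule.mem_span_singleton_mul.2
    ⟨x⁻¹ * y, Submodule.mem_top, mul_inv_cancel_left₀ hx y⟩).symm

/-- Semistar operations in terms of closures of nonzero modules. -/
def semistarIso : WithTop (EqClosure (Grp hp Q) (Win hp Q)) ≃o Semistar D K :=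
  orderIsoOfSurjective (fun e => e.recTopCoe (topSemistar D K) (toSemistar hp hQ))
    (fun e e' => by
      cases e' with
      | top => exact iff_of_true (fun I => le_top) le_top
      | coe e' =>
        cases e with
        | top =>
          refine iff_of_false (fun h => ?_) (by simp)
          exact bot_ne_top (le_antisymm bot_le ((h ⊥).trans_eq (toSemistar_bot hp hQ e')))
        | coe e =>
          rw [WithTop.coe_le_coe]
          refine ⟨fun h I => ?_, fun h I => ?_⟩
          · have := h I.1
            rwa [WithTop.recTopCoe_coe, WithTop.recTopCoe_coe, toSemistar_apply,
              toSemistar_apply] at this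
          · rw [WithTop.recTopCoe_coe, WithTop.recTopCoe_coe]
            by_cases hI : I = ⊥
            · rw [hI, toSemistar_bot, toSemistar_bot]
            · lift I to Win hp Q using (mem_root_win hp hQ).2 hI
              rw [toSemistar_apply, toSemistar_apply]
              exact h I)
    (fun s => by
      rcases s.map_bot with h | h
      · have hne : ∀ I : Win hp Q, s.toFun I.1 ∈ Win hp Q := fun I => (mem_root_win hp hQ).2
          fun h' => (mem_root_win hp hQ).1 I.2 (le_bot_iff.1 (h' ▸ s.le_star' I.1))
        let e : EqClosure (Grp hp Q) (Win hp Q) :=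
          { toFun := fun I => ⟨s.toFun I.1, hne I⟩
            le_apply := fun I => s.le_star' I.1
            mono := fun _ _ hIJ => s.mono' hIJ
            idem := fun I => Subtype.ext (s.idem' I.1)
            map_smul := fun g I => Subtype.ext (by
              have := s.smul' ((g : Kˣ) : K) (Units.ne_zero _) I.1
              rwa [span_singleton_mul_eq_smul, span_singleton_mul_eq_smul] at this) }
        refine ⟨(e : WithTop _), Semistar.ext' (funext fun I => ?_)⟩
        change (toSemistar hp hQ e).toFun I = _
        by_cases hI : I = ⊥
        · rw [hI, toSemistar_bot, h]
        · lift I to Win hp Q using (mem_root_win hp hQ).2 hI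
          exact toSemistar_apply hp hQ e I
      · exact ⟨⊤, Semistar.ext' (funext fun I => (h I).symm)⟩)

theorem semistarIso_top (I : Submodule D K) : (semistarIso hp hQ ⊤).toFun I = ⊤ := rfl

theorem semistarIso_coe (e : EqClosure (Grp hp Q) (Win hp Q)) (I : Win hp Q) :
    (semistarIso hp hQ (e : WithTop _)).toFun I.1 = (e I).1 := toSemistar_apply hp hQ e I

theorem semistarIso_coe_one (e : EqClosure (Grp hp Q) (Win hp Q)) :
    (semistarIso hp hQ (e : WithTop _)).toFun 1 = 1 ↔
      e (valAt hp Q.1).baseX = (valAt hp Q.1).baseX := by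
  rw [← root_base hp hQ, Subtype.ext_iff, ← semistarIso_coe hp hQ]
  rfl

end root
end Paper

namespace Paper

section skeleton
variable {D : Type*} [CommRing D] [IsDomain D] {K : Type*} [Field K] [Algebra D K]
  [IsFractionRing D K]

variable (D K) in
/-- The intersection of the localizations at the maximal ideals above a given ideal. -/
def ringAbove (P : Ideal D) : Subalgebra D K :=
  sInf {A | ∃ (N : Ideal D) (hN : N.IsMaximal), P ≤ N ∧ A = locAt D K N hN.isPrime}

theorem mem_ringAbove {P : Ideal D} {x : K} : x ∈ ringAbove D K P ↔
    ∀ (N : Ideal D) (hN : N.IsMaximal), P ≤ N → x ∈ locAt D K N hN.isPrime := by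
  rw [ringAbove, Algebra.mem_sInf]
  exact ⟨fun h N hN hPN => h _ ⟨N, hN, hPN, rfl⟩, fun h A ⟨N, hN, hPN, hA⟩ => hA ▸ h N hN hPN⟩

theorem toSubmodule_ringAbove (hp : IsPrufer D K) (P : Ideal D) [hP : P.IsPrime] :
    Subalgebra.toSubmodule (ringAbove D K P) = (valAt hp P).base := by
  refine le_antisymm (fun x hx => ?_) (sup_le ?_ fun x hx => ?_)
  · have hx : x ∈ ringAbove D K P := hx
    rw [mem_ringAbove] at hx
    have hxP : (valAt hp P).v x ≤ 1 := by
      obtain ⟨N, hN, hPN⟩ := Ideal.exists_le_maximal P hP.ne_top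
      have := hN.isPrime
      exact ValOver.toMod_le_toMod ((valAt_le_valAt_iff hp).2 hPN)
        ((mem_valAt_toMod_iff_mem_locAt hp).2 (hx N hN hPN))
    let c : Ideal D := (valAt hp P).base.comap (LinearMap.toSpanSingleton D K x)
    have hc : ∀ d, d ∈ c ↔ d • x ∈ (valAt hp P).base := fun d => Iff.rfl
    suffices c = ⊤ by
      have h1 := (hc 1).1 (this ▸ Submodule.mem_top)
      rwa [one_smul] at h1
    by_contra hne
    obtain ⟨N, hN, hcN⟩ := Ideal.exists_le_maximal c hne
    by_cases hPN : P ≤ N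
    · obtain ⟨s, hs, a, h⟩ := mem_locAt_iff.1 (hx N hN hPN)
      refine hs (hcN ((hc s).2 (h ▸ ?_)))
      exact (le_sup_left : 1 ≤ (valAt hp P).base) (Submodule.mem_one.2 ⟨a, rfl⟩)
    · obtain ⟨p, hpP, hpN⟩ := SetLike.not_le_iff_exists.1 hPN
      exact hpN (hcN ((hc p).2 ((le_sup_right : (valAt hp P).maxMod ≤ _)
        (v_smul_lt hp hpP hxP))))
  · rw [Submodule.one_le]
    exact one_mem (ringAbove D K P)
  · refine mem_ringAbove.2 fun N hN hPN => ?_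
    have := hN.isPrime
    exact (mem_valAt_toMod_iff_mem_locAt hp).1 ((ValOver.maxMod_lt_toMod _).le
      (ValOver.maxMod_le_maxMod ((valAt_le_valAt_iff hp).2 hPN) hx))

variable (D K) in
/-- The overring attached to a set of children. -/
def ringOf {Q : hiSpec D} (S : Set (Child Q)) : Subalgebra D K :=
  sInf ((fun i : Child Q => ringAbove D K i.1.1) '' S)

variable {Q : hiSpec D}

theorem mem_ringOf {S : Set (Child Q)} {x : K} :
    x ∈ ringOf D K S ↔ ∀ i ∈ S, x ∈ ringAbove D K i.1.1 := by
  rw [ringOf, Algebra.mem_sInf, Set.forall_mem_image]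

theorem ringOf_singleton (i : Child Q) : ringOf D K {i} = ringAbove D K i.1.1 := by
  rw [ringOf, Set.image_singleton, sInf_singleton]

theorem ringOf_empty : ringOf D K (∅ : Set (Child Q)) = ⊤ := by
  rw [ringOf, Set.image_empty, sInf_empty]

variable (hp : IsPrufer D K) (hfin : (hiSpec D).Finite) (hQ : Q.1 = ⊥)

include hQ in
theorem toSubmodule_ringOf (S : Set (Child Q)) : Subalgebra.toSubmodule (ringOf D K S) =
    glueMod (IndependentActions.basePoint (baseCoord hp) S) := by
  ext x
  rw [mem_glueMod, Subalgebra.mem_toSubmodule, mem_ringOf]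
  have hx : x ∈ (valAt hp Q.1).toMod := root_toMod hp hQ ▸ Submodule.mem_top
  refine Iff.trans ?_ (and_iff_right hx).symm
  refine forall_congr' fun i => ?_
  rw [IndependentActions.basePoint]
  split_ifs with hi
  · rw [forall_prop_of_true hi, ← Subalgebra.mem_toSubmodule, toSubmodule_ringAbove hp]
    rfl
  · exact iff_of_true (fun h => absurd h hi) hx

include hp hfin hQ

theorem ringOf_le_ringOf_iff {S S' : Set (Child Q)} : ringOf D K S ≤ ringOf D K S' ↔ S' ⊆ S := by
  refine ⟨fun h i hi => by_contra fun hiS => ?_, fun h => sInf_le_sInf (Set.image_mono h)⟩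
  have h' : Subalgebra.toSubmodule (ringOf D K S) ≤ Subalgebra.toSubmodule (ringOf D K S') := h
  rw [toSubmodule_ringOf hp hQ, toSubmodule_ringOf hp hQ] at h'
  have := le_of_glueMod_le hfin h' i
  rw [IndependentActions.basePoint, IndependentActions.basePoint, if_neg hiS, if_pos hi] at this
  exact WithTop.coe_ne_top (top_le_iff.1 this)

theorem ringOf_injective : Function.Injective (ringOf D K : Set (Child Q) → _) := fun _ _ h =>
  ((ringOf_le_ringOf_iff hp hfin hQ).1 h.ge).antisymm ((ringOf_le_ringOf_iff hp hfin hQ).1 h.le)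

omit hfin in
theorem dependent_iff (hfin : (hiSpec D).Finite) {i : Child Q} {M N : Ideal D}
    (hM : M.IsMaximal) (hN : N.IsMaximal) (hi : i.1.1 ≤ M) : Dependent D M N ↔ i.1.1 ≤ N := by
  have hM' := hM.isPrime
  have hN' := hN.isPrime
  refine ⟨?_, fun h => ⟨i.1.1, i.1.2.1, fun h0 => ?_, hi, h⟩⟩
  · rintro ⟨R, hR, hR0, hRM, hRN⟩
    rcases eq_or_exists_child_le (Q := Q) hfin hN (hQ ▸ bot_le) with h | ⟨j, hj⟩
    · exact absurd (le_bot_iff.1 (hQ ▸ h ▸ hRN)) hR0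
    by_contra hiN
    have hij : i ≠ j := fun h => hiN (h ▸ hj)
    refine hR0 (le_bot_iff.1 (hQ ▸ le_of_le_children hp hij hR ?_ ?_))
    · exact (le_or_le_of_le hp hRM hi).resolve_right fun h => hiN (h.trans hRN)
    · exact (le_or_le_of_le hp hRN hj).resolve_right fun h =>
        not_le_of_child_le hp hij hM' hi (h.trans hRM)
  · exact i.lt.not_ge (h0 ▸ bot_le)

theorem TOf_eq_ringAbove {i : Child Q} {M : Ideal D} (hM : M.IsMaximal) (hi : i.1.1 ≤ M) :
    TOf D K M = ringAbove D K i.1.1 :=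
  congrArg sInf <| Set.ext fun _ => exists_congr fun _ => exists_congr fun hN =>
    and_congr_left fun _ => dependent_iff hp hQ hfin hM hN hi

theorem mem_stdDecomp_iff {T : Subalgebra D K} : T ∈ stdDecomp D K ↔
    (∃ i : Child Q, T = ringAbove D K i.1.1) ∨ IsEmpty (Child Q) ∧ T = ⊤ := by
  have hbot : TOf D K (⊥ : Ideal D) = ⊤ := by
    refine eq_top_iff.2 (le_sInf ?_)
    rintro _ ⟨N, hN, ⟨R, hR, hR0, hR', -⟩, -⟩
    exact absurd (le_bot_iff.1 hR') hR0
  constructor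
  · rintro ⟨M, hM, rfl⟩
    rcases eq_or_exists_child_le (Q := Q) hfin hM (hQ ▸ bot_le) with rfl | ⟨i, hi⟩
    · refine Or.inr ⟨⟨fun i => ?_⟩, by rw [hQ, hbot]⟩
      exact i.1.2.1.ne_top (hM.out.2 _ i.lt)
    · exact Or.inl ⟨i, TOf_eq_ringAbove hp hfin hQ hM hi⟩
  · rintro (⟨i, rfl⟩ | ⟨hE, rfl⟩)
    · obtain ⟨M, hM, hi⟩ := Ideal.exists_le_maximal i.1.1 i.1.2.1.ne_top
      exact ⟨M, hM, (TOf_eq_ringAbove hp hfin hQ hM hi).symm⟩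
    · exact ⟨Q.1, isMaximal_of_isEmpty hfin, by rw [hQ, hbot]⟩

theorem ringOf_mem_skOver (S : Set (Child Q)) : ringOf D K S ∈ SkOver D K :=
  ⟨(fun i : Child Q => ringAbove D K i.1.1) '' S, Set.image_subset_iff.2 fun i _ =>
    (mem_stdDecomp_iff hp hfin hQ).2 (Or.inl ⟨i, rfl⟩), rfl⟩

theorem exists_ringOf_eq {A : Subalgebra D K} (hA : A ∈ SkOver D K) :
    ∃ S : Set (Child Q), ringOf D K S = A := by
  obtain ⟨F, hF, rfl⟩ := hA
  refine ⟨{i | ringAbove D K i.1.1 ∈ F}, le_antisymm (le_sInf fun T hT => ?_)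
    (sInf_le_sInf (Set.image_subset_iff.2 fun i hi => hi))⟩
  rcases (mem_stdDecomp_iff hp hfin hQ).1 (hF hT) with ⟨i, rfl⟩ | ⟨-, rfl⟩
  · exact sInf_le ⟨i, hT, rfl⟩
  · exact le_top

/-- The skeleton corresponds to the sets of children of the root. -/
def skOverIso : (Set (Child Q))ᵒᵈ ≃o SkOver D K :=
  orderIsoOfSurjective (fun S => ⟨ringOf D K S.ofDual, ringOf_mem_skOver hp hfin hQ _⟩)
    (fun _ _ => ringOf_le_ringOf_iff hp hfin hQ)
    fun A => (exists_ringOf_eq hp hfin hQ A.2).imp fun _ h => Subtype.ext h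

theorem ringOf_mem_stdDecomp_iff {S : Set (Child Q)} :
    ringOf D K S ∈ stdDecomp D K ↔ (∃ i, S = {i}) ∨ IsEmpty (Child Q) := by
  rw [mem_stdDecomp_iff hp hfin hQ]
  simp_rw [← ringOf_singleton, ← ringOf_empty (Q := Q), (ringOf_injective hp hfin hQ).eq_iff]
  refine or_congr_right ⟨And.left, fun h => ⟨h, Set.eq_empty_of_isEmpty S⟩⟩

end skeleton
end Paper

namespace Paper

section supp
variable {D : Type*} [CommRing D] [IsDomain D] {K : Type*} [Field K] [Algebra D K]

omit [IsDomain D] in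
theorem Semistar.mul_mem_toFun (s : Semistar D K) (A : Subalgebra D K) {a x : K} (ha : a ∈ A)
    (hx : x ∈ s.toFun (Subalgebra.toSubmodule A)) :
    a * x ∈ s.toFun (Subalgebra.toSubmodule A) := by
  by_cases h0 : a = 0
  · rw [h0, zero_mul]; exact zero_mem _
  have hle : Submodule.span D {a} * Subalgebra.toSubmodule A ≤ Subalgebra.toSubmodule A := by
    intro y hy
    obtain ⟨z, hz, rfl⟩ := Submodule.mem_span_singleton_mul.1 hy
    exact A.mul_mem ha hz
  refine s.mono' hle ?_
  rw [s.smul' a h0, Submodule.mem_span_singleton_mul]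
  exact ⟨x, hx, rfl⟩

variable [IsFractionRing D K] {hp : IsPrufer D K} {Q : hiSpec D} (hfin : (hiSpec D).Finite)
  (hQ : Q.1 = ⊥)

include hfin in
theorem forall_inv_mul_mem_iff (u : Grp hp Q) {t t' : ∀ j : Child Q, WithTop (Coord hp j)} :
    (∀ x ∈ glueMod t', (((u : Kˣ) : K))⁻¹ * x ∈ glueMod t) ↔ t' ≤ u • t := by
  rw [← (winIso hp Q hfin).le_iff_le, winIso_smul]
  exact forall₂_congr fun x _ => (mem_subgroup_smul_iff u (glueMod t) x).symm

include hfin hQ in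
theorem exists_mul_mem_glueMod_iff {t t' : ∀ j : Child Q, WithTop (Coord hp j)} :
    (∃ d : K, d ≠ 0 ∧ ∀ x ∈ glueMod t', d * x ∈ glueMod t) ↔ ∀ j, t j ≠ ⊤ → t' j ≠ ⊤ := by
  constructor
  · rintro ⟨d, hd, h⟩ j hj hj'
    have := (forall_inv_mul_mem_iff hfin (rootUnit hp hQ (inv_ne_zero hd)) (t := t)
      (t' := t')).1 (by rwa [coe_rootUnit, inv_inv]) j
    rw [hj', Pi.smul_apply, top_le_iff] at this
    revert this hj
    cases t j with
    | top => exact fun h _ => h rfl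
    | coe I => exact fun _ => WithTop.coe_ne_top
  · intro h
    have hG := independentActions hp Q hfin
    choose γ hγ using fun j => hG.exists_le_top j (t' j) (t j) fun h' => by
      by_contra hj
      exact h j hj h'
    obtain ⟨u, hu⟩ := hG.approx_top γ
    refine ⟨(((u : Kˣ) : K))⁻¹, inv_ne_zero (Units.ne_zero _),
      (forall_inv_mul_mem_iff hfin u).2 fun j => ?_⟩
    rw [Pi.smul_apply, hu]
    exact hγ j

variable (hp) in
/-- Semistar operations in terms of families of closures of coordinates. -/
def semistarFamilyIso :
    WithTop (SupportedFamily fun j : Child Q => EqClosure (Grp hp Q) (Coord hp j)) ≃o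
      Semistar D K :=
  (closIso hp Q hfin).withTopCongr.trans (semistarIso hp hQ)

theorem semistarFamilyIso_coe
    (g : SupportedFamily fun j : Child Q => EqClosure (Grp hp Q) (Coord hp j)) :
    semistarFamilyIso hp hfin hQ g = semistarIso hp hQ (closIso hp Q hfin g : EqClosure _ _) :=
  rfl

theorem semistarFamilyIso_top :
    semistarFamilyIso hp hfin hQ ⊤ = semistarIso hp hQ ⊤ := rfl

include hfin hQ in
theorem ringOf_mem_supp_iff {s : Semistar D K} {S : Set (Child Q)}
    {t : ∀ j : Child Q, WithTop (Coord hp j)}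
    (h : s.toFun (Subalgebra.toSubmodule (ringOf D K S)) = glueMod t) :
    ringOf D K S ∈ supp D K s ↔ ∀ j ∈ S, t j ≠ ⊤ := by
  rw [supp, Set.mem_ofPred_eq, and_iff_right (ringOf_mem_skOver hp hfin hQ S), IsFracOf,
    and_iff_right fun a ha x hx => s.mul_mem_toFun _ ha hx, h]
  simp_rw [← Subalgebra.mem_toSubmodule, toSubmodule_ringOf hp hQ]
  rw [exists_mul_mem_glueMod_iff hfin hQ]
  refine forall_congr' fun j => ?_
  have : j ∈ S ↔ IndependentActions.basePoint (baseCoord hp) S j ≠ ⊤ := by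
    conv_lhs => rw [← IndependentActions.setOf_basePoint_ne_top (baseCoord hp) S]
    rfl
  rw [this]

theorem ringOf_mem_supp_coe
    (g : SupportedFamily fun j : Child Q => EqClosure (Grp hp Q) (Coord hp j))
    (S : Set (Child Q)) :
    ringOf D K S ∈ supp D K (semistarFamilyIso hp hfin hQ g) ↔ ∀ j ∈ S, g.val S j ≠ ⊤ := by
  have h : (semistarFamilyIso hp hfin hQ g).toFun (Subalgebra.toSubmodule (ringOf D K S)) =
      glueMod fun j => evalTop (g.val S j)
        (IndependentActions.basePoint (baseCoord hp) S j) := by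
    rw [toSubmodule_ringOf hp hQ, ← coe_winIso hfin, semistarFamilyIso_coe, semistarIso_coe,
      closIso_apply, coe_winIso, IndependentActions.setOf_basePoint_ne_top]
  rw [ringOf_mem_supp_iff hfin hQ h]
  refine forall₂_congr fun j hj => ?_
  rw [evalTop_ne_top, and_iff_left]
  rw [IndependentActions.basePoint, if_pos hj]
  exact WithTop.coe_ne_top

theorem ringOf_mem_supp_top (S : Set (Child Q)) :
    ringOf D K S ∈ supp D K (semistarFamilyIso hp hfin hQ ⊤) ↔ ∀ j ∈ S, False := by
  have h : (semistarFamilyIso hp hfin hQ ⊤).toFun (Subalgebra.toSubmodule (ringOf D K S)) =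
      glueMod fun j : Child Q => (⊤ : WithTop (Coord hp j)) := by
    rw [semistarFamilyIso_top, semistarIso_top, eq_comm, eq_top_iff]
    refine le_inf (root_toMod hp hQ).ge (le_iInf fun j => (root_toMod hp hQ).ge)
  rw [ringOf_mem_supp_iff hfin hQ h]
  simp

end supp

section congr
variable {D₁ : Type*} [CommRing D₁] [IsDomain D₁] {K₁ : Type*} [Field K₁] [Algebra D₁ K₁]
  [IsFractionRing D₁ K₁] {hp₁ : IsPrufer D₁ K₁} {Q₁ : hiSpec D₁}
  (hfin₁ : (hiSpec D₁).Finite) (hQ₁ : Q₁.1 = ⊥)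
  {D₂ : Type*} [CommRing D₂] [IsDomain D₂] {K₂ : Type*} [Field K₂] [Algebra D₂ K₂]
  [IsFractionRing D₂ K₂] {hp₂ : IsPrufer D₂ K₂} {Q₂ : hiSpec D₂}
  (hfin₂ : (hiSpec D₂).Finite) (hQ₂ : Q₂.1 = ⊥)
  {σ : Child Q₁ ≃ Child Q₂}
  (e : ∀ j, EqClosure (Grp hp₁ Q₁) (Coord hp₁ j) ≃o EqClosure (Grp hp₂ Q₂) (Coord hp₂ (σ j)))

/-- Isomorphisms between the closures of coordinates induce an isomorphism between semistar
operations. -/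
def semistarCongr : Semistar D₁ K₁ ≃o Semistar D₂ K₂ :=
  (semistarFamilyIso hp₁ hfin₁ hQ₁).symm.trans
    ((SupportedFamily.congr σ e).withTopCongr.trans (semistarFamilyIso hp₂ hfin₂ hQ₂))

theorem semistarCongr_apply (g) :
    semistarCongr hfin₁ hQ₁ hfin₂ hQ₂ e (semistarFamilyIso hp₁ hfin₁ hQ₁ g) =
      semistarFamilyIso hp₂ hfin₂ hQ₂ ((SupportedFamily.congr σ e).withTopCongr g) := by
  rw [semistarCongr, OrderIso.trans_apply, OrderIso.symm_apply_apply, OrderIso.trans_apply]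

theorem semistarCongr_coe (g : SupportedFamily fun j : Child Q₁ =>
    EqClosure (Grp hp₁ Q₁) (Coord hp₁ j)) :
    semistarCongr hfin₁ hQ₁ hfin₂ hQ₂ e (semistarFamilyIso hp₁ hfin₁ hQ₁ g) =
      semistarFamilyIso hp₂ hfin₂ hQ₂ (WithTop.some (SupportedFamily.congr σ e g)) :=
  semistarCongr_apply ..

theorem semistarCongr_top :
    semistarCongr hfin₁ hQ₁ hfin₂ hQ₂ e (semistarFamilyIso hp₁ hfin₁ hQ₁ ⊤) =
      semistarFamilyIso hp₂ hfin₂ hQ₂ ⊤ :=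
  semistarCongr_apply ..

theorem ringOf_mem_supp_semistarCongr (s : Semistar D₁ K₁) (S : Set (Child Q₁)) :
    ringOf D₂ K₂ (σ '' S) ∈ supp D₂ K₂ (semistarCongr hfin₁ hQ₁ hfin₂ hQ₂ e s) ↔
      ringOf D₁ K₁ S ∈ supp D₁ K₁ s := by
  obtain ⟨g, rfl⟩ := (semistarFamilyIso hp₁ hfin₁ hQ₁).surjective s
  cases g with
  | top =>
    rw [semistarCongr_top, ringOf_mem_supp_top, ringOf_mem_supp_top, Set.forall_mem_image]
  | coe g =>
    rw [semistarCongr_coe, ringOf_mem_supp_coe, ringOf_mem_supp_coe, Set.forall_mem_image]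
    refine forall₂_congr fun j _ => ?_
    rw [SupportedFamily.congr_apply, Equiv.preimage_image, Ne, map_eq_top_iff]

theorem semistarCongr_one
    (he : ∀ j s, s (baseCoord hp₁ j) = baseCoord hp₁ j ↔
      e j s (baseCoord hp₂ (σ j)) = baseCoord hp₂ (σ j))
    (hmax : Q₁.1.IsMaximal ↔ Q₂.1.IsMaximal) (s : Semistar D₁ K₁) :
    s.toFun 1 = 1 ↔ (semistarCongr hfin₁ hQ₁ hfin₂ hQ₂ e s).toFun 1 = 1 := by
  obtain ⟨g, rfl⟩ := (semistarFamilyIso hp₁ hfin₁ hQ₁).surjective s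
  cases g with
  | top =>
    rw [semistarCongr_top, semistarFamilyIso_top, semistarFamilyIso_top, semistarIso_top,
      semistarIso_top, eq_comm, one_eq_top_iff hp₁ hQ₁, eq_comm, one_eq_top_iff hp₂ hQ₂, hmax]
  | coe g =>
    rw [semistarCongr_coe]
    refine (semistarIso_coe_one hp₁ hQ₁ _).trans ((closIso_congr_baseX hfin₁ hfin₂ he g).trans
      (semistarIso_coe_one hp₂ hQ₂ _).symm)

/-- A bijection between the children of the roots induces an isomorphism of skeletons. -/
def skOverCongr (hp₁ : IsPrufer D₁ K₁) (hp₂ : IsPrufer D₂ K₂) (σ : Child Q₁ ≃ Child Q₂) :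
    SkOver D₁ K₁ ≃o SkOver D₂ K₂ :=
  let φ : Set (Child Q₁) ≃o Set (Child Q₂) :=
    { Equiv.Set.congr σ with map_rel_iff' := Set.image_subset_image_iff σ.injective }
  (skOverIso hp₁ hfin₁ hQ₁).symm.trans (φ.dual.trans (skOverIso hp₂ hfin₂ hQ₂))

theorem exists_skOverCongr_eq (hp₁ : IsPrufer D₁ K₁) (hp₂ : IsPrufer D₂ K₂)
    (A : SkOver D₁ K₁) : ∃ S : Set (Child Q₁), ringOf D₁ K₁ S = A.1 ∧
      ringOf D₂ K₂ (σ '' S) = (skOverCongr hfin₁ hQ₁ hfin₂ hQ₂ hp₁ hp₂ σ A).1 := by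
  obtain ⟨S, rfl⟩ := (skOverIso hp₁ hfin₁ hQ₁).surjective A
  refine ⟨S.ofDual, rfl, ?_⟩
  rw [skOverCongr, OrderIso.trans_apply, OrderIso.symm_apply_apply]
  rfl

theorem skOverCongr_mem_stdDecomp_iff (hp₁ : IsPrufer D₁ K₁) (hp₂ : IsPrufer D₂ K₂)
    (A : SkOver D₁ K₁) : A.1 ∈ stdDecomp D₁ K₁ ↔
      (skOverCongr hfin₁ hQ₁ hfin₂ hQ₂ hp₁ hp₂ σ A).1 ∈ stdDecomp D₂ K₂ := by
  obtain ⟨S, h, h'⟩ := exists_skOverCongr_eq hfin₁ hQ₁ hfin₂ hQ₂ (σ := σ) hp₁ hp₂ A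
  rw [← h, ← h', ringOf_mem_stdDecomp_iff hp₁ hfin₁ hQ₁, ringOf_mem_stdDecomp_iff hp₂ hfin₂ hQ₂,
    ← σ.exists_congr_right, σ.isEmpty_congr]
  refine or_congr_left (exists_congr fun i => ?_)
  rw [← Set.image_singleton, (Set.image_injective.2 σ.injective).eq_iff]

theorem semistarCongr_image_supp (Δ : Set (Subalgebra D₁ K₁)) (hΔ : Δ ⊆ SkOver D₁ K₁) :
    semistarCongr hfin₁ hQ₁ hfin₂ hQ₂ e '' {s | supp D₁ K₁ s = Δ} =
      {s | supp D₂ K₂ s = (fun A : SkOver D₁ K₁ =>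
        (skOverCongr hfin₁ hQ₁ hfin₂ hQ₂ hp₁ hp₂ σ A).1) '' {A | A.1 ∈ Δ}} := by
  set n := skOverCongr hfin₁ hQ₁ hfin₂ hQ₂ hp₁ hp₂ σ with hn
  have key : ∀ (s : Semistar D₁ K₁) (A : SkOver D₁ K₁),
      (n A).1 ∈ supp D₂ K₂ (semistarCongr hfin₁ hQ₁ hfin₂ hQ₂ e s) ↔ A.1 ∈ supp D₁ K₁ s :=
    fun s A => by
      obtain ⟨S, h, h'⟩ := exists_skOverCongr_eq hfin₁ hQ₁ hfin₂ hQ₂ (σ := σ) hp₁ hp₂ A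
      rw [hn, ← h, ← h', ringOf_mem_supp_semistarCongr]
  rw [← OrderIso.coe_toEquiv, Equiv.image_eq_preimage_symm]
  ext s
  obtain ⟨s, rfl⟩ := (semistarCongr hfin₁ hQ₁ hfin₂ hQ₂ e).surjective s
  have hs : (semistarCongr hfin₁ hQ₁ hfin₂ hQ₂ e).toEquiv.symm
      (semistarCongr hfin₁ hQ₁ hfin₂ hQ₂ e s) = s := Equiv.symm_apply_apply _ _
  rw [Set.mem_preimage, hs, Set.mem_ofPred_eq, Set.mem_ofPred_eq]
  constructor
  · rintro rfl
    ext B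
    constructor
    · intro hB
      obtain ⟨A, hA⟩ := n.surjective ⟨B, hB.1⟩
      have hB' : (n A).1 = B := congrArg Subtype.val hA
      exact ⟨A, (key s A).1 (hB' ▸ hB), hB'⟩
    · rintro ⟨A, hA, rfl⟩
      exact (key s A).2 hA
  · intro h
    ext A
    constructor
    · intro hA
      have := (key s ⟨A, hA.1⟩).2 hA
      rw [h] at this
      obtain ⟨A', hA', h'⟩ := this
      have := n.injective (Subtype.ext h')
      rw [this] at hA'
      exact hA'
    · intro hA
      exact (key s ⟨A, hΔ hA⟩).1 (h ▸ ⟨⟨A, hΔ hA⟩, hA, rfl⟩)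

end congr
end Paper

namespace Paper

section fractional
variable {D : Type*} [CommRing D] [IsDomain D] {K : Type*} [Field K] [Algebra D K]

omit [IsDomain D] in
theorem isFracOf_bot_iff {I : Submodule D K} : IsFracOf D K ⊥ I ↔
    ∃ d : K, d ≠ 0 ∧ ∀ x ∈ I, d * x ∈ (1 : Submodule D K) := by
  rw [← Algebra.toSubmodule_bot]
  refine and_iff_right fun a ha x hx => ?_
  obtain ⟨r, rfl⟩ := Algebra.mem_bot.1 ha
  rw [← Algebra.smul_def]
  exact I.smul_mem r hx

variable [IsFractionRing D K] (hp : IsPrufer D K) (Q : hiSpec D)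

/-- The nonzero fractional ideals. -/
def fracMods : SubMulAction (Grp hp Q) (Submodule D K) where
  carrier := {I | I ≠ ⊥ ∧ IsFracOf D K ⊥ I}
  smul_mem' u I hI := by
    obtain ⟨h0, hI⟩ := hI
    obtain ⟨x, hx, hx0⟩ := (Submodule.ne_bot_iff _).1 h0
    obtain ⟨d, hd, h⟩ := isFracOf_bot_iff.1 hI
    have hu : ((u : Kˣ) : K) ≠ 0 := Units.ne_zero _
    refine ⟨(Submodule.ne_bot_iff _).2 ⟨((u : Kˣ) : K) * x, ?_, mul_ne_zero hu hx0⟩,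
      isFracOf_bot_iff.2 ⟨d * ((u : Kˣ) : K)⁻¹, mul_ne_zero hd (inv_ne_zero hu), fun y hy => ?_⟩⟩
    · rwa [mem_subgroup_smul_iff, inv_mul_cancel_left₀ hu]
    · rw [mul_assoc]
      exact h _ ((mem_subgroup_smul_iff u I y).1 hy)

variable {hp Q} (hfin : (hiSpec D).Finite) (hQ : Q.1 = ⊥)

include hfin hQ in
theorem glueMod_baseCoord : glueMod (fun j : Child Q => (baseCoord hp j : WithTop (Coord hp j))) =
    (1 : Submodule D K) := by
  rw [← coe_winIso hfin, winIso_baseCoord, ← root_base hp hQ]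
  rfl

include hfin hQ in
theorem glueMod_mem_fracMods_iff {t : ∀ j : Child Q, WithTop (Coord hp j)} :
    glueMod t ∈ fracMods hp Q ↔ ∀ j, t j ≠ ⊤ := by
  refine (and_iff_right ((mem_root_win hp hQ).1 (glueMod_mem_window hfin t))).trans ?_
  rw [isFracOf_bot_iff, ← glueMod_baseCoord (hp := hp) hfin hQ, exists_mul_mem_glueMod_iff hfin hQ]
  exact forall_congr' fun j => forall_prop_of_true WithTop.coe_ne_top

variable (hp) in
/-- Nonzero fractional ideals correspond to their families of coordinates. -/
def fracIso : (∀ j : Child Q, Coord hp j) ≃o fracMods hp Q :=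
  orderIsoOfSurjective
    (fun t => ⟨glueMod fun j => (t j : WithTop (Coord hp j)),
      (glueMod_mem_fracMods_iff hfin hQ).2 fun _ => WithTop.coe_ne_top⟩)
    (fun t t' => ((winIso hp Q hfin).le_iff_le (x := fun j => (t j : WithTop (Coord hp j)))
      (y := fun j => (t' j : WithTop (Coord hp j)))).trans
        (forall_congr' fun j => WithTop.coe_le_coe))
    fun I => by
      obtain ⟨t, ht⟩ := (winIso hp Q hfin).surjective ⟨I.1, (mem_root_win hp hQ).2 I.2.1⟩
      have ht : glueMod t = I.1 := congrArg Subtype.val ht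
      have htop := (glueMod_mem_fracMods_iff hfin hQ).1 (ht ▸ I.2)
      refine ⟨fun j => (t j).untop (htop j), Subtype.ext ?_⟩
      simpa using ht

theorem fracIso_smul (g : Grp hp Q) (t : ∀ j : Child Q, Coord hp j) :
    fracIso hp hfin hQ (g • t) = g • fracIso hp hfin hQ t :=
  Subtype.ext (by
    have := congrArg Subtype.val (winIso_smul hfin g fun j => (t j : WithTop (Coord hp j)))
    exact this)

omit [IsDomain D] [IsFractionRing D K] in
theorem isFracOf_bot_bot : IsFracOf D K ⊥ (⊥ : Submodule D K) :=
  isFracOf_bot_iff.2 ⟨1, one_ne_zero, fun x hx => by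
    rw [(Submodule.mem_bot D).1 hx, mul_zero]; exact zero_mem _⟩

omit [IsDomain D] [IsFractionRing D K] in
theorem FracStar.map_bot (h1 : (1 : Submodule D K) ≠ ⊤) (f : FracStar D K ⊥) :
    (f.toFun ⟨⊥, isFracOf_bot_bot⟩).1 = ⊥ := by
  by_contra h
  obtain ⟨y, hy, hy0⟩ := (Submodule.ne_bot_iff _).1 h
  have hall : ∀ x, x ∈ (f.toFun ⟨⊥, isFracOf_bot_bot⟩).1 := fun x => by
    by_cases hx : x = 0
    · exact hx ▸ zero_mem _
    rw [f.smul' (x / y) (div_ne_zero hx hy0) ⟨⊥, isFracOf_bot_bot⟩ ⟨⊥, isFracOf_bot_bot⟩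
      (Submodule.mul_bot _).symm, Submodule.mem_span_singleton_mul]
    exact ⟨y, hy, div_mul_cancel₀ _ hy0⟩
  obtain ⟨d, hd, h⟩ := isFracOf_bot_iff.1 (f.toFun ⟨⊥, isFracOf_bot_bot⟩).2
  refine h1 (eq_top_iff.2 fun x _ => ?_)
  rw [← mul_div_cancel₀ x hd]
  exact h _ (hall _)

open Classical in
variable (hp) in
/-- The fractional star operation attached to a closure of nonzero fractional ideals. -/
def toFracStar (e : EqClosure (Grp hp Q) (fracMods hp Q)) : FracStar D K ⊥ :=
  let F : {I : Submodule D K // IsFracOf D K ⊥ I} → {I : Submodule D K // IsFracOf D K ⊥ I} :=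
    fun I => if h : I.1 = ⊥ then ⟨⊥, isFracOf_bot_bot⟩ else
      ⟨(e ⟨I.1, h, I.2⟩).1, (e ⟨I.1, h, I.2⟩).2.2⟩
  have hF0 : ∀ I, I.1 = ⊥ → (F I).1 = ⊥ := fun I h => congrArg Subtype.val (dif_pos h)
  have hF : ∀ I (h : I.1 ≠ ⊥), (F I).1 = (e ⟨I.1, h, I.2⟩).1 := fun I h =>
    congrArg Subtype.val (dif_neg h)
  { toFun := F
    le_star' := fun I => by
      by_cases h : I.1 = ⊥
      · rw [h]; exact bot_le
      · rw [hF I h]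
        exact e.le_apply ⟨I.1, h, I.2⟩
    mono' := fun I J hIJ => by
      by_cases h : I.1 = ⊥
      · rw [hF0 I h]; exact bot_le
      · have h' : J.1 ≠ ⊥ := fun h' => h (le_bot_iff.1 (h' ▸ hIJ))
        rw [hF I h, hF J h']
        exact e.mono hIJ
    idem' := fun I => Subtype.ext (by
      by_cases h : I.1 = ⊥
      · rw [hF0 _ (hF0 I h), hF0 I h]
      · have h' : (F I).1 ≠ ⊥ := by rw [hF I h]; exact (e ⟨I.1, h, I.2⟩).2.1
        have : (⟨(F I).1, h', (F I).2⟩ : fracMods hp Q) = e ⟨I.1, h, I.2⟩ := Subtype.ext (hF I h)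
        rw [hF _ h']
        exact (congrArg (fun X => (e X).1) this).trans
          ((congrArg Subtype.val (e.idem _)).trans (hF I h).symm))
    smul' := fun x hx I J hJ => by
      rw [← rootUnit_smul hp hQ hx] at hJ ⊢
      by_cases h : I.1 = ⊥
      · rw [hF0 I h, rootUnit_smul, Submodule.mul_bot]
        rw [h, rootUnit_smul, Submodule.mul_bot] at hJ
        exact hF0 J hJ
      · have hJ' : (rootUnit hp hQ hx • (⟨I.1, h, I.2⟩ : fracMods hp Q)).1 = J.1 := hJ.symm
        have h' : J.1 ≠ ⊥ := hJ' ▸ (rootUnit hp hQ hx • (⟨I.1, h, I.2⟩ : fracMods hp Q)).2.1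
        rw [hF J h', hF I h]
        have : (⟨J.1, h', J.2⟩ : fracMods hp Q) = rootUnit hp hQ hx • ⟨I.1, h, I.2⟩ :=
          Subtype.ext hJ
        rw [this, e.map_smul]
        rfl }

theorem toFracStar_bot (e : EqClosure (Grp hp Q) (fracMods hp Q))
    {I : {I : Submodule D K // IsFracOf D K ⊥ I}} (h : I.1 = ⊥) :
    ((toFracStar hp hQ e).toFun I).1 = ⊥ := congrArg Subtype.val (dif_pos h)

theorem toFracStar_apply (e : EqClosure (Grp hp Q) (fracMods hp Q))
    {I : {I : Submodule D K // IsFracOf D K ⊥ I}} (h : I.1 ≠ ⊥) :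
    ((toFracStar hp hQ e).toFun I).1 = (e ⟨I.1, h, I.2⟩).1 := congrArg Subtype.val (dif_neg h)

variable (hp) in
/-- Fractional star operations in terms of closures of nonzero fractional ideals. -/
def fracModsIso (h1 : (1 : Submodule D K) ≠ ⊤) :
    EqClosure (Grp hp Q) (fracMods hp Q) ≃o FracStar D K ⊥ :=
  orderIsoOfSurjective (toFracStar hp hQ)
    (fun e e' => by
      refine ⟨fun h I => ?_, fun h I => ?_⟩
      · have := h ⟨I.1, I.2.2⟩
        rwa [toFracStar_apply hQ _ I.2.1, toFracStar_apply hQ _ I.2.1] at this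
      · by_cases hI : I.1 = ⊥
        · rw [toFracStar_bot hQ _ hI]; exact bot_le
        · rw [toFracStar_apply hQ _ hI, toFracStar_apply hQ _ hI]
          exact h _)
    (fun f => by
      let e : EqClosure (Grp hp Q) (fracMods hp Q) :=
        { toFun := fun I => ⟨(f.toFun ⟨I.1, I.2.2⟩).1,
            fun h => I.2.1 (le_bot_iff.1 (h ▸ f.le_star' ⟨I.1, I.2.2⟩)),
            (f.toFun ⟨I.1, I.2.2⟩).2⟩
          le_apply := fun I => f.le_star' ⟨I.1, I.2.2⟩
          mono := fun _ _ hIJ => f.mono' _ _ hIJ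
          idem := fun I => Subtype.ext (by
            have := congrArg Subtype.val (f.idem' ⟨I.1, I.2.2⟩)
            exact this)
          map_smul := fun g I => Subtype.ext (by
            have := f.smul' ((g : Kˣ) : K) (Units.ne_zero _) ⟨I.1, I.2.2⟩
              ⟨(g • I).1, (g • I).2.2⟩ (span_singleton_mul_eq_smul (g : Kˣ) I.1).symm
            rwa [span_singleton_mul_eq_smul] at this) }
      refine ⟨e, FracStar.ext' (funext fun I => Subtype.ext ?_)⟩
      by_cases hI : I.1 = ⊥
      · rw [toFracStar_bot hQ _ hI]
        obtain ⟨I, hI'⟩ := I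
        subst hI
        exact (f.map_bot h1).symm
      · exact toFracStar_apply hQ _ hI)

variable (hp) in
/-- Fractional star operations in terms of closures of coordinates. -/
def fracStarIso (h1 : (1 : Submodule D K) ≠ ⊤) :
    (∀ j : Child Q, EqClosure (Grp hp Q) (Coord hp j)) ≃o FracStar D K ⊥ :=
  (((independentActions hp Q hfin).piIso (baseCoord hp)).trans
    (EqClosure.congr (fracIso hp hfin hQ) (fun g => ⟨g, fracIso_smul hfin hQ g⟩)
      fun g => ⟨g, fracIso_smul hfin hQ g⟩)).trans (fracModsIso hp hQ h1)

theorem isStarOp_fracStarIso_iff (h1 : (1 : Submodule D K) ≠ ⊤)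
    (e : ∀ j : Child Q, EqClosure (Grp hp Q) (Coord hp j)) :
    FracStar.IsStarOp D K (fracStarIso hp hfin hQ h1 e) ↔
      ∀ j, e j (baseCoord hp j) = baseCoord hp j := by
  have hone : Subalgebra.toSubmodule (⊥ : Subalgebra D K) = (fracIso hp hfin hQ (baseCoord hp)).1 :=
    Algebra.toSubmodule_bot.trans (glueMod_baseCoord hfin hQ).symm
  have key : ∀ h, ((fracStarIso hp hfin hQ h1 e).toFun ⟨Subalgebra.toSubmodule ⊥, h⟩).1 =
      (fracIso hp hfin hQ fun j => e j (baseCoord hp j)).1 := fun h => by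
    have h0 : Subalgebra.toSubmodule (⊥ : Subalgebra D K) ≠ ⊥ :=
      hone ▸ (fracIso hp hfin hQ (baseCoord hp)).2.1
    refine (toFracStar_apply hQ _ h0).trans (congrArg Subtype.val ?_)
    have : (⟨Subalgebra.toSubmodule ⊥, h0, h⟩ : fracMods hp Q) =
      fracIso hp hfin hQ (baseCoord hp) := Subtype.ext hone
    refine (congrArg _ this).trans (EqClosure.congr_apply (fracIso hp hfin hQ)
      (fun g => ⟨g, fracIso_smul hfin hQ g⟩) (fun g => ⟨g, fracIso_smul hfin hQ g⟩) _ _)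
  have hfrac : IsFracOf D K ⊥ (Subalgebra.toSubmodule (⊥ : Subalgebra D K)) :=
    hone ▸ (fracIso hp hfin hQ (baseCoord hp)).2.2
  rw [FracStar.IsStarOp, forall_prop_of_true hfrac, key, hone, ← Subtype.ext_iff,
    (fracIso hp hfin hQ).injective.eq_iff, funext_iff]

omit [IsDomain D] [IsFractionRing D K] in
theorem isFracOf_of_one_eq_top (h1 : (1 : Submodule D K) = ⊤) (I : Submodule D K) :
    IsFracOf D K ⊥ I :=
  isFracOf_bot_iff.2 ⟨1, one_ne_zero, fun _ _ => h1 ▸ Submodule.mem_top⟩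

omit [IsDomain D] [IsFractionRing D K] in
/-- Over a field, all submodules are fractional ideals. -/
def fracStarIsoSemistar (h1 : (1 : Submodule D K) = ⊤) : Semistar D K ≃o FracStar D K ⊥ :=
  orderIsoOfSurjective
    (fun s =>
      { toFun := fun I => ⟨s.toFun I.1, isFracOf_of_one_eq_top h1 _⟩
        le_star' := fun I => s.le_star' I.1
        mono' := fun _ _ h => s.mono' h
        idem' := fun I => Subtype.ext (s.idem' I.1)
        smul' := fun x hx I _ hJ => (congrArg s.toFun hJ).trans (s.smul' x hx I.1) })
    (fun _ _ => ⟨fun h I => h ⟨I, isFracOf_of_one_eq_top h1 I⟩, fun h I => h I.1⟩)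
    fun f => ⟨
      { toFun := fun I => (f.toFun ⟨I, isFracOf_of_one_eq_top h1 I⟩).1
        le_star' := fun I => f.le_star' ⟨I, isFracOf_of_one_eq_top h1 I⟩
        mono' := fun _ _ h => f.mono' _ _ h
        idem' := fun I => congrArg Subtype.val (f.idem' ⟨I, isFracOf_of_one_eq_top h1 I⟩)
        smul' := fun x hx I => f.smul' x hx ⟨I, isFracOf_of_one_eq_top h1 I⟩ _ rfl },
      rfl⟩

omit [IsDomain D] [IsFractionRing D K] in
theorem FracStar.isStarOp_of_one_eq_top (h1 : (1 : Submodule D K) = ⊤) (f : FracStar D K ⊥) :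
    FracStar.IsStarOp D K f := fun h =>
  le_antisymm (le_top.trans_eq (Algebra.toSubmodule_bot.trans h1).symm)
    (f.le_star' ⟨Subalgebra.toSubmodule ⊥, h⟩)

end fractional

section congr
variable {D₁ : Type*} [CommRing D₁] [IsDomain D₁] {K₁ : Type*} [Field K₁] [Algebra D₁ K₁]
  [IsFractionRing D₁ K₁] {hp₁ : IsPrufer D₁ K₁} {Q₁ : hiSpec D₁}
  {D₂ : Type*} [CommRing D₂] [IsDomain D₂] {K₂ : Type*} [Field K₂] [Algebra D₂ K₂]
  [IsFractionRing D₂ K₂] {hp₂ : IsPrufer D₂ K₂} {Q₂ : hiSpec D₂}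

theorem exists_fracStar_orderIso (hfin₁ : (hiSpec D₁).Finite) (hQ₁ : Q₁.1 = ⊥)
    (hfin₂ : (hiSpec D₂).Finite) (hQ₂ : Q₂.1 = ⊥) {σ : Child Q₁ ≃ Child Q₂}
    (e : ∀ j, EqClosure (Grp hp₁ Q₁) (Coord hp₁ j) ≃o EqClosure (Grp hp₂ Q₂) (Coord hp₂ (σ j)))
    (he : ∀ j s, s (baseCoord hp₁ j) = baseCoord hp₁ j ↔
      e j s (baseCoord hp₂ (σ j)) = baseCoord hp₂ (σ j))
    (hmax : Q₁.1.IsMaximal ↔ Q₂.1.IsMaximal) :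
    ∃ φ : FracStar D₁ K₁ ⊥ ≃o FracStar D₂ K₂ ⊥, ∀ f : FracStar D₁ K₁ ⊥,
      FracStar.IsStarOp D₁ K₁ f ↔ FracStar.IsStarOp D₂ K₂ (φ f) := by
  rw [← one_eq_top_iff hp₁ hQ₁, ← one_eq_top_iff hp₂ hQ₂] at hmax
  by_cases h1 : (1 : Submodule D₁ K₁) = ⊤
  · exact ⟨(fracStarIsoSemistar h1).symm.trans ((semistarCongr hfin₁ hQ₁ hfin₂ hQ₂ e).trans
      (fracStarIsoSemistar (hmax.1 h1))), fun f => iff_of_true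
        (f.isStarOp_of_one_eq_top h1) (FracStar.isStarOp_of_one_eq_top (hmax.1 h1) _)⟩
  · have h2 := h1 ∘ hmax.2
    let E : (∀ j : Child Q₁, EqClosure (Grp hp₁ Q₁) (Coord hp₁ j)) ≃
        ∀ j : Child Q₂, EqClosure (Grp hp₂ Q₂) (Coord hp₂ j) :=
      Equiv.piCongr σ fun j => (e j).toEquiv
    have hE : ∀ f j, E f (σ j) = e j (f j) := fun f j => Equiv.piCongr_apply_apply σ
      (Z := fun j => EqClosure (Grp hp₂ Q₂) (Coord hp₂ j)) (fun j => (e j).toEquiv) f j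
    let ψ : (∀ j : Child Q₁, EqClosure (Grp hp₁ Q₁) (Coord hp₁ j)) ≃o
        ∀ j : Child Q₂, EqClosure (Grp hp₂ Q₂) (Coord hp₂ j) :=
      { E with
        map_rel_iff' := fun {f f'} => by
          refine σ.forall_congr_right.symm.trans (forall_congr' fun j => ?_)
          exact (iff_of_eq (congrArg₂ (· ≤ ·) (hE f j) (hE f' j))).trans (e j).le_iff_le }
    have hψ : ∀ f j, ψ f (σ j) = e j (f j) := hE
    refine ⟨(fracStarIso hp₁ hfin₁ hQ₁ h1).symm.trans
      (ψ.trans (fracStarIso hp₂ hfin₂ hQ₂ h2)), fun f => ?_⟩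
    obtain ⟨f, rfl⟩ := (fracStarIso hp₁ hfin₁ hQ₁ h1).surjective f
    rw [OrderIso.trans_apply, OrderIso.symm_apply_apply, OrderIso.trans_apply,
      isStarOp_fracStarIso_iff, isStarOp_fracStarIso_iff, ← σ.forall_congr_right]
    refine forall_congr' fun j => ?_
    rw [hψ]
    exact he j (f j)

end congr
end Paper

namespace Paper

/-- Under the hypotheses of the semistar theorem, if moreover
`M·(D₁)_M` is principal iff `ν(M)·(D₂)_{ν(M)}` is principal for every maximal ideal
`M` of `D₁`, then the order isomorphisms `𝛎` and `𝛎_F` restrict to order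
isomorphisms between the sets of (semi)star operations and between `Star(D₁)` and
`Star(D₂)`. -/
theorem statement11
    (D₁ : Type*) [CommRing D₁] [IsDomain D₁]
    (K₁ : Type*) [Field K₁] [Algebra D₁ K₁] [IsFractionRing D₁ K₁]
    (D₂ : Type*) [CommRing D₂] [IsDomain D₂]
    (K₂ : Type*) [Field K₂] [Algebra D₂ K₂] [IsFractionRing D₂ K₂]
    (hp₁ : IsPrufer D₁ K₁) (hsl₁ : IsSemilocal D₁)
    (hp₂ : IsPrufer D₂ K₂) (hsl₂ : IsSemilocal D₂)
    (ν : ↥(hiSpec D₁) ≃o ↥(hiSpec D₂))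
    (hK : Nonempty (AFracStar K₁ ≃o AFracStar K₂))
    (hZ : ∀ P Q : ↥(hiSpec D₁), DirectlyBelow D₁ Q.1 P.1 →
      Nonempty (AFracStar (Zring D₁ P.1 Q.1 (mem_hiSpec_prime P.2)) ≃o
        AFracStar (Zring D₂ (ν P).1 (ν Q).1 (mem_hiSpec_prime (ν P).2))))
    (hprinc : ∀ (M : Ideal D₁) (hM : M.IsMaximal),
      (Ideal.map (algebraMap D₁ (locRing D₁ M hM.isPrime)) M).IsPrincipal ↔
        (Ideal.map (algebraMap D₂ (locRing D₂ (ν ⟨M, maximal_mem_hiSpec hM⟩).1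
            (mem_hiSpec_prime (ν ⟨M, maximal_mem_hiSpec hM⟩).2)))
          (ν ⟨M, maximal_mem_hiSpec hM⟩).1).IsPrincipal) :
    ∃ (bnu : Semistar D₁ K₁ ≃o Semistar D₂ K₂)
      (bnuF : FracStar D₁ K₁ ⊥ ≃o FracStar D₂ K₂ ⊥)
      (νbar : ↥(SkOver D₁ K₁) ≃o ↥(SkOver D₂ K₂)),
      (∀ T : ↥(SkOver D₁ K₁), T.1 ∈ stdDecomp D₁ K₁ ↔ (νbar T).1 ∈ stdDecomp D₂ K₂) ∧
      (∀ Δ : Set (Subalgebra D₁ K₁), Δ ⊆ SkOver D₁ K₁ →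
        (⇑bnu) '' {s | supp D₁ K₁ s = Δ} =
          {s | supp D₂ K₂ s =
            (fun A : ↥(SkOver D₁ K₁) => (νbar A).1) '' {A | A.1 ∈ Δ}}) ∧
      (∀ s : Semistar D₁ K₁, s.toFun 1 = 1 ↔ (bnu s).toFun 1 = 1) ∧
      (∀ f : FracStar D₁ K₁ ⊥,
        FracStar.IsStarOp D₁ K₁ f ↔ FracStar.IsStarOp D₂ K₂ (bnuF f)) := by

  have hfin₁ := hiSpec_finite hp₁ hsl₁
  have hfin₂ := hiSpec_finite hp₂ hsl₂
  have hprinc' : ∀ P : hiSpec D₁, P.1.IsMaximal →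
      ((valAt hp₁ P.1).Principal ↔ (valAt hp₂ (ν P).1).Principal) := fun P hP =>
    (isPrincipal_map_iff hp₁).symm.trans ((hprinc P.1 hP).trans (isPrincipal_map_iff hp₂))
  let Q : hiSpec D₁ := ⟨⊥, Ideal.isPrime_bot, Or.inl rfl⟩
  have hQ₁ : Q.1 = ⊥ := rfl
  have hQ₂ : (ν Q).1 = ⊥ := by
    obtain ⟨P, hP⟩ := ν.surjective ⟨⊥, Ideal.isPrime_bot, Or.inl rfl⟩
    have : ν Q ≤ ν P := ν.monotone (bot_le (a := P.1))
    rw [hP] at this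
    exact le_bot_iff.1 this
  choose e he using fun j : Child Q =>
    exists_coord_iso ν hZ hprinc' j (exists_win_iso hfin₁ hfin₂ ν hZ hprinc' j.1)
  have hmax := isMaximal_map_iff ν Q
  obtain ⟨φ, hφ⟩ := exists_fracStar_orderIso hfin₁ hQ₁ hfin₂ hQ₂ e he hmax
  exact ⟨semistarCongr hfin₁ hQ₁ hfin₂ hQ₂ e, φ,
    skOverCongr hfin₁ hQ₁ hfin₂ hQ₂ hp₁ hp₂ (childCongr ν Q),
    fun A => skOverCongr_mem_stdDecomp_iff hfin₁ hQ₁ hfin₂ hQ₂ hp₁ hp₂ A,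
    fun Δ hΔ => semistarCongr_image_supp hfin₁ hQ₁ hfin₂ hQ₂ e Δ hΔ,
    fun s => semistarCongr_one hfin₁ hQ₁ hfin₂ hQ₂ e he hmax s, hφ⟩

end Paper
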